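/- For every integer D > 0 with D ≡ 0 or 1 (mod 4), one has ∑_{x,y∈ℤ, x≡D (mod 2)} H(D−x²−y²) = −5·L_D(−1) + ∑_{(a,b,c)∈ℤ³, b²−4ac=D, a+c>0>a} (a+c) − (1/12)·δ_{D=□}·(6D+1), where δ_{D=□} equals 1 if D is a perfect square and 0 otherwise; both sums have only finitely many nonzero terms. -/

import Mathlib

/-!
STATEMENT 3: For every integer D > 0 with D ≡ 0 or 1 (mod 4),
∑_{x,y∈ℤ, x≡D (mod 2)} H(D−x²−y²)
  = −5·L_D(−1) + ∑_{(a,b,c)∈ℤ³, b²−4ac=D, a+c>0>a} (a+c) − (1/12)·δ_{D=□}·(6D+1),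
where δ_{D=□} = 1 if D is a perfect square and 0 otherwise, and both sums have only finitely
many nonzero terms.  Here H is the Hurwitz class number and
L_D(−1) = L_{D₀}(−1)·∑_{d∣f} μ(d)χ_{D₀}(d)·d·σ₃(f/d) for the decomposition D = D₀f² with D₀
a fundamental discriminant, χ_{D₀} the Kronecker symbol (D₀/·) as a Dirichlet character
mod |D₀|, and L_{D₀} the analytic continuation of its Dirichlet L-series.
-/

open Complex

/-- Integral binary quadratic forms [a,b,c] are represented as triples (a,b,c) ∈ ℤ³,
with Q(x,y) = ax² + bxy + cy² and discriminant b² − 4ac. -/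
def qfAct (g : Matrix.SpecialLinearGroup (Fin 2) ℤ) (Q : ℤ × ℤ × ℤ) : ℤ × ℤ × ℤ :=
  ((Q.1 * (g.1 0 0) ^ 2 + Q.2.1 * (g.1 0 0) * (g.1 0 1) + Q.2.2 * (g.1 0 1) ^ 2),
   (2 * Q.1 * (g.1 0 0) * (g.1 1 0) + Q.2.1 * ((g.1 0 0) * (g.1 1 1) + (g.1 0 1) * (g.1 1 0)) +
      2 * Q.2.2 * (g.1 0 1) * (g.1 1 1)),
   (Q.1 * (g.1 1 0) ^ 2 + Q.2.1 * (g.1 1 0) * (g.1 1 1) + Q.2.2 * (g.1 1 1) ^ 2))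

/-- SL₂(ℤ)-equivalence of integral binary quadratic forms. -/
def qfRel (Q₁ Q₂ : ℤ × ℤ × ℤ) : Prop := ∃ g : Matrix.SpecialLinearGroup (Fin 2) ℤ, qfAct g Q₁ = Q₂

/-- The set of SL₂(ℤ)-classes of positive definite integral binary quadratic forms of
discriminant −n. -/
def qfClasses (n : ℤ) : Set (Quot qfRel) :=
  {q | ∃ Q : ℤ × ℤ × ℤ, Quot.mk qfRel Q = q ∧ Q.2.1 ^ 2 - 4 * Q.1 * Q.2.2 = -n ∧ 0 < Q.1}

/-- The Hurwitz class number H(n): H(0) = −1/12; for n > 0 with n ≡ 0, 3 (mod 4), H(n) is the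
number of SL₂(ℤ)-classes of positive definite integral binary quadratic forms of discriminant
−n, where the class containing a multiple of x²+y² is counted with weight 1/2 and the class
containing a multiple of x²+xy+y² with weight 1/3; H(n) = 0 otherwise. -/
noncomputable def hurwitzH (n : ℤ) : ℝ :=
  if n = 0 then -(1 / 12)
  else if 0 < n ∧ (n % 4 = 0 ∨ n % 4 = 3) then
    ((qfClasses n).ncard : ℝ)
      - 1 / 2 * (({q ∈ qfClasses n | ∃ k : ℤ, Quot.mk qfRel (k, 0, k) = q}).ncard : ℝ)
      - 2 / 3 * (({q ∈ qfClasses n | ∃ k : ℤ, Quot.mk qfRel (k, k, k) = q}).ncard : ℝ)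
  else 0

/-- The Kronecker symbol (a/n) for a positive natural number n (and (a/0) = 1 iff a = ±1),
defined multiplicatively: the Jacobi symbol on the odd part of n, together with the factor
(a/2)^(v₂(n)), where (a/2) = 0 for even a, 1 for a ≡ ±1 (mod 8), −1 for a ≡ ±3 (mod 8). -/
def kroneckerSym (a : ℤ) (n : ℕ) : ℤ :=
  if n = 0 then (if a.natAbs = 1 then 1 else 0)
  else
    (if a % 2 = 0 then 0 else if a % 8 = 1 ∨ a % 8 = 7 then 1 else -1) ^ (n.factorization 2) *
      jacobiSym a (n / 2 ^ (n.factorization 2))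

/-- A fundamental discriminant: either d ≡ 1 (mod 4) and squarefree (this includes d = 1),
or d = 4m with m squarefree and m ≡ 2, 3 (mod 4). -/
def IsFundamentalDiscriminant (d : ℤ) : Prop :=
  (d % 4 = 1 ∧ Squarefree d) ∨
    (d % 4 = 0 ∧ Squarefree (d / 4) ∧ ((d / 4) % 4 = 2 ∨ (d / 4) % 4 = 3))

namespace ClassNumberRelation

/-- Quadruples `(A, B, C, D)` with `A D + B C = n`, `C > 0`, whose perturbation
`(A, B - η A, C, D + η C)` satisfies `P`. -/
def quads (n : ℤ) (η : ℝ) (P : ℝ → ℝ → ℝ → ℝ → Prop) : Set (ℤ × ℤ × ℤ × ℤ) :=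
  {p | p.1 * p.2.2.2 + p.2.1 * p.2.2.1 = n ∧ 0 < p.2.2.1 ∧
    P p.1 (p.2.1 - η * p.1) p.2.2.1 (p.2.2.2 + η * p.2.2.1)}

def PG (a b c d : ℝ) : Prop := a - c < d ∧ d < a + c ∧ c < b
def PL₁ (a b c d : ℝ) : Prop := a < c ∧ d < a - c ∧ b * (a - c) < c * d
def PL₂ (a b c d : ℝ) : Prop := -c < a ∧ a + c < d ∧ c * d < b * (a + c)
def PR₁ (a b c d : ℝ) : Prop := c < a ∧ a - c < d ∧ c * d < b * (a - c)
def PR₂ (a b c d : ℝ) : Prop := a < -c ∧ d < a + c ∧ b * (a + c) < c * d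
def PR₃ (a b c d : ℝ) : Prop := c < b ∧ (a - c) * b < d * c ∧ d * c < (a + c) * b

lemma cells_iff {a b c d : ℝ} (hc : 0 < c) (h1 : d ≠ a - c) (h2 : d ≠ a + c)
    (h3 : c * d ≠ b * (a - c)) (h4 : c * d ≠ b * (a + c)) :
    (PG a b c d ∨ PL₁ a b c d ∨ PL₂ a b c d) ↔ (PR₁ a b c d ∨ PR₂ a b c d ∨ PR₃ a b c d) := by
  unfold PG PL₁ PL₂ PR₁ PR₂ PR₃
  constructor
  · rintro (⟨h, h', h''⟩ | ⟨h, h', h''⟩ | ⟨h, h', h''⟩)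
    · by_cases k1 : c * d < b * (a - c)
      · left; refine ⟨?_, h, k1⟩
        by_contra! hh
        nlinarith [mul_nonneg (sub_nonneg.2 hh) (sub_pos.2 h'').le, mul_pos hc (sub_pos.2 h)]
      · by_cases k2 : b * (a + c) < c * d
        · right; left; refine ⟨?_, h', k2⟩
          by_contra! hh
          nlinarith [mul_nonneg (by linarith : 0 ≤ a + c) (sub_pos.2 h'').le,
            mul_pos hc (sub_pos.2 h')]
        · right; right
          refine ⟨h'', ?_, ?_⟩
          · have := lt_of_le_of_ne (not_lt.1 k1) (Ne.symm h3); linarith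
          · have := lt_of_le_of_ne (not_lt.1 k2) h4; linarith
    · have hb : c < b := by
        by_contra! hh
        nlinarith [mul_nonneg (sub_pos.2 h).le (sub_nonneg.2 hh), mul_pos hc (sub_pos.2 h')]
      by_cases k2 : b * (a + c) < c * d
      · right; left
        refine ⟨?_, by linarith, k2⟩
        by_contra! hh
        nlinarith [mul_nonneg (by linarith : 0 ≤ a + c) (by linarith : 0 ≤ b),
          mul_pos hc (sub_pos.2 h), mul_pos hc (sub_pos.2 h')]
      · right; right
        have := lt_of_le_of_ne (not_lt.1 k2) h4
        exact ⟨hb, by linarith, by linarith⟩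
    · have hb : c < b := by
        by_contra! hh
        nlinarith [mul_nonneg (by linarith : 0 ≤ a + c) (sub_nonneg.2 hh),
          mul_pos hc (sub_pos.2 h')]
      by_cases k1 : c * d < b * (a - c)
      · left
        refine ⟨?_, by linarith, k1⟩
        by_contra! hh
        nlinarith [mul_nonneg (sub_nonneg.2 hh) (by linarith : 0 ≤ b),
          mul_pos hc (by linarith : 0 < a + c), mul_pos hc (sub_pos.2 h')]
      · right; right
        have := lt_of_le_of_ne (not_lt.1 k1) (Ne.symm h3)
        exact ⟨hb, by linarith, by linarith⟩
  · rintro (⟨h, h', h''⟩ | ⟨h, h', h''⟩ | ⟨h, h', h''⟩)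
    · have hb : c < b := by
        by_contra! hh
        nlinarith [mul_nonneg (sub_pos.2 h).le (sub_nonneg.2 hh), mul_pos hc (sub_pos.2 h')]
      rcases lt_or_gt_of_ne h2 with k | k
      · exact Or.inl ⟨h', k, hb⟩
      · right; right; exact ⟨by linarith, k, by nlinarith⟩
    · have hb : c < b := by
        by_contra! hh
        nlinarith [mul_nonneg (by linarith : 0 ≤ -a - c) (sub_nonneg.2 hh),
          mul_pos hc (sub_pos.2 h')]
      rcases lt_or_gt_of_ne h1 with k | k
      · right; left; exact ⟨by linarith, k, by nlinarith⟩
      · exact Or.inl ⟨k, h', hb⟩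
    · rcases lt_or_gt_of_ne h1 with k | k
      · right; left
        refine ⟨?_, k, by linarith⟩
        by_contra! hh
        nlinarith [mul_nonneg (sub_nonneg.2 hh) (sub_pos.2 h).le, mul_pos hc (sub_pos.2 k)]
      · rcases lt_or_gt_of_ne h2 with k2 | k2
        · exact Or.inl ⟨k, k2, h⟩
        · right; right
          refine ⟨?_, k2, by linarith⟩
          by_contra! hh
          nlinarith [mul_nonneg (by linarith : 0 ≤ -a - c) (sub_pos.2 h).le,
            mul_pos hc (sub_pos.2 k2)]

variable {n : ℤ} {η : ℝ}

lemma no_tie (hη : Irrational η) {p q : ℤ} (h : (p : ℝ) + q * η = 0) : q = 0 := by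
  by_contra hq
  apply hη
  refine ⟨-p / q, ?_⟩
  push_cast
  have : (q : ℝ) ≠ 0 := by exact_mod_cast hq
  field_simp
  linarith

lemma quads_cells_eq (hη : Irrational η) :
    quads n η PG ∪ quads n η PL₁ ∪ quads n η PL₂ =
      quads n η PR₁ ∪ quads n η PR₂ ∪ quads n η PR₃ := by
  ext ⟨A, B, C, D⟩
  by_cases hC : 0 < C
  · have hC' : (0 : ℝ) < C := by exact_mod_cast hC
    have key := @cells_iff A (B - η * A) C (D + η * C) hC' ?_ ?_ ?_ ?_
    · simp only [quads, Set.mem_union, Set.mem_ofPred_eq]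
      tauto
    · intro h
      have := @no_tie η hη (D - A + C) C (by push_cast; linarith)
      omega
    · intro h
      have := @no_tie η hη (D - A - C) C (by push_cast; linarith)
      omega
    · intro h
      have := @no_tie η hη (C * D - B * (A - C)) (C ^ 2 + A * (A - C)) (by push_cast; linarith)
      nlinarith [sq_nonneg (2 * A - C), sq_pos_of_pos hC]
    · intro h
      have := @no_tie η hη (C * D - B * (A + C)) (C ^ 2 + A * (A + C)) (by push_cast; linarith)
      nlinarith [sq_nonneg (2 * A + C), sq_pos_of_pos hC]
  · simp [quads, hC]

/-- The shear `(A, B, C, D) ↦ (A + 2C, B - 2D, C, D)`. -/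
def shear : ℤ × ℤ × ℤ × ℤ ≃ ℤ × ℤ × ℤ × ℤ where
  toFun p := (p.1 + 2 * p.2.2.1, p.2.1 - 2 * p.2.2.2, p.2.2.1, p.2.2.2)
  invFun p := (p.1 - 2 * p.2.2.1, p.2.1 + 2 * p.2.2.2, p.2.2.1, p.2.2.2)
  left_inv p := by simp
  right_inv p := by simp

def flip₂ : ℤ × ℤ × ℤ × ℤ ≃ ℤ × ℤ × ℤ × ℤ where
  toFun p := (-p.2.2.1, p.2.2.2, p.1 + p.2.2.1, p.2.2.2 - p.2.1)
  invFun p := (p.2.2.1 + p.1, p.2.1 - p.2.2.2, -p.1, p.2.1)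
  left_inv p := by simp
  right_inv p := by simp

def flip₁ : ℤ × ℤ × ℤ × ℤ ≃ ℤ × ℤ × ℤ × ℤ where
  toFun p := (p.2.2.1, -p.2.2.2, p.2.2.1 - p.1, p.2.1 + p.2.2.2)
  invFun p := (p.1 - p.2.2.1, p.2.2.2 + p.2.1, p.1, -p.2.1)
  left_inv p := by simp
  right_inv p := by simp

lemma quads_PL₂_eq (hη : Irrational η) :
    quads n η PL₂ = shear ⁻¹' quads n η PR₁ ∪ flip₂ ⁻¹' (quads n η PR₃ ∩ {p | p.1 < 0}) := by
  ext ⟨A, B, C, D⟩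
  simp only [quads, shear, flip₂, Equiv.coe_fn_mk, Set.mem_union, Set.mem_preimage,
    Set.mem_inter_iff, Set.mem_ofPred_eq, PL₂, PR₁, PR₃]
  push_cast
  rcases le_or_gt C 0 with hC | hC
  · constructor
    · rintro ⟨-, h, -⟩; omega
    · rintro (⟨-, h, -⟩ | ⟨-, h⟩) <;> omega
  have hC' : (0 : ℝ) < C := by exact_mod_cast hC
  have e1 : (A + 2 * C) * D + (B - 2 * D) * C = A * D + B * C := by ring
  have e2 : -C * (D - B) + D * (A + C) = A * D + B * C := by ring
  rw [e1, e2]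
  by_cases hn : A * D + B * C = n
  swap
  · simp [hn]
  simp only [hn, hC, true_and]
  have e3 : (B : ℝ) - 2 * D - η * (A + 2 * C) = (B - η * A) - 2 * (D + η * C) := by ring
  have e4 : (D : ℝ) - η * -C = D + η * C := by ring
  have e5 : (D : ℝ) - B + η * (A + C) = (D + η * C) - (B - η * A) := by ring
  rw [e3, e4, e5]
  have tie : (2 * A + 3 * C) * (D + η * C) ≠ (B - η * A) * (A + C) := by
    intro h
    have := @no_tie η hη ((2 * A + 3 * C) * D - B * (A + C)) ((2 * A + 3 * C) * C + A * (A + C))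
      (by push_cast; linarith)
    nlinarith [sq_nonneg (2 * A + 3 * C), sq_pos_of_pos hC]
  have e6 : (0 < A + C) ↔ (-(C : ℝ) < A) := by
    rw [← Int.cast_pos (R := ℝ)]; push_cast; constructor <;> intro <;> linarith
  rw [e6]
  generalize (B : ℝ) - η * A = b at *
  generalize (D : ℝ) + η * C = d at *
  generalize (A : ℝ) = a at *
  constructor
  · rintro ⟨h1, h2, h3⟩
    rcases lt_or_gt_of_ne tie with k | k
    · left; exact ⟨by linarith, by linarith, by nlinarith⟩
    · right; exact ⟨⟨h1, by linarith, by nlinarith, by nlinarith⟩, by omega⟩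
  · rintro (⟨h1, h2, h3⟩ | ⟨⟨h1, h2, h3, h4⟩, -⟩)
    · have := mul_pos (by linarith : 0 < a + C) (by linarith : 0 < d)
      exact ⟨by linarith, by linarith, by nlinarith⟩
    · exact ⟨by linarith, by linarith, by nlinarith⟩

lemma quads_PL₁_eq (hη : Irrational η) :
    quads n η PL₁ =
      shear.symm ⁻¹' quads n η PR₂ ∪ flip₁ ⁻¹' (quads n η PR₃ ∩ {p | 0 < p.1}) := by
  ext ⟨A, B, C, D⟩
  simp only [quads, shear, flip₁, Equiv.coe_fn_mk, Equiv.coe_fn_symm_mk, Set.mem_union,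
    Set.mem_preimage, Set.mem_inter_iff, Set.mem_ofPred_eq, PL₁, PR₂, PR₃]
  push_cast
  rcases le_or_gt C 0 with hC | hC
  · constructor
    · rintro ⟨-, h, -⟩; omega
    · rintro (⟨-, h, -⟩ | ⟨-, h⟩) <;> omega
  have hC' : (0 : ℝ) < C := by exact_mod_cast hC
  have e1 : (A - 2 * C) * D + (B + 2 * D) * C = A * D + B * C := by ring
  have e2 : C * (B + D) + -D * (C - A) = A * D + B * C := by ring
  rw [e1, e2]
  by_cases hn : A * D + B * C = n
  swap
  · simp [hn]
  simp only [hn, hC, true_and]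
  have e3 : (B : ℝ) + 2 * D - η * (A - 2 * C) = (B - η * A) + 2 * (D + η * C) := by ring
  have e4 : -(D : ℝ) - η * C = -(D + η * C) := by ring
  have e5 : (B : ℝ) + D + η * (C - A) = (D + η * C) + (B - η * A) := by ring
  rw [e3, e4, e5]
  have tie : (3 * C - 2 * A) * (D + η * C) ≠ (B - η * A) * (A - C) := by
    intro h
    have := @no_tie η hη ((3 * C - 2 * A) * D - B * (A - C)) ((3 * C - 2 * A) * C + A * (A - C))
      (by push_cast; linarith)
    nlinarith [sq_nonneg (2 * A - 3 * C), sq_pos_of_pos hC]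
  have e6 : (0 < C - A) ↔ ((A : ℝ) < C) := by
    rw [← Int.cast_pos (R := ℝ)]; push_cast; constructor <;> intro <;> linarith
  rw [e6]
  generalize (B : ℝ) - η * A = b at *
  generalize (D : ℝ) + η * C = d at *
  generalize (A : ℝ) = a at *
  constructor
  · rintro ⟨h1, h2, h3⟩
    rcases lt_or_gt_of_ne tie with k | k
    · right; exact ⟨⟨h1, by linarith, by nlinarith, by nlinarith⟩, trivial⟩
    · left; exact ⟨by linarith, by linarith, by nlinarith⟩
  · rintro (⟨h1, h2, h3⟩ | ⟨⟨h1, h2, h3, h4⟩, -⟩)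
    · have := mul_pos (by linarith : 0 < C - a) (by linarith : 0 < -d)
      exact ⟨by linarith, by linarith, by nlinarith⟩
    · exact ⟨by linarith, by linarith, by nlinarith⟩

end ClassNumberRelation

namespace ClassNumberRelation
variable {n : ℤ} {η : ℝ}

lemma PL₁_bounds {a b c d n : ℝ} (hn : a * d + b * c = n) (hn1 : 1 ≤ n) (hc : 1 ≤ c)
    (h : PL₁ a b c d) :
    |a| ≤ 4 * n ^ 2 ∧ |b| ≤ 4 * n ^ 2 ∧ |c| ≤ 4 * n ^ 2 ∧ |d| ≤ 4 * n ^ 2 := by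
  obtain ⟨h1, h2, h3⟩ := h
  have hb : c < b := by
    by_contra! hh
    nlinarith [mul_nonneg (sub_pos.2 h1).le (sub_nonneg.2 hh),
      mul_pos (by linarith : 0 < c) (sub_pos.2 h2)]
  have hnn : n ≤ n ^ 2 := by nlinarith
  rcases le_or_gt a 0 with ha | ha
  · have had : 0 ≤ a * d := mul_nonneg_of_nonpos_of_nonpos ha (by linarith)
    have hbn : b ≤ n := by nlinarith
    have hcn : c ≤ n := by linarith
    have haa : a ^ 2 ≤ n := by nlinarith
    have ha' : -a ≤ n := by nlinarith
    have hd : -d ≤ 2 * n ^ 2 := by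
      have : c * (-d) < b * (c - a) := by linarith
      have h5 : b * (c - a) ≤ n * (n + n) := mul_le_mul hbn (by linarith) (by linarith)
        (by linarith)
      nlinarith
    refine ⟨?_, ?_, ?_, ?_⟩ <;> rw [abs_le] <;> constructor <;> linarith
  · have h4 : b * (a ^ 2 - a * c + c ^ 2) < n * c := by nlinarith
    have h5 : b * c * 3 < 4 * n := by
      by_contra! hh
      nlinarith [mul_nonneg (by linarith : 0 ≤ b) (sq_nonneg (2 * a - c)),
        mul_nonneg (by linarith : 0 ≤ c) (sub_nonneg.2 hh)]
    have hbn : b * 3 < 4 * n := by nlinarith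
    have hd : -d < b := by
      have : c * (-d) < b * (c - a) := by linarith
      have : b * (c - a) < b * c := by nlinarith
      nlinarith
    refine ⟨?_, ?_, ?_, ?_⟩ <;> rw [abs_le] <;> constructor <;> linarith

lemma PL₂_bounds {a b c d n : ℝ} (hn : a * d + b * c = n) (hn1 : 1 ≤ n) (hc : 1 ≤ c)
    (h : PL₂ a b c d) :
    |a| ≤ 4 * n ^ 2 ∧ |b| ≤ 4 * n ^ 2 ∧ |c| ≤ 4 * n ^ 2 ∧ |d| ≤ 4 * n ^ 2 := by
  have := @PL₁_bounds (-a) b c (-d) n (by linarith) hn1 hc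
    ⟨by linarith [h.1], by linarith [h.2.1], by linarith [h.2.2]⟩
  simpa only [abs_neg] using this

lemma finite_of_bounds {S : Set (ℤ × ℤ × ℤ × ℤ)} (η : ℝ) (K : ℝ)
    (h : ∀ p ∈ S, |(p.1 : ℝ)| ≤ K ∧ |(p.2.1 : ℝ) - η * p.1| ≤ K ∧ |(p.2.2.1 : ℝ)| ≤ K ∧
      |(p.2.2.2 : ℝ) + η * p.2.2.1| ≤ K) : S.Finite := by
  let M : ℤ := ⌈K + |η| * K⌉
  refine ((Set.finite_Icc (-M) M).prod ((Set.finite_Icc (-M) M).prod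
    ((Set.finite_Icc (-M) M).prod (Set.finite_Icc (-M) M)))).subset ?_
  rintro ⟨A, B, C, D⟩ hp
  obtain ⟨h1, h2, h3, h4⟩ := h _ hp
  simp only at h1 h2 h3 h4
  have hM : K + |η| * K ≤ M := Int.le_ceil _
  have hK : 0 ≤ |η| * K := mul_nonneg (abs_nonneg _) ((abs_nonneg _).trans h1)
  have k2 : |η * A| ≤ |η| * K := by
    rw [abs_mul]; exact mul_le_mul_of_nonneg_left h1 (abs_nonneg _)
  have k4 : |η * C| ≤ |η| * K := by
    rw [abs_mul]; exact mul_le_mul_of_nonneg_left h3 (abs_nonneg _)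
  rw [abs_le] at h1 h2 h3 h4 k2 k4
  simp only [Set.mem_prod, Set.mem_Icc]
  refine ⟨⟨?_, ?_⟩, ⟨?_, ?_⟩, ⟨?_, ?_⟩, ⟨?_, ?_⟩⟩ <;>
    (rw [← Int.cast_le (R := ℝ)]; push_cast; linarith)

lemma quads_real_det (p : ℤ × ℤ × ℤ × ℤ) (h : p.1 * p.2.2.2 + p.2.1 * p.2.2.1 = n) :
    (p.1 : ℝ) * (p.2.2.2 + η * p.2.2.1) + (p.2.1 - η * p.1) * p.2.2.1 = n := by
  rw [← h]; push_cast; ring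

lemma quads_PL₁_finite (hn : 1 ≤ n) : (quads n η PL₁).Finite := by
  refine finite_of_bounds η (4 * (n : ℝ) ^ 2) ?_
  rintro p ⟨h1, h2, h3⟩
  exact PL₁_bounds (quads_real_det p h1) (by exact_mod_cast hn) (by exact_mod_cast h2) h3

lemma quads_PL₂_finite (hn : 1 ≤ n) : (quads n η PL₂).Finite := by
  refine finite_of_bounds η (4 * (n : ℝ) ^ 2) ?_
  rintro p ⟨h1, h2, h3⟩
  exact PL₂_bounds (quads_real_det p h1) (by exact_mod_cast hn) (by exact_mod_cast h2) h3

lemma quads_disjoint {P Q : ℝ → ℝ → ℝ → ℝ → Prop}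
    (h : ∀ a b c d, 0 < c → P a b c d → Q a b c d → False) :
    Disjoint (quads n η P) (quads n η Q) := by
  rw [Set.disjoint_left]
  rintro p ⟨-, h2, h3⟩ ⟨-, -, h3'⟩
  exact h _ _ _ _ (by exact_mod_cast h2) h3 h3'

lemma encard_quads_PG (hη : Irrational η) (hn : 1 ≤ n) :
    (quads n η PG).encard = (quads n η PR₃ ∩ {p | p.1 = 0}).encard := by
  have d1 : Disjoint (quads n η PG) (quads n η PL₁) := quads_disjoint fun a b c d _ h h' => by
    have := h.1; have := h'.2.1; linarith
  have d2 : Disjoint (quads n η PG ∪ quads n η PL₁) (quads n η PL₂) :=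
    Set.disjoint_union_left.2 ⟨quads_disjoint fun a b c d _ h h' => by
      have := h.2.1; have := h'.2.1; linarith, quads_disjoint fun a b c d _ h h' => by
      have := h.2.1; have := h'.2.1; linarith⟩
  have d3 : Disjoint (quads n η PR₁) (quads n η PR₂) := quads_disjoint fun a b c d _ h h' => by
    have := h.1; have := h'.1; linarith
  have d4 : Disjoint (quads n η PR₁ ∪ quads n η PR₂) (quads n η PR₃) :=
    Set.disjoint_union_left.2 ⟨quads_disjoint fun a b c d _ h h' => by
      have := h.2.2; have := h'.2.1; linarith, quads_disjoint fun a b c d _ h h' => by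
      have := h.2.2; have := h'.2.2; linarith⟩
  have e := congrArg Set.encard (quads_cells_eq (n := n) hη)
  rw [Set.encard_union_eq d2, Set.encard_union_eq d1, Set.encard_union_eq d4,
    Set.encard_union_eq d3] at e
  set R := quads n η PR₃ with hR
  have hsplit : R.encard = (R ∩ {p | p.1 = 0}).encard + (R ∩ {p | 0 < p.1}).encard +
      (R ∩ {p | p.1 < 0}).encard := by
    rw [← Set.encard_union_eq, ← Set.encard_union_eq]
    · congr 1
      ext p
      simp only [Set.mem_union, Set.mem_inter_iff, Set.mem_ofPred_eq]
      have := lt_trichotomy p.1 0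
      tauto
    · rw [Set.disjoint_left]; rintro p (⟨-, h⟩ | ⟨-, h⟩) ⟨-, h'⟩ <;>
      simp only [Set.mem_ofPred_eq] at h h' <;> omega
    · rw [Set.disjoint_left]; rintro p ⟨-, h⟩ ⟨-, h'⟩
      simp only [Set.mem_ofPred_eq] at h h'; omega
  have l1 : (quads n η PL₁).encard = (quads n η PR₂).encard + (R ∩ {p | 0 < p.1}).encard := by
    rw [quads_PL₁_eq hη, Set.encard_union_eq, Set.encard_preimage_of_bijective shear.symm.bijective,
      Set.encard_preimage_of_bijective flip₁.bijective]
    rw [Set.disjoint_left]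
    rintro ⟨A, B, C, D⟩ ⟨-, h0, h1, h2, h3⟩ ⟨⟨-, -, k1, k2, k3⟩, -⟩
    simp only [shear, flip₁, Equiv.coe_fn_mk, Equiv.coe_fn_symm_mk] at h0 h1 h2 h3 k1 k2 k3
    push_cast at h0 h1 h2 h3 k1 k2 k3
    nlinarith
  have l2 : (quads n η PL₂).encard = (quads n η PR₁).encard + (R ∩ {p | p.1 < 0}).encard := by
    rw [quads_PL₂_eq hη, Set.encard_union_eq, Set.encard_preimage_of_bijective shear.bijective,
      Set.encard_preimage_of_bijective flip₂.bijective]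
    rw [Set.disjoint_left]
    rintro ⟨A, B, C, D⟩ ⟨-, h0, h1, h2, h3⟩ ⟨⟨-, -, k1, k2, k3⟩, -⟩
    simp only [shear, flip₂, Equiv.coe_fn_mk] at h0 h1 h2 h3 k1 k2 k3
    push_cast at h0 h1 h2 h3 k1 k2 k3
    nlinarith
  have f1 : (quads n η PL₁).encard ≠ ⊤ := Set.encard_ne_top_iff.2 (quads_PL₁_finite hn)
  have f2 : (quads n η PL₂).encard ≠ ⊤ := Set.encard_ne_top_iff.2 (quads_PL₂_finite hn)
  have e' : (quads n η PG).encard + ((quads n η PL₁).encard + (quads n η PL₂).encard) =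
      (R ∩ {p | p.1 = 0}).encard + ((quads n η PL₁).encard + (quads n η PL₂).encard) := by
    rw [← add_assoc, e, hsplit, l1, l2]
    abel
  have f3 : (quads n η PL₁).encard + (quads n η PL₂).encard ≠ ⊤ := by
    simp [f1, f2]
  exact (ENat.add_left_injective_of_ne_top f3) e'

/-- The quadruples `(A, B, C, D)` with `A D + B C = n`, `|A - D| ≤ C ≤ B`, up to boundary
identifications. -/
def reducedQuads (n : ℤ) : Set (ℤ × ℤ × ℤ × ℤ) :=
  {p | p.1 * p.2.2.2 + p.2.1 * p.2.2.1 = n ∧ 0 < p.2.2.1 ∧ -p.2.2.1 < p.1 - p.2.2.2 ∧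
    p.1 - p.2.2.2 ≤ p.2.2.1 ∧ (p.2.2.1 < p.2.1 ∨ p.2.2.1 = p.2.1 ∧ p.1 < 0)}

lemma reduced_bounds {A B C D : ℤ} (hn : A * D + B * C = n) (hC : 0 < C) (h1 : -C ≤ A - D)
    (h2 : A - D ≤ C) (h3 : C ≤ B) : C ≤ 2 * n ∧ |A| ≤ 2 * n ∧ |D| ≤ 2 * n ∧ B ≤ 2 * n := by
  have e : 3 * C ^ 2 + (A + D) ^ 2 ≤ 4 * n := by nlinarith
  have hn1 : 1 ≤ n := by nlinarith [sq_nonneg (A + D)]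
  have hC2 : C ≤ 2 * n := by nlinarith [sq_nonneg (A + D)]
  have hs : |A + D| ≤ 2 * n := abs_le_of_sq_le_sq (by nlinarith) (by linarith)
  have hB : B ≤ 2 * n := by nlinarith [sq_nonneg (A + D), mul_nonneg hC.le (by linarith : 0 ≤ B - C)]
  rw [abs_le] at hs
  simp only [abs_le]
  refine ⟨hC2, ⟨?_, ?_⟩, ⟨?_, ?_⟩, hB⟩ <;> linarith

lemma abs_mul_small {n : ℤ} {η : ℝ} (h0 : 0 < η) (h1 : η * (4 * n) < 1) {A : ℝ}
    (hA : |A| ≤ 2 * n) : -(1 / 2) < η * A ∧ η * A < 1 / 2 := by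
  rw [abs_le] at hA
  constructor <;> nlinarith

lemma quads_PG_eq (hn : 1 ≤ n) (h0 : 0 < η) (h1 : η * (4 * n) < 1) :
    quads n η PG = reducedQuads n := by
  ext ⟨A, B, C, D⟩
  simp only [quads, reducedQuads, PG, Set.mem_ofPred_eq]
  have hn' : (1 : ℝ) ≤ n := by exact_mod_cast hn
  constructor
  · rintro ⟨hdet, hC, k1, k2, k3⟩
    have hC' : (1 : ℝ) ≤ C := by exact_mod_cast hC
    have hdet' := quads_real_det (η := η) (A, B, C, D) hdet
    simp only at hdet'
    set b := (B : ℝ) - η * A with hb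
    set d := (D : ℝ) + η * C with hd
    have e : 3 * (C : ℝ) ^ 2 + (A + d) ^ 2 ≤ 4 * n := by
      nlinarith [mul_pos (sub_pos.2 k1) (sub_pos.2 k2)]
    have b1 : |(C : ℝ)| ≤ 2 * n := abs_le_of_sq_le_sq (by nlinarith [sq_nonneg (A + d)])
      (by linarith)
    have b3 : |(C : ℝ)| ≤ 2 * n := b1
    have b2 : |(A : ℝ) + d| ≤ 2 * n := abs_le_of_sq_le_sq (by nlinarith) (by linarith)
    rw [abs_le] at b1 b2
    have bA : |(A : ℝ)| ≤ 2 * n := by rw [abs_le]; constructor <;> linarith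
    have s1 := abs_mul_small h0 h1 bA
    have s2 := abs_mul_small h0 h1 b3
    have t1 : 0 < η * C := by positivity
    refine ⟨hdet, hC, ?_, ?_, ?_⟩
    · rw [← Int.cast_lt (R := ℝ)]; push_cast; linarith
    · rw [← Int.lt_add_one_iff, ← Int.cast_lt (R := ℝ)]; push_cast; linarith
    · have hCB : C ≤ B := by
        rw [← Int.lt_add_one_iff, ← Int.cast_lt (R := ℝ)]; push_cast; linarith
      rcases hCB.lt_or_eq with h | h
      · exact Or.inl h
      · refine Or.inr ⟨h, ?_⟩
        have : (C : ℝ) = B := by exact_mod_cast h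
        have : η * A < 0 := by linarith
        have : (A : ℝ) < 0 := by nlinarith
        exact_mod_cast this
  · rintro ⟨hdet, hC, k1, k2, k3⟩
    have hCB : C ≤ B := by omega
    obtain ⟨b1, b2, -, -⟩ := reduced_bounds hdet hC k1.le k2 hCB
    have bA : |(A : ℝ)| ≤ 2 * n := by exact_mod_cast b2
    have bC : |(C : ℝ)| ≤ 2 * n := by rw [← Int.cast_abs, abs_of_pos hC]; exact_mod_cast b1
    have s1 := abs_mul_small h0 h1 bA
    have s2 := abs_mul_small h0 h1 bC
    have hC' : (0 : ℝ) < C := by exact_mod_cast hC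
    have t1 : 0 < η * C := by positivity
    have k1' : -(C : ℝ) + 1 ≤ A - D := by exact_mod_cast k1
    have k2' : (A : ℝ) - D ≤ C := by exact_mod_cast k2
    refine ⟨hdet, hC, by linarith, by linarith, ?_⟩
    rcases k3 with k | ⟨k, k'⟩
    · have : (C : ℝ) + 1 ≤ B := by exact_mod_cast k
      linarith
    · have : (C : ℝ) = B := by exact_mod_cast k
      have : (A : ℝ) < 0 := by exact_mod_cast k'
      nlinarith

lemma quads_PR₃_zero (hn : 1 ≤ n) (h0 : 0 < η) (h1 : η * (4 * n) < 1) :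
    quads n η PR₃ ∩ {p | p.1 = 0} =
      {p | p.1 = 0 ∧ p.2.1 * p.2.2.1 = n ∧ 0 < p.2.2.1 ∧ p.2.2.1 < p.2.1 ∧
        -p.2.1 ≤ p.2.2.2 ∧ p.2.2.2 < p.2.1} := by
  ext ⟨A, B, C, D⟩
  simp only [quads, PR₃, Set.mem_inter_iff, Set.mem_ofPred_eq]
  have hn' : (1 : ℝ) ≤ n := by exact_mod_cast hn
  constructor
  · rintro ⟨⟨hdet, hC, k1, k2, k3⟩, rfl⟩
    have hC' : (0 : ℝ) < C := by exact_mod_cast hC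
    push_cast at k1 k2 k3
    have k1' : C < B := by rw [← Int.cast_lt (R := ℝ)]; linarith
    have hCn : |(C : ℝ)| ≤ 2 * n := by
      rw [← Int.cast_abs, abs_of_pos hC]
      have : C ≤ 2 * n := by nlinarith
      exact_mod_cast this
    have s2 := abs_mul_small h0 h1 hCn
    have t1 : 0 < η * C := by positivity
    refine ⟨rfl, by linarith, hC, k1', ?_, ?_⟩
    · have : -(B : ℝ) < D + η * C := by nlinarith
      rw [← Int.lt_add_one_iff, ← Int.cast_lt (R := ℝ)]; push_cast; linarith
    · have : D + η * C < (B : ℝ) := by nlinarith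
      rw [← Int.cast_lt (R := ℝ)]; linarith
  · rintro ⟨rfl, hdet, hC, hCB, k1, k2⟩
    have hC' : (0 : ℝ) < C := by exact_mod_cast hC
    have hCn : |(C : ℝ)| ≤ 2 * n := by
      rw [← Int.cast_abs, abs_of_pos hC]
      have : C ≤ 2 * n := by nlinarith
      exact_mod_cast this
    have s2 := abs_mul_small h0 h1 hCn
    have t1 : 0 < η * C := by positivity
    have k1' : -(B : ℝ) ≤ D := by exact_mod_cast k1
    have k2' : (D : ℝ) + 1 ≤ B := by exact_mod_cast k2
    have k3' : (C : ℝ) < B := by exact_mod_cast hCB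
    refine ⟨⟨by linarith, hC, ?_, ?_, ?_⟩, rfl⟩ <;> push_cast <;> nlinarith

lemma encard_reducedQuads (hn : 1 ≤ n) : (reducedQuads n).encard =
    {p : ℤ × ℤ × ℤ × ℤ | p.1 = 0 ∧ p.2.1 * p.2.2.1 = n ∧ 0 < p.2.2.1 ∧ p.2.2.1 < p.2.1 ∧
        -p.2.1 ≤ p.2.2.2 ∧ p.2.2.2 < p.2.1}.encard := by
  have hn' : (1 : ℝ) ≤ n := by exact_mod_cast hn
  let η : ℝ := √2 / ((8 * n : ℤ) : ℝ)
  have hη : Irrational η := irrational_sqrt_two.div_intCast (by omega)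
  have h0 : 0 < η := by
    have : (0 : ℝ) < ((8 * n : ℤ) : ℝ) := by exact_mod_cast (by omega : 0 < 8 * n)
    positivity
  have h1 : η * (4 * n) < 1 := by
    have hs : √2 < 2 := by
      rw [Real.sqrt_lt' (by norm_num)]; norm_num
    have : η * (4 * n) = √2 / 2 := by
      simp only [η]; push_cast; field_simp; norm_num
    linarith
  rw [← quads_PG_eq hn h0 h1, encard_quads_PG hη hn, quads_PR₃_zero hn h0 h1]

/-- The count of reduced quadruples as a divisor sum. -/
lemma ncard_reducedQuads (hn : 1 ≤ n) : ((reducedQuads n).ncard : ℤ) =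
    ∑ B ∈ (Finset.Icc 1 n).filter (fun B => B ∣ n ∧ n < B ^ 2), 2 * B := by
  rw [Set.ncard_def, encard_reducedQuads hn, ← Set.ncard_def]
  let e : ((B : ℤ) × ℤ) → ℤ × ℤ × ℤ × ℤ := fun p => (0, p.1, n / p.1, p.2)
  let F : Finset ((B : ℤ) × ℤ) := ((Finset.Icc 1 n).filter (fun B => B ∣ n ∧ n < B ^ 2)).sigma
    fun B => Finset.Ico (-B) B
  have he : Function.Injective e := by
    rintro ⟨a, b⟩ ⟨c, d⟩ h
    simp only [e, Prod.mk.injEq] at h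
    obtain ⟨-, h1, -, h2⟩ := h
    subst h1 h2; rfl
  have key : {p : ℤ × ℤ × ℤ × ℤ | p.1 = 0 ∧ p.2.1 * p.2.2.1 = n ∧ 0 < p.2.2.1 ∧
      p.2.2.1 < p.2.1 ∧ -p.2.1 ≤ p.2.2.2 ∧ p.2.2.2 < p.2.1} = e '' (F : Set _) := by
    ext ⟨A, B, C, D⟩
    simp only [Set.mem_ofPred_eq, Set.mem_image, e, F, Finset.coe_sigma, Set.mem_sigma_iff,
      Finset.mem_coe, Finset.mem_filter, Finset.mem_Icc, Finset.mem_Ico, Sigma.exists,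
      Prod.mk.injEq]
    constructor
    · rintro ⟨rfl, h1, h2, h3, h4, h5⟩
      refine ⟨B, D, ⟨⟨⟨by omega, by nlinarith⟩, ⟨C, h1.symm⟩, by nlinarith⟩, h4, h5⟩, rfl, rfl, ?_,
        rfl⟩
      rw [← h1, Int.mul_ediv_cancel_left _ (by omega)]
    · rintro ⟨B', D', ⟨⟨⟨h1, h2⟩, ⟨k, hk⟩, h3⟩, h4, h5⟩, rfl, rfl, rfl, rfl⟩
      have : n / B' = k := by rw [hk, Int.mul_ediv_cancel_left _ (by omega)]
      rw [this]
      refine ⟨rfl, hk.symm, by nlinarith, by nlinarith, h4, h5⟩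
  rw [key, Set.ncard_image_of_injective _ he, Set.ncard_coe_finset, Finset.card_sigma]
  push_cast
  refine Finset.sum_congr rfl fun B hB => ?_
  simp only [Finset.mem_filter, Finset.mem_Icc] at hB
  rw [Int.card_Ico, Int.toNat_of_nonneg (by omega)]
  ring

end ClassNumberRelation

namespace ClassNumberRelation

lemma qfAct_mul (g h : Matrix.SpecialLinearGroup (Fin 2) ℤ) (Q : ℤ × ℤ × ℤ) :
    qfAct g (qfAct h Q) = qfAct (g * h) Q := by
  simp only [qfAct, Matrix.SpecialLinearGroup.coe_mul, Matrix.mul_apply, Fin.sum_univ_two,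
    Prod.mk.injEq]
  refine ⟨by ring, by ring, by ring⟩

lemma qfAct_one (Q : ℤ × ℤ × ℤ) : qfAct 1 Q = Q := by
  simp [qfAct]

lemma qfRel_equivalence : Equivalence qfRel where
  refl Q := ⟨1, qfAct_one Q⟩
  symm := by
    rintro Q _ ⟨g, rfl⟩
    exact ⟨g⁻¹, by rw [qfAct_mul, inv_mul_cancel, qfAct_one]⟩
  trans := by
    rintro Q _ _ ⟨g, rfl⟩ ⟨h, rfl⟩
    exact ⟨h * g, (qfAct_mul _ _ _).symm⟩

lemma mk_eq_mk {Q R : ℤ × ℤ × ℤ} : Quot.mk qfRel Q = Quot.mk qfRel R ↔ qfRel Q R :=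
  ⟨fun h => qfRel_equivalence.eqvGen_iff.1 (Quot.eqvGen_exact h), Quot.sound⟩

lemma det_eq (g : Matrix.SpecialLinearGroup (Fin 2) ℤ) :
    g.1 0 0 * g.1 1 1 - g.1 0 1 * g.1 1 0 = 1 := by
  rw [← Matrix.det_fin_two]; exact g.2

lemma disc_qfAct (g : Matrix.SpecialLinearGroup (Fin 2) ℤ) (Q : ℤ × ℤ × ℤ) :
    (qfAct g Q).2.1 ^ 2 - 4 * (qfAct g Q).1 * (qfAct g Q).2.2 = Q.2.1 ^ 2 - 4 * Q.1 * Q.2.2 := by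
  have h := det_eq g
  have : (qfAct g Q).2.1 ^ 2 - 4 * (qfAct g Q).1 * (qfAct g Q).2.2 =
      (Q.2.1 ^ 2 - 4 * Q.1 * Q.2.2) * (g.1 0 0 * g.1 1 1 - g.1 0 1 * g.1 1 0) ^ 2 := by
    simp only [qfAct]; ring
  rw [this, h]; ring

/-- Reduced positive definite forms of discriminant `-n`. -/
def reducedForms (n : ℤ) : Set (ℤ × ℤ × ℤ) :=
  {Q | Q.2.1 ^ 2 - 4 * Q.1 * Q.2.2 = -n ∧ 0 < Q.1 ∧ -Q.1 < Q.2.1 ∧ Q.2.1 ≤ Q.1 ∧ Q.1 ≤ Q.2.2 ∧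
    (Q.1 = Q.2.2 → 0 ≤ Q.2.1)}

lemma value_lower_bound {a b c p q : ℤ} (h1 : -a < b) (h2 : b ≤ a) (h3 : a ≤ c) :
    a * (p ^ 2 - |p * q| + q ^ 2) ≤ a * p ^ 2 + b * p * q + c * q ^ 2 := by
  have hb : |b| ≤ a := abs_le.2 ⟨h1.le, h2⟩
  have : -(a * |p * q|) ≤ b * (p * q) := by
    have h4 := neg_abs_le (b * (p * q))
    rw [abs_mul] at h4
    nlinarith [abs_nonneg (p * q)]
  nlinarith [sq_nonneg q]

lemma norm_pos {p q : ℤ} (h : p ≠ 0 ∨ q ≠ 0) : 1 ≤ p ^ 2 - |p * q| + q ^ 2 := by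
  by_contra! hh
  have h0 : 4 * (p ^ 2 - |p * q| + q ^ 2) = (2 * |p| - |q|) ^ 2 + 3 * q ^ 2 := by
    rw [abs_mul]; nlinarith [sq_abs p, sq_abs q]
  have h1 : 4 * (p ^ 2 - |p * q| + q ^ 2) = (2 * |q| - |p|) ^ 2 + 3 * p ^ 2 := by
    rw [abs_mul]; nlinarith [sq_abs p, sq_abs q]
  rcases h with h | h
  · nlinarith [sq_nonneg (2 * |q| - |p|), Int.one_le_abs h, sq_abs p]
  · nlinarith [sq_nonneg (2 * |p| - |q|), Int.one_le_abs h, sq_abs q]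

lemma reduced_first_le {n : ℤ} {Q R : ℤ × ℤ × ℤ} (hQ : Q ∈ reducedForms n)
    (h : qfRel Q R) : Q.1 ≤ R.1 := by
  obtain ⟨g, rfl⟩ := h
  obtain ⟨-, h0, h1, h2, h3, -⟩ := hQ
  have := value_lower_bound (p := g.1 0 0) (q := g.1 0 1) h1 h2 h3
  have hg := det_eq g
  have := norm_pos (p := g.1 0 0) (q := g.1 0 1) (by
    by_contra! hh
    rw [hh.1, hh.2] at hg; omega)
  simp only [qfAct]
  nlinarith

lemma eq_of_mod {a b b' k : ℤ} (h1 : -a < b) (h2 : b ≤ a) (h1' : -a < b')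
    (h2' : b' ≤ a) (h : b' = b + 2 * a * k) : b' = b := by
  have hk1 : k < 1 := by by_contra! hh; nlinarith
  have hk2 : -1 < k := by by_contra! hh; nlinarith
  obtain rfl : k = 0 := by omega
  linarith

lemma reduced_unique {n : ℤ} {Q R : ℤ × ℤ × ℤ} (hQ : Q ∈ reducedForms n)
    (hR : R ∈ reducedForms n) (h : qfRel Q R) : Q = R := by
  have ha : Q.1 = R.1 :=
    le_antisymm (reduced_first_le hQ h) (reduced_first_le hR (qfRel_equivalence.symm h))
  have hb : Q.2.1 = R.2.1 := by
    obtain ⟨g, hg⟩ := h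
    obtain ⟨d, h0, h1, h2, h3, h4⟩ := hQ
    obtain ⟨d', h0', h1', h2', h3', h4'⟩ := hR
    obtain ⟨a, b, c⟩ := Q
    obtain ⟨a', b', c'⟩ := R
    simp only at *
    subst ha
    simp only [qfAct, Prod.mk.injEq] at hg
    have hdet := det_eq g
    generalize g.1 0 0 = p at *
    generalize g.1 0 1 = q at *
    generalize g.1 1 0 = r at *
    generalize g.1 1 1 = s at *
    obtain ⟨e1, e2, -⟩ := hg
    have hv := value_lower_bound (p := p) (q := q) h1 h2 h3
    have hnorm : p ^ 2 - |p * q| + q ^ 2 ≤ 1 := by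
      by_contra! hh; nlinarith
    have hp : p ^ 2 ≤ 1 := by
      by_contra! hh
      have : 4 * (p ^ 2 - |p * q| + q ^ 2) = (2 * |q| - |p|) ^ 2 + 3 * p ^ 2 := by
        rw [abs_mul]; nlinarith [sq_abs p, sq_abs q]
      nlinarith [sq_nonneg (2 * |q| - |p|)]
    have hq : q ^ 2 ≤ 1 := by
      by_contra! hh
      have : 4 * (p ^ 2 - |p * q| + q ^ 2) = (2 * |p| - |q|) ^ 2 + 3 * q ^ 2 := by
        rw [abs_mul]; nlinarith [sq_abs p, sq_abs q]
      nlinarith [sq_nonneg (2 * |p| - |q|)]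
    have hp1 : p ≤ 1 := by nlinarith
    have hp2 : -1 ≤ p := by nlinarith
    have hq1 : q ≤ 1 := by nlinarith
    have hq2 : -1 ≤ q := by nlinarith
    by_cases hq0 : q = 0
    · subst hq0
      refine (eq_of_mod h1 h2 h1' h2' (k := p * r) ?_).symm
      linear_combination -e2 + b * hdet
    · have hqq : q ^ 2 = 1 := by
        have : q = 1 ∨ q = -1 := by omega
        rcases this with rfl | rfl <;> norm_num
      by_cases hp0 : p = 0
      · subst hp0
        have hca : c = a := by nlinarith
        subst hca
        have hb0 := h4 rfl
        rcases h2.lt_or_eq with hlt | heq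
        · have hb' : b' = -b := by
            refine eq_of_mod (a := c) (by omega) (by omega) h1' h2' (k := q * s) ?_
            linear_combination -e2 - b * hdet
          have hcc : c' = c := by
            have : c * c' = c * c := by rw [hb'] at d'; nlinarith
            exact mul_left_cancel₀ h0.ne' this
          have := h4' hcc.symm
          omega
        · subst heq
          refine (eq_of_mod h1 h2 h1' h2' (k := q * s - 1) ?_).symm
          linear_combination -e2 - b * hdet
      · have hpp : p ^ 2 = 1 := by
          have : p = 1 ∨ p = -1 := by omega
          rcases this with rfl | rfl <;> norm_num
        have hpq : p * q = 1 ∨ p * q = -1 := sq_eq_one_iff.1 (by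
          rw [mul_pow, hpp, hqq]; norm_num)
        have e3 : b * (p * q) + c = 0 := by rw [hpp, hqq] at e1; linarith
        have hba : b = a ∧ c = a := by
          rcases hpq with h | h <;> rw [h] at e3 <;> omega
        obtain ⟨rfl, rfl⟩ := hba
        have : c ≤ b' := by
          by_contra! hh
          nlinarith [mul_pos (sub_pos.2 hh) (by linarith : 0 < c + b')]
        omega
  obtain ⟨a, b, c⟩ := Q
  obtain ⟨a', b', c'⟩ := R
  simp only at ha hb
  subst ha hb
  have h1 := hQ.1
  have h2 := hR.1
  have h3 := hQ.2.1
  simp only at h1 h2 h3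
  have : a * c = a * c' := by linarith
  rw [mul_left_cancel₀ h3.ne' this]

def translation (k : ℤ) : Matrix.SpecialLinearGroup (Fin 2) ℤ :=
  ⟨!![1, 0; k, 1], by simp [Matrix.det_fin_two]⟩

def inversion : Matrix.SpecialLinearGroup (Fin 2) ℤ :=
  ⟨!![0, 1; -1, 0], by simp [Matrix.det_fin_two]⟩

lemma qfRel_translation (a b c k : ℤ) : qfRel (a, b, c) (a, b + 2 * a * k, a * k ^ 2 + b * k + c) :=
  ⟨translation k, by simp [qfAct, translation]; ring⟩

lemma qfRel_inversion (a b c : ℤ) : qfRel (a, b, c) (c, -b, a) :=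
  ⟨inversion, by simp [qfAct, inversion]⟩

lemma exists_reduced {n : ℤ} (hn : 0 < n) (m : ℕ) : ∀ Q : ℤ × ℤ × ℤ, Q.1.toNat ≤ m →
    Q.2.1 ^ 2 - 4 * Q.1 * Q.2.2 = -n → 0 < Q.1 → ∃ R ∈ reducedForms n, qfRel Q R := by
  induction m with
  | zero => intro Q h _ h'; omega
  | succ m ih =>
    rintro ⟨a, b, c⟩ hm hd ha
    simp only at hm hd ha
    obtain ⟨b', c', hrel, hb1, hb2⟩ : ∃ b' c', qfRel (a, b, c) (a, b', c') ∧ -a < b' ∧ b' ≤ a := by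
      have h1 := Int.emod_add_mul_ediv (a - b) (2 * a)
      have h2 := Int.emod_nonneg (a - b) (by omega : 2 * a ≠ 0)
      have h3 := Int.emod_lt_of_pos (a - b) (by omega : 0 < 2 * a)
      refine ⟨_, _, qfRel_translation a b c ((a - b) / (2 * a)), by linarith, by linarith⟩
    have hd' : b' ^ 2 - 4 * a * c' = -n := by
      obtain ⟨g, hg⟩ := hrel
      have := disc_qfAct g (a, b, c)
      rw [hg] at this
      simp only at this
      rw [this, hd]
    have hc' : 0 < c' := by
      by_contra! hh
      nlinarith [sq_nonneg b']
    rcases lt_trichotomy c' a with h | h | h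
    · obtain ⟨R, hR, hr⟩ := ih (c', -b', a) (by simp only; omega) (by simp only; linarith) hc'
      exact ⟨R, hR, qfRel_equivalence.trans hrel
        (qfRel_equivalence.trans (qfRel_inversion _ _ _) hr)⟩
    · subst h
      rcases le_or_gt 0 b' with h | h
      · exact ⟨_, ⟨hd', ha, hb1, hb2, le_rfl, fun _ => h⟩, hrel⟩
      · refine ⟨_, ⟨?_, ha, ?_, ?_, le_rfl, ?_⟩,
          qfRel_equivalence.trans hrel (qfRel_inversion _ _ _)⟩ <;> simp only
        · linarith
        · omega
        · omega
        · omega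
    · exact ⟨_, ⟨hd', ha, hb1, hb2, h.le, fun h' => absurd h' h.ne⟩, hrel⟩

lemma injOn_mk (n : ℤ) : Set.InjOn (Quot.mk qfRel) (reducedForms n) :=
  fun _ hQ _ hR h => reduced_unique hQ hR (mk_eq_mk.1 h)

lemma image_mk {n : ℤ} (hn : 0 < n) : Quot.mk qfRel '' reducedForms n = qfClasses n := by
  ext q
  constructor
  · rintro ⟨Q, hQ, rfl⟩
    exact ⟨Q, rfl, hQ.1, hQ.2.1⟩
  · rintro ⟨Q, rfl, h1, h2⟩
    obtain ⟨R, hR, h⟩ := exists_reduced hn _ Q le_rfl h1 h2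
    exact ⟨R, hR, (mk_eq_mk.2 h).symm⟩

lemma ncard_special {n : ℤ} (hn : 0 < n) (F : ℤ → ℤ × ℤ × ℤ) 
    (hF : ∀ g k, 0 < (qfAct g (F k)).1 → (F k).2.1 ^ 2 - 4 * (F k).1 * (F k).2.2 = -n →
      F k ∈ reducedForms n) :
    ({q ∈ qfClasses n | ∃ k : ℤ, Quot.mk qfRel (F k) = q}).ncard =
      (reducedForms n ∩ Set.range F).ncard := by
  rw [← ((injOn_mk n).mono Set.inter_subset_left).ncard_image]
  congr 1
  ext q
  constructor
  · rintro ⟨hq, k, rfl⟩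
    rw [← image_mk hn] at hq
    obtain ⟨Q, hQ, h⟩ := hq
    obtain ⟨g, hg⟩ := mk_eq_mk.1 h.symm
    refine ⟨F k, ⟨hF g k ?_ ?_, k, rfl⟩, rfl⟩
    · rw [hg]; exact hQ.2.1
    · rw [← disc_qfAct g, hg]; exact hQ.1
  · rintro ⟨Q, ⟨hQ, k, rfl⟩, rfl⟩
    exact ⟨(image_mk hn) ▸ ⟨_, hQ, rfl⟩, k, rfl⟩

/-- The Hurwitz class number as a weighted count of reduced forms. -/
lemma hurwitzH_eq {n : ℤ} (hn : 0 < n) : hurwitzH n = ((reducedForms n).ncard : ℝ)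
    - 1 / 2 * ((reducedForms n ∩ Set.range fun k : ℤ => (k, (0 : ℤ), k)).ncard : ℝ)
    - 2 / 3 * ((reducedForms n ∩ Set.range fun k : ℤ => (k, k, k)).ncard : ℝ) := by
  unfold hurwitzH
  rw [if_neg hn.ne']
  split_ifs with h
  · rw [ncard_special hn (fun k : ℤ => (k, (0 : ℤ), k)), ncard_special hn (fun k : ℤ => (k, k, k)),
      ← image_mk hn, (injOn_mk n).ncard_image]
    · intro g k h1 h2
      simp only [qfAct] at h1 h2
      have hk : 0 < k := by
        by_contra! hh
        have : g.1 0 0 ^ 2 + g.1 0 0 * g.1 0 1 + g.1 0 1 ^ 2 ≥ 0 := by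
          nlinarith [sq_nonneg (2 * g.1 0 0 + g.1 0 1), sq_nonneg (g.1 0 1)]
        nlinarith
      refine ⟨h2, hk, ?_, ?_, ?_, ?_⟩ <;> simp only <;> omega
    · intro g k h1 h2
      simp only [qfAct] at h1 h2
      have hk : 0 < k := by
        by_contra! hh
        nlinarith [sq_nonneg (g.1 0 0), sq_nonneg (g.1 0 1)]
      refine ⟨h2, hk, ?_, ?_, ?_, ?_⟩ <;> simp only <;> omega
  · have : reducedForms n = ∅ := by
      rw [Set.eq_empty_iff_forall_notMem]
      rintro ⟨a, b, c⟩ ⟨h1, -⟩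
      simp only at h1
      apply h
      refine ⟨hn, ?_⟩
      rcases Int.even_or_odd' b with ⟨k, rfl | rfl⟩
      · left
        have : n = 4 * (a * c - k ^ 2) := by linarith
        omega
      · right
        have : n = 4 * (a * c - k ^ 2 - k - 1) + 3 := by linarith
        omega
    simp [this]

end ClassNumberRelation

namespace ClassNumberRelation

variable {n : ℤ}

/-- Quadruples `(A, B, C, D)` with `A D + B C = n` for which `(C, A - D, B)` is reduced. -/
def formQuads (n : ℤ) : Set (ℤ × ℤ × ℤ × ℤ) :=
  {p | p.1 * p.2.2.2 + p.2.1 * p.2.2.1 = n ∧ 0 < p.2.2.1 ∧ -p.2.2.1 < p.1 - p.2.2.2 ∧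
    p.1 - p.2.2.2 ≤ p.2.2.1 ∧ p.2.2.1 ≤ p.2.1 ∧ (p.2.2.1 = p.2.1 → 0 ≤ p.1 - p.2.2.2)}

def toForm (p : ℤ × ℤ × ℤ × ℤ) : ℤ × ℤ × ℤ := (p.2.2.1, p.1 - p.2.2.2, p.2.1)

lemma formQuads_finite (n : ℤ) : (formQuads n).Finite := by
  refine ((Set.finite_Icc (-(2 * n)) (2 * n)).prod ((Set.finite_Icc (-(2 * n)) (2 * n)).prod
    ((Set.finite_Icc (-(2 * n)) (2 * n)).prod (Set.finite_Icc (-(2 * n)) (2 * n))))).subset ?_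
  rintro ⟨A, B, C, D⟩ ⟨h, h0, h1, h2, h3, -⟩
  simp only at h h0 h1 h2 h3
  have := reduced_bounds h h0 h1.le h2 h3
  simp only [abs_le] at this
  simp only [Set.mem_prod, Set.mem_Icc]
  omega

lemma sum_ncard_reducedForms (P : Set (ℤ × ℤ × ℤ)) :
    ∑ t ∈ (Finset.Icc (-(2 * n)) (2 * n)).filter (fun t => t ^ 2 < 4 * n),
      (reducedForms (4 * n - t ^ 2) ∩ P).ncard = (formQuads n ∩ toForm ⁻¹' P).ncard := by
  have hfin : (formQuads n ∩ toForm ⁻¹' P).Finite := (formQuads_finite n).inter_of_left _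
  rw [Set.ncard_eq_toFinset_card _ hfin, Finset.card_eq_sum_card_fiberwise
    (f := fun p => p.1 + p.2.2.2)
    (t := (Finset.Icc (-(2 * n)) (2 * n)).filter (fun t => t ^ 2 < 4 * n))]
  · refine Finset.sum_congr rfl fun t _ => ?_
    rw [← Set.ncard_coe_finset]
    symm
    refine Set.ncard_congr (fun p _ => toForm p) ?_ ?_ ?_
    · rintro ⟨A, B, C, D⟩ hp
      simp only [Finset.coe_filter, Set.Finite.mem_toFinset, Set.mem_ofPred_eq] at hp
      obtain ⟨⟨⟨h, h0, h1, h2, h3, h4⟩, hP⟩, ht⟩ := hp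
      simp only at h h0 h1 h2 h3 h4 ht
      refine ⟨⟨?_, h0, h1, h2, h3, h4⟩, hP⟩
      simp only [toForm]
      rw [← ht, ← h]; ring
    · rintro ⟨A, B, C, D⟩ ⟨A', B', C', D'⟩ hp hp' h
      simp only [Finset.coe_filter, Set.Finite.mem_toFinset, Set.mem_ofPred_eq] at hp hp'
      simp only [toForm, Prod.mk.injEq] at h
      have := hp.2
      have := hp'.2
      simp only [Prod.mk.injEq]
      omega
    · rintro ⟨a, b, c⟩ ⟨⟨h, h0, h1, h2, h3, h4⟩, hP⟩
      simp only at h h0 h1 h2 h3 h4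
      obtain ⟨k, hk⟩ : ∃ k, t = b + 2 * k := by
        have h5 : (t - b) * (t + b) = 4 * (n - a * c) := by linarith
        have : (2 : ℤ) ∣ t - b := by
          by_contra hh
          have e1 : (t - b) % 2 = 1 := by omega
          have e2 : (t + b) % 2 = 1 := by omega
          have e3 : ((t - b) * (t + b)) % 2 = 1 := by rw [Int.mul_emod, e1, e2]; rfl
          omega
        obtain ⟨k, hk⟩ := this
        exact ⟨k, by omega⟩
      subst hk
      refine ⟨(b + k, c, a, k), ?_, ?_⟩
      · simp only [Finset.coe_filter, Set.Finite.mem_toFinset, Set.mem_ofPred_eq]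
        have e : b + k - k = b := by ring
        refine ⟨⟨⟨?_, h0, ?_, ?_, h3, ?_⟩, ?_⟩, ?_⟩
        · simp only; nlinarith
        · simpa only [e] using h1
        · simpa only [e] using h2
        · simpa only [e] using h4
        · simpa only [Set.mem_preimage, toForm, e] using hP
        · ring
      · simp [toForm]
  · rintro ⟨A, B, C, D⟩ hp
    obtain ⟨⟨h, h0, h1, h2, h3, h4⟩, -⟩ := hfin.mem_toFinset.1 hp
    simp only at h h0 h1 h2 h3 h4
    have e : (A + D) ^ 2 + 3 * C ^ 2 ≤ 4 * n := by nlinarith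
    have hn1 : 1 ≤ n := by nlinarith [sq_nonneg (A + D)]
    have hs : |A + D| ≤ 2 * n := abs_le_of_sq_le_sq (by nlinarith) (by linarith)
    rw [abs_le] at hs
    simp only [Finset.coe_filter, Finset.mem_Icc, Set.mem_ofPred_eq]
    exact ⟨⟨hs.1, hs.2⟩, by nlinarith⟩

/-- Triples `(A, C, D)` with `A D + C² = n`, `C > 0` satisfying `P`. -/
def triples (n : ℤ) (P : ℤ → ℤ → ℤ → Prop) : Set (ℤ × ℤ × ℤ) :=
  {p | p.1 * p.2.2 + p.2.1 ^ 2 = n ∧ 0 < p.2.1 ∧ P p.1 p.2.1 p.2.2}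

lemma triples_finite {P : ℤ → ℤ → ℤ → Prop} (h : ∀ a c d, P a c d → -c ≤ a - d ∧ a - d ≤ c) :
    (triples n P).Finite := by
  refine ((Set.finite_Icc (-(2 * n)) (2 * n)).prod ((Set.finite_Icc (-(2 * n)) (2 * n)).prod
    (Set.finite_Icc (-(2 * n)) (2 * n)))).subset ?_
  rintro ⟨A, C, D⟩ ⟨h0, h1, h2⟩
  simp only at h0 h1 h2
  have := reduced_bounds (A := A) (B := C) (C := C) (D := D) (by linarith) h1 (h _ _ _ h2).1
    (h _ _ _ h2).2 le_rfl
  simp only [abs_le] at this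
  simp only [Set.mem_prod, Set.mem_Icc]
  omega

lemma ncard_triples_equiv {P Q : ℤ → ℤ → ℤ → Prop} (e : ℤ × ℤ × ℤ ≃ ℤ × ℤ × ℤ)
    (h : ∀ p, e p ∈ triples n Q ↔ p ∈ triples n P) :
    (triples n P).ncard = (triples n Q).ncard := by
  rw [Set.ncard_def, Set.ncard_def, ← Set.encard_preimage_of_bijective e.bijective (triples n Q)]
  congr 2
  ext p
  exact (h p).symm

lemma ncard_triples_split {P Q R : ℤ → ℤ → ℤ → Prop}
    (h : ∀ a c d, P a c d → -c ≤ a - d ∧ a - d ≤ c) (h1 : ∀ a c d, P a c d ↔ Q a c d ∨ R a c d)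
    (h2 : ∀ a c d, Q a c d → R a c d → False) :
    (triples n P).ncard = (triples n Q).ncard + (triples n R).ncard := by
  rw [← Set.ncard_union_eq _ (triples_finite fun a c d hh => h _ _ _ ((h1 _ _ _).2 (Or.inl hh)))
    (triples_finite fun a c d hh => h _ _ _ ((h1 _ _ _).2 (Or.inr hh)))]
  · congr 1
    ext p
    simp only [triples, Set.mem_union, Set.mem_ofPred_eq, h1]
    tauto
  · rw [Set.disjoint_left]
    rintro p ⟨-, -, hp⟩ ⟨-, -, hp'⟩
    exact h2 _ _ _ hp hp'

def swapTriple : ℤ × ℤ × ℤ ≃ ℤ × ℤ × ℤ where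
  toFun p := (p.2.2, p.2.1, p.1)
  invFun p := (p.2.2, p.2.1, p.1)
  left_inv _ := rfl
  right_inv _ := rfl

def negTriple : ℤ × ℤ × ℤ ≃ ℤ × ℤ × ℤ where
  toFun p := (-p.1, p.2.1, -p.2.2)
  invFun p := (-p.1, p.2.1, -p.2.2)
  left_inv p := by simp
  right_inv p := by simp

lemma ncard_diag_eq :
    (triples n fun a _ d => a = d).ncard + 2 * (triples n fun a c d => 0 < a - d ∧ a - d < c).ncard
      = 2 * (triples n fun a c d => -c < a - d ∧ a - d < c ∧ a < 0).ncard +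
        (triples n fun a c d => -c < a - d ∧ a - d < c ∧ a = 0).ncard := by
  have s1 : (triples n fun a c d => 0 < a - d ∧ a - d < c).ncard =
      (triples n fun a c d => -c < a - d ∧ a - d < 0).ncard :=
    ncard_triples_equiv swapTriple fun ⟨a, c, d⟩ => by
      simp only [triples, swapTriple, Equiv.coe_fn_mk, Set.mem_ofPred_eq, mul_comm d a]
      omega
  have s2 : (triples n fun a c d => -c < a - d ∧ a - d < c ∧ a < 0).ncard =
      (triples n fun a c d => -c < a - d ∧ a - d < c ∧ 0 < a).ncard :=
    ncard_triples_equiv negTriple fun ⟨a, c, d⟩ => by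
      simp only [triples, negTriple, Equiv.coe_fn_mk, Set.mem_ofPred_eq, neg_mul_neg]
      omega
  have s3 : (triples n fun a c d => -c < a - d ∧ a - d < c ∧ 0 < c).ncard =
      (triples n fun a c d => a = d ∧ 0 < c).ncard +
        (triples n fun a c d => a ≠ d ∧ -c < a - d ∧ a - d < c).ncard :=
    ncard_triples_split (by omega) (by omega) (by omega)
  have s4 : (triples n fun a c d => a ≠ d ∧ -c < a - d ∧ a - d < c).ncard =
      (triples n fun a c d => 0 < a - d ∧ a - d < c).ncard +
        (triples n fun a c d => -c < a - d ∧ a - d < 0).ncard :=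
    ncard_triples_split (by omega) (by omega) (by omega)
  have s5 : (triples n fun a c d => -c < a - d ∧ a - d < c ∧ 0 < c).ncard =
      (triples n fun a c d => -c < a - d ∧ a - d < c ∧ a = 0).ncard +
        (triples n fun a c d => -c < a - d ∧ a - d < c ∧ a ≠ 0).ncard :=
    ncard_triples_split (by omega) (by omega) (by omega)
  have s6 : (triples n fun a c d => -c < a - d ∧ a - d < c ∧ a ≠ 0).ncard =
      (triples n fun a c d => -c < a - d ∧ a - d < c ∧ a < 0).ncard +
        (triples n fun a c d => -c < a - d ∧ a - d < c ∧ 0 < a).ncard :=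
    ncard_triples_split (by omega) (by omega) (by omega)
  have s7 : (triples n fun a c d => a = d ∧ 0 < c) = triples n fun a c d => a = d := by
    ext p; simp only [triples, Set.mem_ofPred_eq]; tauto
  rw [s7] at s3
  omega

lemma ncard_axis_of_sq {k : ℤ} (hk : 0 < k) (h : k ^ 2 = n) :
    ((triples n fun a c d => -c < a - d ∧ a - d < c ∧ a = 0).ncard : ℤ) = 2 * k - 1 := by
  have : (triples n fun a c d => -c < a - d ∧ a - d < c ∧ a = 0) =
      (fun d : ℤ => ((0 : ℤ), k, d)) '' (Finset.Ioo (-k) k : Finset ℤ) := by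
    ext ⟨a, c, d⟩
    simp only [triples, Set.mem_ofPred_eq, Set.mem_image, Finset.mem_coe, Finset.mem_Ioo,
      Prod.mk.injEq]
    constructor
    · rintro ⟨h1, h2, h3, h4, rfl⟩
      have : c = k := by
        rw [← h, zero_mul, zero_add] at h1
        exact (sq_eq_sq₀ h2.le hk.le).1 h1
      exact ⟨d, by omega, rfl, this.symm, rfl⟩
    · rintro ⟨d', h1, rfl, rfl, rfl⟩
      exact ⟨by linarith, hk, by omega, by omega, rfl⟩
  rw [this, Set.ncard_image_of_injective _ (fun x y h => by simpa using h), Set.ncard_coe_finset,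
    Int.card_Ioo]
  omega

lemma ncard_axis_of_not_sq (h : ¬ ∃ k : ℤ, 0 < k ∧ k ^ 2 = n) :
    (triples n fun a c d => -c < a - d ∧ a - d < c ∧ a = 0).ncard = 0 := by
  have : (triples n fun a c d => -c < a - d ∧ a - d < c ∧ a = 0) = ∅ := by
    rw [Set.eq_empty_iff_forall_notMem]
    rintro ⟨a, c, d⟩ ⟨h1, h2, h3, h4, h5⟩
    simp only at h1 h2 h5
    subst h5
    exact h ⟨c, h2, by linarith⟩
  rw [this, Set.ncard_empty]

lemma ncard_edge :
    (triples n fun a c d => a - d = c).ncard =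
      3 * (triples n fun a c d => a - d = c ∧ a < 0).ncard +
      (triples n fun a c d => a - d = c ∧ (d = 0 ∨ d = -c)).ncard := by
  have s1 : (triples n fun a c d => a - d = c ∧ a < 0).ncard =
      (triples n fun a c d => a - d = c ∧ 0 < d).ncard :=
    Set.ncard_congr (fun p _ => (-p.2.2, -p.1, p.2.1))
      (by
        rintro ⟨a, c, d⟩ ⟨h1, h2, h3, h4⟩
        simp only at h1 h2 h3 h4
        refine ⟨?_, ?_, ?_, ?_⟩ <;> simp only
        · subst h3; rw [← h1]; ring
        all_goals omega)
      (by
        rintro ⟨a, c, d⟩ ⟨a', c', d'⟩ - - h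
        simp only [Prod.mk.injEq] at h ⊢
        omega)
      (by
        rintro ⟨a, c, d⟩ ⟨h1, h2, h3, h4⟩
        simp only at h1 h2 h3 h4
        refine ⟨(-c, d, -a), ⟨?_, h4, ?_, ?_⟩, by simp⟩ <;> simp only
        · subst h3; rw [← h1]; ring
        all_goals omega)
  have s2 : (triples n fun a c d => a - d = c ∧ 0 < d).ncard =
      (triples n fun a c d => a - d = c ∧ -c < d ∧ d < 0).ncard :=
    Set.ncard_congr (fun p _ => (p.2.1, p.1, -p.2.2))
      (by
        rintro ⟨a, c, d⟩ ⟨h1, h2, h3, h4⟩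
        simp only at h1 h2 h3 h4
        refine ⟨?_, ?_, ?_, ?_⟩ <;> simp only
        · subst h3; rw [← h1]; ring
        all_goals omega)
      (by
        rintro ⟨a, c, d⟩ ⟨a', c', d'⟩ - - h
        simp only [Prod.mk.injEq] at h ⊢
        omega)
      (by
        rintro ⟨a, c, d⟩ ⟨h1, h2, h3, h4⟩
        simp only at h1 h2 h3 h4
        refine ⟨(c, a, -d), ⟨?_, ?_, ?_, ?_⟩, by simp⟩ <;> simp only
        · subst h3; rw [← h1]; ring
        all_goals omega)
  have s3 : (triples n fun a c d => a - d = c ∧ 0 < c).ncard =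
      (triples n fun a c d => a - d = c ∧ (d = 0 ∨ d = -c)).ncard +
      (triples n fun a c d => a - d = c ∧ d ≠ 0 ∧ d ≠ -c ∧ 0 < c).ncard := by
    have : (triples n fun a c d => a - d = c ∧ (d = 0 ∨ d = -c)) =
        (triples n fun a c d => a - d = c ∧ (d = 0 ∨ d = -c) ∧ 0 < c) := by
      ext p; simp only [triples, Set.mem_ofPred_eq]; tauto
    rw [this]
    exact ncard_triples_split (by omega) (by omega) (by omega)
  have s4 : (triples n fun a c d => a - d = c ∧ d ≠ 0 ∧ d ≠ -c ∧ 0 < c).ncard =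
      (triples n fun a c d => a - d = c ∧ a < 0 ∧ 0 < c).ncard +
      (triples n fun a c d => a - d = c ∧ 0 < a ∧ d ≠ 0 ∧ 0 < c).ncard :=
    ncard_triples_split (by omega) (by omega) (by omega)
  have s5 : (triples n fun a c d => a - d = c ∧ 0 < a ∧ d ≠ 0 ∧ 0 < c).ncard =
      (triples n fun a c d => a - d = c ∧ 0 < d ∧ 0 < c).ncard +
      (triples n fun a c d => a - d = c ∧ -c < d ∧ d < 0).ncard :=
    ncard_triples_split (by omega) (by omega) (by omega)
  have e1 : (triples n fun a c d => a - d = c ∧ 0 < c) = triples n fun a c d => a - d = c := by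
    ext p; simp only [triples, Set.mem_ofPred_eq]; tauto
  have e2 : (triples n fun a c d => a - d = c ∧ a < 0 ∧ 0 < c) =
      triples n fun a c d => a - d = c ∧ a < 0 := by
    ext p; simp only [triples, Set.mem_ofPred_eq]; tauto
  have e3 : (triples n fun a c d => a - d = c ∧ 0 < d ∧ 0 < c) =
      triples n fun a c d => a - d = c ∧ 0 < d := by
    ext p; simp only [triples, Set.mem_ofPred_eq]; tauto
  rw [e1] at s3
  rw [e2] at s4
  rw [e3] at s5
  omega

lemma ncard_rays_of_sq {k : ℤ} (hk : 0 < k) (h : k ^ 2 = n) :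
    (triples n fun a c d => a - d = c ∧ (d = 0 ∨ d = -c)).ncard = 2 := by
  have : (triples n fun a c d => a - d = c ∧ (d = 0 ∨ d = -c)) = {(k, k, 0), (0, k, -k)} := by
    ext ⟨a, c, d⟩
    simp only [triples, Set.mem_ofPred_eq, Set.mem_insert_iff, Set.mem_singleton_iff,
      Prod.mk.injEq]
    constructor
    · rintro ⟨h1, h2, h3, h4 | h4⟩
      · subst h4
        have : c = k := (sq_eq_sq₀ h2.le hk.le).1 (by linarith)
        left; omega
      · have ha : a = 0 := by omega
        subst ha
        have : c = k := (sq_eq_sq₀ h2.le hk.le).1 (by linarith)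
        right; omega
    · rintro (⟨rfl, rfl, rfl⟩ | ⟨rfl, rfl, rfl⟩)
      · exact ⟨by linarith, hk, by ring, Or.inl rfl⟩
      · exact ⟨by linarith, hk, by ring, Or.inr rfl⟩
  rw [this, Set.ncard_pair]
  intro h
  simp only [Prod.mk.injEq] at h
  omega

lemma ncard_rays_of_not_sq (h : ¬ ∃ k : ℤ, 0 < k ∧ k ^ 2 = n) :
    (triples n fun a c d => a - d = c ∧ (d = 0 ∨ d = -c)).ncard = 0 := by
  have : (triples n fun a c d => a - d = c ∧ (d = 0 ∨ d = -c)) = ∅ := by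
    rw [Set.eq_empty_iff_forall_notMem]
    rintro ⟨a, c, d⟩ ⟨h1, h2, h3, h4 | h4⟩ <;> simp only at h1 h2 h3 h4
    · subst h4
      exact h ⟨c, h2, by linarith⟩
    · have ha : a = 0 := by omega
      subst ha
      exact h ⟨c, h2, by linarith⟩
  rw [this, Set.ncard_empty]

/-- The part `C < B` common to `formQuads` and `reducedQuads`. -/
def strictQuads (n : ℤ) : Set (ℤ × ℤ × ℤ × ℤ) :=
  {p | p.1 * p.2.2.2 + p.2.1 * p.2.2.1 = n ∧ 0 < p.2.2.1 ∧ -p.2.2.1 < p.1 - p.2.2.2 ∧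
    p.1 - p.2.2.2 ≤ p.2.2.1 ∧ p.2.2.1 < p.2.1}

def ofTriple (p : ℤ × ℤ × ℤ) : ℤ × ℤ × ℤ × ℤ := (p.1, p.2.1, p.2.1, p.2.2)

lemma ofTriple_injective : Function.Injective ofTriple := by
  rintro ⟨a, c, d⟩ ⟨a', c', d'⟩ h
  simp only [ofTriple, Prod.mk.injEq] at h ⊢
  tauto

lemma strictQuads_finite (n : ℤ) : (strictQuads n).Finite :=
  (formQuads_finite n).subset fun _ ⟨h, h0, h1, h2, h3⟩ =>
    ⟨h, h0, h1, h2, h3.le, fun h' => absurd h' h3.ne⟩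

lemma ncard_formQuads : (formQuads n).ncard = (strictQuads n).ncard +
    ((triples n fun a _ d => a = d).ncard + (triples n fun a c d => 0 < a - d ∧ a - d < c).ncard +
      (triples n fun a c d => a - d = c).ncard) := by
  have e : (triples n fun a c d => 0 ≤ a - d ∧ a - d ≤ c ∧ 0 < c).ncard =
      (triples n fun a c d => a = d ∧ 0 < c).ncard +
        (triples n fun a c d => 0 < a - d ∧ a - d ≤ c ∧ 0 < c).ncard :=
    ncard_triples_split (by omega) (by omega) (by omega)
  have e' : (triples n fun a c d => 0 < a - d ∧ a - d ≤ c ∧ 0 < c).ncard =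
      (triples n fun a c d => 0 < a - d ∧ a - d < c).ncard +
        (triples n fun a c d => a - d = c ∧ 0 < c).ncard :=
    ncard_triples_split (by omega) (by omega) (by omega)
  have e1 : (triples n fun a c d => a - d = c ∧ 0 < c) = triples n fun a c d => a - d = c := by
    ext p; simp only [triples, Set.mem_ofPred_eq]; tauto
  have e2 : (triples n fun a c d => a = d ∧ 0 < c) = triples n fun a c d => a = d := by
    ext p; simp only [triples, Set.mem_ofPred_eq]; tauto
  rw [add_assoc, ← e1, ← e2, ← e', ← e, ← Set.ncard_image_of_injective _ ofTriple_injective,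
    ← Set.ncard_union_eq _ (strictQuads_finite n) ((triples_finite (by omega)).image _)]
  · congr 1
    ext ⟨A, B, C, D⟩
    simp only [formQuads, strictQuads, triples, ofTriple, Set.mem_union, Set.mem_image,
      Set.mem_ofPred_eq, Prod.mk.injEq, Prod.exists]
    constructor
    · rintro ⟨h, h0, h1, h2, h3, h4⟩
      rcases h3.lt_or_eq with k | k
      · exact Or.inl ⟨h, h0, h1, h2, k⟩
      · subst k
        exact Or.inr ⟨A, C, D, ⟨by linarith, h0, h4 rfl, h2, h0⟩, rfl, rfl, rfl, rfl⟩
    · rintro (⟨h, h0, h1, h2, h3⟩ | ⟨_, _, _, ⟨h, h0, h1, h2, h3⟩, rfl, rfl, rfl, rfl⟩)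
      · exact ⟨h, h0, h1, h2, h3.le, by omega⟩
      · exact ⟨by linarith, h0, by omega, h2, le_rfl, fun _ => h1⟩
  · rw [Set.disjoint_left]
    rintro _ ⟨-, -, -, -, h⟩ ⟨p, -, rfl⟩
    exact lt_irrefl _ h

lemma ncard_reducedQuads_eq : (reducedQuads n).ncard = (strictQuads n).ncard +
    ((triples n fun a c d => -c < a - d ∧ a - d < c ∧ a < 0).ncard +
      (triples n fun a c d => a - d = c ∧ a < 0).ncard) := by
  have e : (triples n fun a c d => -c < a - d ∧ a - d ≤ c ∧ a < 0 ∧ 0 < c).ncard =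
      (triples n fun a c d => -c < a - d ∧ a - d < c ∧ a < 0).ncard +
        (triples n fun a c d => a - d = c ∧ a < 0 ∧ 0 < c).ncard :=
    ncard_triples_split (by omega) (by omega) (by omega)
  have e1 : (triples n fun a c d => a - d = c ∧ a < 0 ∧ 0 < c) =
      triples n fun a c d => a - d = c ∧ a < 0 := by
    ext p; simp only [triples, Set.mem_ofPred_eq]; tauto
  rw [← e1, ← e, ← Set.ncard_image_of_injective _ ofTriple_injective,
    ← Set.ncard_union_eq _ (strictQuads_finite n) ((triples_finite (by omega)).image _)]
  · congr 1
    ext ⟨A, B, C, D⟩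
    simp only [reducedQuads, strictQuads, triples, ofTriple, Set.mem_union, Set.mem_image,
      Set.mem_ofPred_eq, Prod.mk.injEq, Prod.exists]
    constructor
    · rintro ⟨h, h0, h1, h2, k | ⟨k, k'⟩⟩
      · exact Or.inl ⟨h, h0, h1, h2, k⟩
      · subst k
        exact Or.inr ⟨A, C, D, ⟨by linarith, h0, h1, h2, k', h0⟩, rfl, rfl, rfl, rfl⟩
    · rintro (⟨h, h0, h1, h2, h3⟩ | ⟨_, _, _, ⟨h, h0, h1, h2, h3, h4⟩, rfl, rfl, rfl, rfl⟩)
      · exact ⟨h, h0, h1, h2, Or.inl h3⟩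
      · exact ⟨by linarith, h0, by omega, h2, Or.inr ⟨rfl, h3⟩⟩
  · rw [Set.disjoint_left]
    rintro _ ⟨-, -, -, -, h⟩ ⟨p, -, rfl⟩
    exact lt_irrefl _ h

lemma ncard_formQuads_square :
    (formQuads n ∩ toForm ⁻¹' Set.range fun k : ℤ => (k, (0 : ℤ), k)).ncard =
      (triples n fun a _ d => a = d).ncard := by
  rw [← Set.ncard_image_of_injective _ ofTriple_injective]
  congr 1
  ext ⟨A, B, C, D⟩
  simp only [formQuads, triples, ofTriple, toForm, Set.mem_inter_iff, Set.mem_image,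
    Set.mem_preimage, Set.mem_range, Set.mem_ofPred_eq, Prod.mk.injEq, Prod.exists]
  constructor
  · rintro ⟨⟨h, h0, h1, h2, h3, h4⟩, k, rfl, h5, rfl⟩
    exact ⟨A, k, D, ⟨by linarith, h0, by omega⟩, rfl, rfl, rfl, rfl⟩
  · rintro ⟨_, _, _, ⟨h, h0, rfl⟩, rfl, rfl, rfl, rfl⟩
    exact ⟨⟨by linarith, h0, by omega, by omega, le_rfl, by omega⟩, _, rfl, by omega, rfl⟩

lemma ncard_formQuads_hexagon :
    (formQuads n ∩ toForm ⁻¹' Set.range fun k : ℤ => (k, k, k)).ncard =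
      (triples n fun a c d => a - d = c).ncard := by
  rw [← Set.ncard_image_of_injective _ ofTriple_injective]
  congr 1
  ext ⟨A, B, C, D⟩
  simp only [formQuads, triples, ofTriple, toForm, Set.mem_inter_iff, Set.mem_image,
    Set.mem_preimage, Set.mem_range, Set.mem_ofPred_eq, Prod.mk.injEq, Prod.exists]
  constructor
  · rintro ⟨⟨h, h0, h1, h2, h3, h4⟩, k, rfl, h5, rfl⟩
    exact ⟨A, k, D, ⟨by linarith, h0, by omega⟩, rfl, rfl, rfl, rfl⟩
  · rintro ⟨_, _, _, ⟨h, h0, rfl⟩, rfl, rfl, rfl, rfl⟩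
    exact ⟨⟨by linarith, h0, by omega, by omega, le_rfl, by omega⟩, _, rfl, by omega, rfl⟩

lemma sum_hurwitzH_eq :
    ∑ t ∈ (Finset.Icc (-(2 * n)) (2 * n)).filter (fun t => t ^ 2 < 4 * n),
      hurwitzH (4 * n - t ^ 2) = ((reducedQuads n).ncard : ℝ) +
      1 / 2 * ((triples n fun a c d => -c < a - d ∧ a - d < c ∧ a = 0).ncard : ℝ) +
      1 / 3 * ((triples n fun a c d => a - d = c ∧ (d = 0 ∨ d = -c)).ncard : ℝ) := by
  have h1 := sum_ncard_reducedForms (n := n) Set.univ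
  have h2 := sum_ncard_reducedForms (n := n) (Set.range fun k : ℤ => (k, (0 : ℤ), k))
  have h3 := sum_ncard_reducedForms (n := n) (Set.range fun k : ℤ => (k, k, k))
  simp only [Set.inter_univ, Set.preimage_univ] at h1
  rw [ncard_formQuads_square] at h2
  rw [ncard_formQuads_hexagon] at h3
  rw [ncard_formQuads] at h1
  have h4 := ncard_diag_eq (n := n)
  have h5 := ncard_edge (n := n)
  have h6 := ncard_reducedQuads_eq (n := n)
  have hs : ∑ t ∈ (Finset.Icc (-(2 * n)) (2 * n)).filter (fun t => t ^ 2 < 4 * n),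
      hurwitzH (4 * n - t ^ 2) =
      ∑ t ∈ (Finset.Icc (-(2 * n)) (2 * n)).filter (fun t => t ^ 2 < 4 * n),
      (((reducedForms (4 * n - t ^ 2)).ncard : ℝ)
    - 1 / 2 * ((reducedForms (4 * n - t ^ 2) ∩
        Set.range fun k : ℤ => (k, (0 : ℤ), k)).ncard : ℝ)
    - 2 / 3 * ((reducedForms (4 * n - t ^ 2) ∩ Set.range fun k : ℤ => (k, k, k)).ncard : ℝ)) :=
    Finset.sum_congr rfl fun t ht => hurwitzH_eq (by
      have := (Finset.mem_filter.1 ht).2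
      omega)
  rw [hs, Finset.sum_sub_distrib, Finset.sum_sub_distrib, ← Finset.mul_sum, ← Finset.mul_sum]
  replace h1 := congrArg (Nat.cast (R := ℝ)) h1
  replace h2 := congrArg (Nat.cast (R := ℝ)) h2
  replace h3 := congrArg (Nat.cast (R := ℝ)) h3
  replace h4 := congrArg (Nat.cast (R := ℝ)) h4
  replace h5 := congrArg (Nat.cast (R := ℝ)) h5
  replace h6 := congrArg (Nat.cast (R := ℝ)) h6
  push_cast at h1 h2 h3 h4 h5 h6
  linarith

lemma hurwitzH_neg {m : ℤ} (hm : m < 0) : hurwitzH m = 0 := by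
  unfold hurwitzH
  rw [if_neg hm.ne, if_neg (by omega)]

lemma sum_divisors_reflect (hn : 1 ≤ n) :
    ∑ B ∈ (Finset.Icc 1 n).filter (fun B => B ∣ n ∧ B ^ 2 < n), B =
      ∑ B ∈ (Finset.Icc 1 n).filter (fun B => B ∣ n ∧ n < B ^ 2), n / B := by
  refine Finset.sum_bij' (fun B _ => n / B) (fun B _ => n / B) ?_ ?_ ?_ ?_ ?_
  · intro B hB
    simp only [Finset.mem_filter, Finset.mem_Icc] at hB ⊢
    obtain ⟨⟨h1, h2⟩, ⟨k, rfl⟩, h3⟩ := hB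
    rw [Int.mul_ediv_cancel_left _ (by omega)]
    refine ⟨⟨by nlinarith, by nlinarith⟩, Dvd.intro_left _ rfl, by nlinarith⟩
  · intro B hB
    simp only [Finset.mem_filter, Finset.mem_Icc] at hB ⊢
    obtain ⟨⟨h1, h2⟩, ⟨k, rfl⟩, h3⟩ := hB
    rw [Int.mul_ediv_cancel_left _ (by omega)]
    refine ⟨⟨by nlinarith, by nlinarith⟩, Dvd.intro_left _ rfl, by nlinarith⟩
  · intro B hB
    simp only [Finset.mem_filter, Finset.mem_Icc] at hB ⊢
    obtain ⟨⟨h1, h2⟩, ⟨k, rfl⟩, h3⟩ := hB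
    rw [Int.mul_ediv_cancel_left _ (by omega)]
    exact Int.mul_ediv_cancel _ (by nlinarith)
  · intro B hB
    simp only [Finset.mem_filter, Finset.mem_Icc] at hB ⊢
    obtain ⟨⟨h1, h2⟩, ⟨k, rfl⟩, h3⟩ := hB
    rw [Int.mul_ediv_cancel_left _ (by omega)]
    exact Int.mul_ediv_cancel _ (by nlinarith)
  · intro B hB
    simp only [Finset.mem_filter, Finset.mem_Icc] at hB ⊢
    obtain ⟨⟨h1, h2⟩, ⟨k, rfl⟩, h3⟩ := hB
    rw [Int.mul_ediv_cancel_left _ (by omega)]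
    exact (Int.mul_ediv_cancel _ (by nlinarith)).symm

lemma sum_divisors_split :
    ∑ B ∈ (Finset.Icc 1 n).filter (fun B => B ∣ n), B =
      ∑ B ∈ (Finset.Icc 1 n).filter (fun B => B ∣ n ∧ n < B ^ 2), B +
      ∑ B ∈ (Finset.Icc 1 n).filter (fun B => B ∣ n ∧ B ^ 2 < n), B +
      ∑ B ∈ (Finset.Icc 1 n).filter (fun B => B ^ 2 = n), B := by
  simp only [Finset.sum_filter, ← Finset.sum_add_distrib]
  refine Finset.sum_congr rfl fun B _ => ?_
  by_cases h : B ∣ n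
  · rcases lt_trichotomy n (B ^ 2) with k | k | k
    · simp [h, k, k.not_gt, k.ne']
    · simp [← k]
      intro h'; rw [k] at h'; exact absurd (Dvd.intro_left _ (sq B).symm) h'
    · simp [h, k, k.not_gt, k.ne]
  · have : B ^ 2 ≠ n := by rintro rfl; exact h (Dvd.intro_left _ (sq B).symm)
    simp [h, this]

/-- The Kronecker–Hurwitz class number relation. -/
theorem class_number_relation (hn : 1 ≤ n) :
    ∑ t ∈ Finset.Icc (-(2 * n)) (2 * n), hurwitzH (4 * n - t ^ 2) =
      ((∑ B ∈ (Finset.Icc 1 n).filter (fun B => B ∣ n), B +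
        ∑ B ∈ (Finset.Icc 1 n).filter (fun B => B ∣ n ∧ n < B ^ 2), (B - n / B) : ℤ) : ℝ) := by
  rw [Finset.sum_sub_distrib, ← sum_divisors_reflect hn, sum_divisors_split,
    ← Finset.sum_filter_add_sum_filter_not _ (fun t : ℤ => t ^ 2 < 4 * n), sum_hurwitzH_eq]
  have hG := ncard_reducedQuads hn
  rw [← Finset.mul_sum] at hG
  have hG' : ((reducedQuads n).ncard : ℝ) =
      ((2 * ∑ B ∈ (Finset.Icc 1 n).filter (fun B => B ∣ n ∧ n < B ^ 2), B : ℤ) : ℝ) := by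
    exact_mod_cast hG
  rw [hG']
  have hrest : ∑ t ∈ (Finset.Icc (-(2 * n)) (2 * n)).filter (fun t => ¬ t ^ 2 < 4 * n),
      hurwitzH (4 * n - t ^ 2) =
      ∑ t ∈ (Finset.Icc (-(2 * n)) (2 * n)).filter (fun t => t ^ 2 = 4 * n), (-(1 / 12) : ℝ) := by
    rw [Finset.sum_filter, Finset.sum_filter]
    refine Finset.sum_congr rfl fun t _ => ?_
    rcases lt_trichotomy (t ^ 2) (4 * n) with h | h | h
    · simp [h, h.ne]
    · simp [h, hurwitzH]
    · rw [if_pos h.not_gt, if_neg h.ne', hurwitzH_neg (by omega)]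
  rw [hrest]
  by_cases hsq : ∃ k : ℤ, 0 < k ∧ k ^ 2 = n
  · obtain ⟨k, hk, hkn⟩ := hsq
    have h1 := ncard_axis_of_sq hk hkn
    have h2 := ncard_rays_of_sq hk hkn
    have h3 : (Finset.Icc 1 n).filter (fun B => B ^ 2 = n) = {k} := by
      ext B
      simp only [Finset.mem_filter, Finset.mem_Icc, Finset.mem_singleton]
      constructor
      · rintro ⟨⟨h, -⟩, h'⟩
        exact (sq_eq_sq₀ (by omega) hk.le).1 (by rw [h', hkn])
      · rintro rfl
        exact ⟨⟨by omega, by nlinarith⟩, hkn⟩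
    have h4 : (Finset.Icc (-(2 * n)) (2 * n)).filter (fun t => t ^ 2 = 4 * n) =
        {2 * k, -(2 * k)} := by
      ext t
      simp only [Finset.mem_filter, Finset.mem_Icc, Finset.mem_singleton, Finset.mem_insert]
      rw [← sq_eq_sq_iff_eq_or_eq_neg, ← hkn]
      constructor
      · rintro ⟨-, h⟩
        rw [h]; ring
      · intro h
        have : |t| ≤ 2 * k ^ 2 := abs_le_of_sq_le_sq (by nlinarith) (by nlinarith)
        exact ⟨abs_le.1 this, by rw [h]; ring⟩
    have h1' : ((triples n fun a c d => -c < a - d ∧ a - d < c ∧ a = 0).ncard : ℝ) = 2 * k - 1 := by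
      exact_mod_cast h1
    rw [h1', h2, h3, h4, Finset.sum_pair (by omega), Finset.sum_singleton]
    push_cast
    ring
  · rw [ncard_axis_of_not_sq hsq, ncard_rays_of_not_sq hsq]
    have h3 : (Finset.Icc 1 n).filter (fun B => B ^ 2 = n) = ∅ := by
      rw [Finset.filter_eq_empty_iff]
      intro B hB h
      exact hsq ⟨B, by have := (Finset.mem_Icc.1 hB).1; omega, h⟩
    have h4 : (Finset.Icc (-(2 * n)) (2 * n)).filter (fun t => t ^ 2 = 4 * n) = ∅ := by
      rw [Finset.filter_eq_empty_iff]
      intro t _ h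
      obtain ⟨s, hs⟩ : (2 : ℤ) ∣ t := Int.prime_two.dvd_of_dvd_pow (n := 2) ⟨2 * n, by linarith⟩
      refine hsq ⟨|s|, ?_, ?_⟩
      · rw [abs_pos]; rintro rfl; subst hs; omega
      · rw [sq_abs]; subst hs; linarith
    rw [h3, h4]
    push_cast
    simp only [Finset.sum_empty]
    ring

end ClassNumberRelation

namespace ZagierSum

open scoped ENNReal

/-- The value of the form `a X² + b X + c` at a real number. -/
def evalForm (Q : ℤ × ℤ × ℤ) (x : ℝ) : ℝ := Q.1 * x ^ 2 + Q.2.1 * x + Q.2.2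

/-- The forms `[a, b, c]` of discriminant `D` for which `P a c` holds. -/
def formsWith (D : ℤ) (P : ℤ → ℤ → Prop) : Set (ℤ × ℤ × ℤ) :=
  {Q | Q.2.1 ^ 2 - 4 * Q.1 * Q.2.2 = D ∧ P Q.1 Q.2.2}

/-- The sum of the positive parts of the values at `x` of the forms in `formsWith D P`. -/
noncomputable def posSum (D : ℤ) (P : ℤ → ℤ → Prop) (x : ℝ) : ℝ≥0∞ :=
  ∑' Q, (formsWith D P).indicator (fun Q => ENNReal.ofReal (evalForm Q x)) Q

variable {D : ℤ}

lemma posSum_split {P P₁ P₂ : ℤ → ℤ → Prop} (h : ∀ a c, P a c ↔ P₁ a c ∨ P₂ a c)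
    (h' : ∀ a c, P₁ a c → ¬ P₂ a c) (x : ℝ) :
    posSum D P x = posSum D P₁ x + posSum D P₂ x := by
  have e : formsWith D P = formsWith D P₁ ∪ formsWith D P₂ := by
    ext Q; simp only [formsWith, Set.mem_union, Set.mem_ofPred_eq, h]; tauto
  have d : Disjoint (formsWith D P₁) (formsWith D P₂) := by
    rw [Set.disjoint_left]; exact fun Q h1 h2 => h' _ _ h1.2 h2.2
  unfold posSum
  rw [e, Set.indicator_union_of_disjoint d, ← ENNReal.tsum_add]

lemma posSum_congr_equiv {P P' : ℤ → ℤ → Prop} (e : ℤ × ℤ × ℤ ≃ ℤ × ℤ × ℤ) {x y : ℝ}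
    (h : ∀ Q, e Q ∈ formsWith D P' ↔ Q ∈ formsWith D P)
    (hv : ∀ Q, evalForm (e Q) y = evalForm Q x) :
    posSum D P x = posSum D P' y := by
  unfold posSum
  refine Eq.trans (tsum_congr fun Q => ?_) (e.tsum_eq _)
  by_cases hQ : Q ∈ formsWith D P
  · rw [Set.indicator_of_mem hQ, Set.indicator_of_mem ((h Q).2 hQ), hv]
  · rw [Set.indicator_of_notMem hQ, Set.indicator_of_notMem (fun h' => hQ ((h Q).1 h'))]

def translateForm : ℤ × ℤ × ℤ ≃ ℤ × ℤ × ℤ where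
  toFun Q := (Q.1, Q.2.1 + 2 * Q.1, Q.1 + Q.2.1 + Q.2.2)
  invFun Q := (Q.1, Q.2.1 - 2 * Q.1, Q.1 - Q.2.1 + Q.2.2)
  left_inv Q := by
    ext <;> simp
    ring
  right_inv Q := by
    ext <;> simp
    ring

def swapForm : ℤ × ℤ × ℤ ≃ ℤ × ℤ × ℤ where
  toFun Q := (Q.2.2, Q.2.1, Q.1)
  invFun Q := (Q.2.2, Q.2.1, Q.1)
  left_inv _ := rfl
  right_inv _ := rfl

lemma posSum_add_one (x : ℝ) :
    posSum D (fun a _ => a < 0) (x + 1) = posSum D (fun a _ => a < 0) x := by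
  refine posSum_congr_equiv translateForm (fun Q => ?_) fun Q => ?_
  · simp only [formsWith, translateForm, Equiv.coe_fn_mk, Set.mem_ofPred_eq]
    have : (Q.2.1 + 2 * Q.1) ^ 2 - 4 * Q.1 * (Q.1 + Q.2.1 + Q.2.2) =
      Q.2.1 ^ 2 - 4 * Q.1 * Q.2.2 := by ring
    rw [this]
  · simp only [evalForm, translateForm, Equiv.coe_fn_mk]
    push_cast; ring

lemma posSum_inv {x : ℝ} (hx : 0 < x) (P : ℤ → ℤ → Prop) :
    ENNReal.ofReal (x ^ 2) * posSum D P (1 / x) = posSum D (fun a c => P c a) x := by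
  unfold posSum
  rw [← swapForm.tsum_eq (fun Q => (formsWith D (fun a c => P c a)).indicator _ Q),
    ← ENNReal.tsum_mul_left]
  refine tsum_congr fun Q => ?_
  have hQ' : swapForm Q ∈ formsWith D (fun a c => P c a) ↔ Q ∈ formsWith D P := by
    simp only [formsWith, swapForm, Equiv.coe_fn_mk, Set.mem_ofPred_eq]
    rw [show 4 * Q.2.2 * Q.1 = 4 * Q.1 * Q.2.2 by ring]
  by_cases hQ : Q ∈ formsWith D P
  · rw [Set.indicator_of_mem hQ, Set.indicator_of_mem (hQ'.2 hQ),
      ← ENNReal.ofReal_mul (sq_nonneg x)]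
    congr 1
    simp only [evalForm, swapForm, Equiv.coe_fn_mk]
    field_simp
    ring
  · rw [Set.indicator_of_notMem hQ, Set.indicator_of_notMem (fun h' => hQ (hQ'.1 h')), mul_zero]

lemma formsWith_finite : (formsWith D (fun a c => a < 0 ∧ 0 < c)).Finite := by
  refine ((Set.finite_Icc (-D) D).prod ((Set.finite_Icc (-D) D).prod
    (Set.finite_Icc (-D) D))).subset ?_
  rintro ⟨a, b, c⟩ ⟨h, h1, h2⟩
  simp only at h h1 h2
  simp only [Set.mem_prod, Set.mem_Icc]
  have h3 : 0 < -a * c := mul_pos (by linarith) h2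
  refine ⟨⟨by nlinarith [sq_nonneg b], by nlinarith [sq_nonneg b]⟩,
    ⟨by nlinarith [sq_nonneg (b + 1)], by nlinarith [sq_nonneg (b - 1)]⟩,
    by nlinarith [sq_nonneg b], by nlinarith [sq_nonneg b]⟩

/-- The finite set of forms with `a < 0 < c`. -/
noncomputable def indefForms (D : ℤ) : Finset (ℤ × ℤ × ℤ) := (formsWith_finite (D := D)).toFinset

lemma mem_indefForms {Q : ℤ × ℤ × ℤ} :
    Q ∈ indefForms D ↔ Q.2.1 ^ 2 - 4 * Q.1 * Q.2.2 = D ∧ Q.1 < 0 ∧ 0 < Q.2.2 := by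
  simp [indefForms, formsWith]

lemma posSum_neg_pos (x : ℝ) : posSum D (fun a c => a < 0 ∧ 0 < c) x =
    ENNReal.ofReal (∑ Q ∈ indefForms D, max (evalForm Q x) 0) := by
  unfold posSum
  rw [tsum_eq_sum (s := indefForms D), ENNReal.ofReal_sum_of_nonneg
    (fun _ _ => le_max_right _ _)]
  · refine Finset.sum_congr rfl fun Q hQ => ?_
    rw [Set.indicator_of_mem, ENNReal.ofReal_max]
    · simp
    · exact mem_indefForms.1 hQ
  · intro Q hQ
    refine Set.indicator_of_notMem (fun h => hQ (mem_indefForms.2 ?_)) _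
    exact h

lemma posSum_pos_neg (x : ℝ) : posSum D (fun a c => 0 < a ∧ c < 0) x =
    ENNReal.ofReal (∑ Q ∈ indefForms D, max (-evalForm Q x) 0) := by
  unfold posSum
  rw [← (Equiv.neg (ℤ × ℤ × ℤ)).tsum_eq, tsum_eq_sum (s := indefForms D),
    ENNReal.ofReal_sum_of_nonneg (fun _ _ => le_max_right _ _)]
  · refine Finset.sum_congr rfl fun Q hQ => ?_
    have hQ' := mem_indefForms.1 hQ
    rw [Set.indicator_of_mem, ENNReal.ofReal_max]
    · simp only [evalForm, Equiv.neg_apply, Prod.fst_neg, Prod.snd_neg, Int.cast_neg,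
        ENNReal.ofReal_zero, zero_le, sup_of_le_left]
      congr 1
      ring
    · refine ⟨?_, ?_, ?_⟩ <;> simp
      · exact hQ'.1
      · exact hQ'.2.1
      · exact hQ'.2.2
  · intro Q hQ
    refine Set.indicator_of_notMem (fun h => hQ (mem_indefForms.2 ?_)) _
    obtain ⟨h1, h2, h3⟩ := h
    simp at h1 h2 h3
    exact ⟨h1, h2, h3⟩

/-- The sum of the last coefficients of the forms with `a < 0 < c`. -/
noncomputable def coeffSum (D : ℤ) : ℤ := ∑ Q ∈ indefForms D, Q.2.2

lemma sum_fst_indefForms : ∑ Q ∈ indefForms D, Q.1 = -coeffSum D := by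
  rw [coeffSum, ← Finset.sum_neg_distrib]
  refine Finset.sum_nbij' (fun Q => (-Q.2.2, Q.2.1, -Q.1)) (fun Q => (-Q.2.2, Q.2.1, -Q.1))
    ?_ ?_ ?_ ?_ ?_
  · intro Q hQ
    rw [mem_indefForms] at hQ ⊢
    refine ⟨?_, ?_, ?_⟩ <;> simp only
    · rw [← hQ.1]; ring
    · linarith [hQ.2.2]
    · linarith [hQ.2.1]
  · intro Q hQ
    rw [mem_indefForms] at hQ ⊢
    refine ⟨?_, ?_, ?_⟩ <;> simp only
    · rw [← hQ.1]; ring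
    · linarith [hQ.2.2]
    · linarith [hQ.2.1]
  all_goals intro Q _; simp

lemma sum_snd_indefForms : ∑ Q ∈ indefForms D, Q.2.1 = 0 := by
  have : ∑ Q ∈ indefForms D, Q.2.1 = ∑ Q ∈ indefForms D, -Q.2.1 := by
    refine Finset.sum_nbij' (fun Q => (Q.1, -Q.2.1, Q.2.2)) (fun Q => (Q.1, -Q.2.1, Q.2.2))
      ?_ ?_ ?_ ?_ ?_
    · intro Q hQ
      rw [mem_indefForms] at hQ ⊢
      simpa using hQ
    · intro Q hQ
      rw [mem_indefForms] at hQ ⊢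
      simpa using hQ
    all_goals intro Q _; simp
  rw [Finset.sum_neg_distrib] at this
  linarith

lemma sum_eval_indefForms (x : ℝ) :
    ∑ Q ∈ indefForms D, max (evalForm Q x) 0 - ∑ Q ∈ indefForms D, max (-evalForm Q x) 0 =
      coeffSum D * (1 - x ^ 2) := by
  rw [← Finset.sum_sub_distrib]
  have h1 : ∀ Q ∈ indefForms D, max (evalForm Q x) 0 - max (-evalForm Q x) 0 =
      Q.1 * x ^ 2 + Q.2.1 * x + Q.2.2 := by
    intro Q _
    rcases le_total 0 (evalForm Q x) with h | h
    · rw [max_eq_left h, max_eq_right (by linarith), sub_zero, evalForm]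
    · rw [max_eq_right h, max_eq_left (by linarith), zero_sub, neg_neg, evalForm]
  rw [Finset.sum_congr rfl h1, Finset.sum_add_distrib, Finset.sum_add_distrib, ← Finset.sum_mul,
    ← Finset.sum_mul, ← Int.cast_sum, ← Int.cast_sum, ← Int.cast_sum, sum_fst_indefForms,
    sum_snd_indefForms, ← coeffSum]
  push_cast; ring

/-- `∑_{m ≥ 1} max (y - m) 0` for `y ≥ 0`. -/
noncomputable def tailSum (y : ℝ) : ℝ := (y ^ 2 - y - Int.fract y ^ 2 + Int.fract y) / 2

lemma tailSum_eq {y : ℝ} (hy : 0 ≤ y) :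
    tailSum y = ∑ m ∈ Finset.range ⌊y⌋₊, (y - (m + 1)) := by
  have h1 : ∀ n : ℕ, ∑ m ∈ Finset.range n, (y - (m + 1)) = n * y - n * (n + 1) / 2 := by
    intro n
    induction n with
    | zero => simp
    | succ n ih => rw [Finset.sum_range_succ, ih]; push_cast; ring
  have h2 : Int.fract y = y - ⌊y⌋₊ := by
    rw [Int.fract, natCast_floor_eq_intCast_floor hy]
  rw [h1, tailSum, h2]; ring

lemma le_of_lt_floor {y : ℝ} {m : ℕ} (h : m < ⌊y⌋₊) : 0 ≤ y - (m + 1) := by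
  have : ((m + 1 : ℕ) : ℝ) ≤ y := (Nat.le_floor_iff' (by omega)).1 h
  push_cast at this
  linarith

lemma tailSum_nonneg {y : ℝ} (hy : 0 ≤ y) : 0 ≤ tailSum y := by
  rw [tailSum_eq hy]
  exact Finset.sum_nonneg fun m hm => le_of_lt_floor (Finset.mem_range.1 hm)

lemma tsum_tail {y : ℝ} (hy : 0 ≤ y) :
    ∑' m : ℕ, ENNReal.ofReal (y - (m + 1)) = ENNReal.ofReal (tailSum y) := by
  rw [tailSum_eq hy, ENNReal.ofReal_sum_of_nonneg
    fun m hm => le_of_lt_floor (Finset.mem_range.1 hm)]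
  refine tsum_eq_sum fun m hm => ENNReal.ofReal_of_nonpos ?_
  have : y < m + 1 := by
    have := Nat.lt_floor_add_one y
    have h2 : (⌊y⌋₊ : ℝ) ≤ m := by
      exact_mod_cast not_lt.1 (fun h => hm (Finset.mem_range.2 h))
    linarith
  linarith

lemma posSum_linear_of_sq {k : ℕ} (hk : 0 < k) (hD : (k : ℤ) ^ 2 = D) {x : ℝ} (hx : 0 < x) :
    posSum D (fun a c => a = 0 ∧ c < 0) x = ENNReal.ofReal (tailSum (k * x)) := by
  rw [← tsum_tail (by positivity)]
  unfold posSum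
  let i : ℕ → ℤ × ℤ × ℤ := fun m => (0, k, -(m + 1))
  have hi : Function.Injective i := fun m m' h => by
    simp only [i, Prod.mk.injEq] at h; omega
  rw [← hi.tsum_eq]
  · refine tsum_congr fun m => ?_
    rw [Set.indicator_of_mem]
    · congr 1
      simp only [evalForm, i]; push_cast; ring
    · refine ⟨?_, rfl, ?_⟩ <;> simp only [i]
      · rw [← hD]; ring
      · omega
  · rintro ⟨a, b, c⟩ hQ
    have hmem := Set.mem_of_indicator_ne_zero hQ
    rw [Function.mem_support, Set.indicator_of_mem hmem] at hQ
    obtain ⟨h1, h2, h3⟩ := hmem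
    simp only at h1 h2 h3
    subst h2
    have hb : b = k ∨ b = -k := by
      rw [← sq_eq_sq_iff_eq_or_eq_neg, hD]; linarith
    have hc : (c : ℝ) < 0 := by exact_mod_cast h3
    rcases hb with rfl | rfl
    · refine ⟨(-c - 1).toNat, ?_⟩
      simp only [i, Prod.mk.injEq, true_and]
      omega
    · exfalso
      apply hQ
      apply ENNReal.ofReal_of_nonpos
      simp only [evalForm]
      push_cast
      have : 0 ≤ (k : ℝ) * x := by positivity
      linarith

lemma posSum_linear_of_not_sq (hD : ¬ ∃ k : ℤ, k ^ 2 = D) (x : ℝ) :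
    posSum D (fun a c => a = 0 ∧ c < 0) x = 0 := by
  unfold posSum
  rw [ENNReal.tsum_eq_zero]
  rintro ⟨a, b, c⟩
  refine Set.indicator_of_notMem ?_ _
  rintro ⟨h1, h2, -⟩
  simp only at h1 h2
  subst h2
  exact hD ⟨b, by linarith⟩

/-- Either `D = k²` and `κ = 1`, or `D` is not a square and `κ = 0`. -/
def IsSquareData (D : ℤ) (k : ℕ) (κ : ℝ) : Prop :=
  0 < k ∧ ((κ = 1 ∧ (k : ℤ) ^ 2 = D) ∨ (κ = 0 ∧ ¬ ∃ k : ℤ, k ^ 2 = D))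

variable {k : ℕ} {κ : ℝ}

lemma IsSquareData.nonneg (h : IsSquareData D k κ) : 0 ≤ κ := by
  rcases h.2 with h | h <;> rw [h.1]; exact zero_le_one

lemma posSum_linear (h : IsSquareData D k κ) {x : ℝ} (hx : 0 < x) :
    posSum D (fun a c => a = 0 ∧ c < 0) x = ENNReal.ofReal (κ * tailSum (k * x)) := by
  rcases h with ⟨hk, ⟨rfl, hD⟩ | ⟨rfl, hD⟩⟩
  · rw [posSum_linear_of_sq hk hD hx, one_mul]
  · rw [posSum_linear_of_not_sq hD]; simp

lemma posSum_linear' (h : IsSquareData D k κ) {x : ℝ} (hx : 0 < x) :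
    posSum D (fun a c => a < 0 ∧ c = 0) x =
      ENNReal.ofReal (x ^ 2 * (κ * tailSum (k * (1 / x)))) := by
  have := posSum_inv (D := D) hx (fun a c => a = 0 ∧ c < 0)
  rw [posSum_linear h (by positivity), ← ENNReal.ofReal_mul (sq_nonneg x)] at this
  rw [this]
  congr 1
  ext a c
  tauto

/-- The functional equation of the sum over forms with `a < 0` under `x ↦ 1 / x`. -/
lemma posSum_functional_equation (h : IsSquareData D k κ) {x : ℝ} (hx : 0 < x) :
    posSum D (fun a _ => a < 0) x +
      ENNReal.ofReal (∑ Q ∈ indefForms D, max (-evalForm Q x) 0 + κ * tailSum (k * x)) =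
    ENNReal.ofReal (x ^ 2) * posSum D (fun a _ => a < 0) (1 / x) +
      ENNReal.ofReal (∑ Q ∈ indefForms D, max (evalForm Q x) 0 +
        x ^ 2 * (κ * tailSum (k * (1 / x)))) := by
  have hκ := h.nonneg
  have t1 : 0 ≤ tailSum (k * x) := tailSum_nonneg (by positivity)
  have t2 : 0 ≤ tailSum (k * (1 / x)) := tailSum_nonneg (by positivity)
  rw [posSum_inv hx, ENNReal.ofReal_add (Finset.sum_nonneg fun _ _ => le_max_right _ _)
    (by positivity), ENNReal.ofReal_add (Finset.sum_nonneg fun _ _ => le_max_right _ _)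
    (by positivity), ← posSum_linear' h hx, ← posSum_linear h hx, ← posSum_neg_pos,
    ← posSum_pos_neg]
  rw [posSum_split (P := fun a _ => a < 0) (P₁ := fun a c => a < 0 ∧ c < 0)
      (P₂ := fun a c => a < 0 ∧ 0 ≤ c) (by omega) (by omega),
    posSum_split (P := fun a c => a < 0 ∧ 0 ≤ c) (P₁ := fun a c => a < 0 ∧ 0 < c)
      (P₂ := fun a c => a < 0 ∧ c = 0) (by omega) (by omega),
    posSum_split (P := fun _ c => c < 0) (P₁ := fun a c => a < 0 ∧ c < 0)
      (P₂ := fun a c => 0 ≤ a ∧ c < 0) (by omega) (by omega),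
    posSum_split (P := fun a c => 0 ≤ a ∧ c < 0) (P₁ := fun a c => 0 < a ∧ c < 0)
      (P₂ := fun a c => a = 0 ∧ c < 0) (by omega) (by omega)]
  abel

end ZagierSum

namespace ZagierSum

open scoped ENNReal

variable {D : ℤ} {k : ℕ} {κ : ℝ}

lemma periodic_posSum : Function.Periodic (posSum D (fun a _ => a < 0)) 1 := posSum_add_one

/-- A bound for the inhomogeneous term of the functional equation on `[0, 1]`. -/
noncomputable def formBound (D : ℤ) (k : ℕ) (κ : ℝ) : ℝ :=
  ∑ Q ∈ indefForms D, (|(Q.1 : ℝ)| + |(Q.2.1 : ℝ)| + |(Q.2.2 : ℝ)|) + κ * (k ^ 2 + 1)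

lemma formBound_nonneg (h : IsSquareData D k κ) : 0 ≤ formBound D k κ := by
  have := h.nonneg
  unfold formBound
  positivity

lemma sum_max_evalForm_le {x : ℝ} (h0 : 0 ≤ x) (h1 : x ≤ 1) :
    ∑ Q ∈ indefForms D, max (evalForm Q x) 0 ≤
      ∑ Q ∈ indefForms D, (|(Q.1 : ℝ)| + |(Q.2.1 : ℝ)| + |(Q.2.2 : ℝ)|) := by
  refine Finset.sum_le_sum fun Q _ => max_le ?_ (by positivity)
  have e1 : (Q.1 : ℝ) * x ^ 2 ≤ |(Q.1 : ℝ)| := by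
    calc (Q.1 : ℝ) * x ^ 2 ≤ |(Q.1 : ℝ)| * x ^ 2 :=
          mul_le_mul_of_nonneg_right (le_abs_self _) (sq_nonneg x)
      _ ≤ |(Q.1 : ℝ)| * 1 := mul_le_mul_of_nonneg_left (pow_le_one₀ h0 h1) (abs_nonneg _)
      _ = _ := mul_one _
  have e2 : (Q.2.1 : ℝ) * x ≤ |(Q.2.1 : ℝ)| := by
    calc (Q.2.1 : ℝ) * x ≤ |(Q.2.1 : ℝ)| * x := mul_le_mul_of_nonneg_right (le_abs_self _) h0
      _ ≤ |(Q.2.1 : ℝ)| * 1 := mul_le_mul_of_nonneg_left h1 (abs_nonneg _)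
      _ = _ := mul_one _
  have e3 := le_abs_self (Q.2.2 : ℝ)
  unfold evalForm
  linarith

lemma posSum_zero_le (h : IsSquareData D k κ) :
    posSum D (fun a _ => a < 0) 0 ≤ ENNReal.ofReal (formBound D k κ) := by
  rw [posSum_split (P := fun a _ => a < 0) (P₁ := fun a c => a < 0 ∧ 0 < c)
      (P₂ := fun a c => a < 0 ∧ c ≤ 0) (by omega) (by omega), posSum_neg_pos]
  have h0 : posSum D (fun a c => a < 0 ∧ c ≤ 0) 0 = 0 := by
    unfold posSum
    rw [ENNReal.tsum_eq_zero]
    intro Q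
    rw [Set.indicator_apply_eq_zero]
    intro hQ
    apply ENNReal.ofReal_of_nonpos
    have : (Q.2.2 : ℝ) ≤ 0 := by exact_mod_cast hQ.2.2
    simpa [evalForm] using this
  rw [h0, add_zero]
  apply ENNReal.ofReal_le_ofReal
  have := sum_max_evalForm_le (D := D) (x := 0) le_rfl zero_le_one
  have h2 : 0 ≤ κ * ((k : ℝ) ^ 2 + 1) := mul_nonneg h.nonneg (by positivity)
  unfold formBound
  linarith

lemma posSum_le_inv (h : IsSquareData D k κ) {x : ℝ} (hx : 0 < x) (hx1 : x ≤ 1) :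
    posSum D (fun a _ => a < 0) x ≤ ENNReal.ofReal (formBound D k κ) +
      ENNReal.ofReal (x ^ 2) * posSum D (fun a _ => a < 0) (1 / x) := by
  refine le_self_add.trans ((posSum_functional_equation h hx).trans_le ?_)
  rw [add_comm]
  gcongr
  have h1 := sum_max_evalForm_le (D := D) hx.le hx1
  have h2 : x ^ 2 * (κ * tailSum (k * (1 / x))) ≤ κ * (k ^ 2 + 1) := by
    rw [mul_left_comm]
    refine mul_le_mul_of_nonneg_left ?_ h.nonneg
    have e : x ^ 2 * tailSum (k * (1 / x)) = (k ^ 2 - k * x -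
        x ^ 2 * (Int.fract (k * (1 / x)) ^ 2 - Int.fract (k * (1 / x)))) / 2 := by
      unfold tailSum; field_simp; ring
    rw [e]
    have f0 := Int.fract_nonneg (k * (1 / x))
    have f1 := (Int.fract_lt_one (k * (1 / x))).le
    set y := Int.fract (k * (1 / x))
    have : 0 ≤ (k : ℝ) * x := by positivity
    have h3 : x ^ 2 * (y - y ^ 2) ≤ 1 * 1 :=
      mul_le_mul (pow_le_one₀ hx.le hx1) (by nlinarith) (by nlinarith) zero_le_one
    nlinarith [sq_nonneg (k : ℝ)]
  unfold formBound
  linarith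

lemma posSum_div_le (h : IsSquareData D k κ) (q : ℕ) : ∀ p < q,
    posSum D (fun a _ => a < 0) ((p : ℝ) / q) ≤
      ENNReal.ofReal (formBound D k κ * (1 + (p : ℝ) / q)) := by
  have hM := formBound_nonneg h
  induction q using Nat.strong_induction_on with
  | _ q ih =>
    intro p hp
    rcases Nat.eq_zero_or_pos p with rfl | hp0
    · simpa using posSum_zero_le h
    have hpR : (0 : ℝ) < p := by exact_mod_cast hp0
    have hqR : (0 : ℝ) < q := by exact_mod_cast hp0.trans hp
    have hpq : (p : ℝ) ≤ q := by exact_mod_cast hp.le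
    refine (posSum_le_inv h (div_pos hpR hqR) ((div_le_one hqR).2 hpq)).trans ?_
    have e : (1 : ℝ) / ((p : ℝ) / q) = ((q % p : ℕ) : ℝ) / p + ((q / p : ℕ) : ℝ) * 1 := by
      have : (q : ℝ) = (q % p : ℕ) + p * (q / p : ℕ) := by exact_mod_cast (Nat.mod_add_div q p).symm
      rw [one_div_div, mul_one]
      field_simp
      linarith
    rw [e, (periodic_posSum.nat_mul (q / p)) _]
    have hr := Nat.mod_lt q hp0
    have hrq : q % p + p ≤ q := by
      have h1 := Nat.mod_add_div q p
      have h2 : p * 1 ≤ p * (q / p) := Nat.mul_le_mul_left p (Nat.div_pos hp.le hp0)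
      omega
    have hrqR : ((q % p : ℕ) : ℝ) + p ≤ q := by exact_mod_cast hrq
    calc _ ≤ ENNReal.ofReal (formBound D k κ) + ENNReal.ofReal (((p : ℝ) / q) ^ 2) *
          ENNReal.ofReal (formBound D k κ * (1 + ((q % p : ℕ) : ℝ) / p)) := by
          gcongr; exact ih p hp _ hr
      _ = ENNReal.ofReal (formBound D k κ + ((p : ℝ) / q) ^ 2 *
          (formBound D k κ * (1 + ((q % p : ℕ) : ℝ) / p))) := by
          rw [← ENNReal.ofReal_mul (by positivity), ENNReal.ofReal_add hM (by positivity)]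
      _ ≤ _ := by
          apply ENNReal.ofReal_le_ofReal
          have : ((p : ℝ) / q) ^ 2 * (1 + ((q % p : ℕ) : ℝ) / p) ≤ (p : ℝ) / q := by
            have e2 : ((p : ℝ) / q) ^ 2 * (1 + ((q % p : ℕ) : ℝ) / p) =
                (p : ℝ) / q * ((((q % p : ℕ) : ℝ) + p) / q) := by field_simp; ring
            rw [e2]
            exact mul_le_of_le_one_right (by positivity) ((div_le_one hqR).2 hrqR)
          nlinarith [mul_le_mul_of_nonneg_left this hM]

lemma lowerSemicontinuous_posSum (P : ℤ → ℤ → Prop) : LowerSemicontinuous (posSum D P) := by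
  refine lowerSemicontinuous_tsum fun Q => Continuous.lowerSemicontinuous ?_
  by_cases hQ : Q ∈ formsWith D P
  · simp only [Set.indicator_of_mem hQ, evalForm]
    exact ENNReal.continuous_ofReal.comp (by fun_prop)
  · simp only [Set.indicator_of_notMem hQ]
    exact continuous_const

lemma posSum_le (h : IsSquareData D k κ) (x : ℝ) :
    posSum D (fun a _ => a < 0) x ≤ ENNReal.ofReal (2 * formBound D k κ) := by
  have hM := formBound_nonneg h
  have hcl : IsClosed {x | posSum D (fun a _ => a < 0) x ≤ ENNReal.ofReal (2 * formBound D k κ)} :=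
    (lowerSemicontinuous_posSum _).isClosed_preimage _
  have hd : DenseRange ((↑) : ℚ → ℝ) := Rat.denseRange_cast
  refine hcl.closure_subset_iff.2 (Set.range_subset_iff.2 fun r => ?_) (hd x)
  have hpos : 0 < (r.den : ℤ) := by exact_mod_cast r.den_pos
  obtain ⟨p, hp⟩ := Int.eq_ofNat_of_zero_le (Int.emod_nonneg r.num hpos.ne')
  have hlt : p < r.den := by
    have := Int.emod_lt_of_pos r.num hpos
    omega
  have hdR : (0 : ℝ) < r.den := by exact_mod_cast hpos
  have e : (r : ℝ) = (p : ℝ) / r.den + ((r.num / r.den : ℤ) : ℝ) * 1 := by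
    have h1 : (r.num : ℝ) = p + r.den * ((r.num / r.den : ℤ) : ℝ) := by
      exact_mod_cast (hp ▸ (Int.emod_add_mul_ediv r.num r.den).symm)
    rw [Rat.cast_def, h1]
    field_simp
  rw [Set.mem_ofPred_eq, e, (periodic_posSum.int_mul _) _]
  refine (posSum_div_le h _ _ hlt).trans (ENNReal.ofReal_le_ofReal ?_)
  have : (p : ℝ) / r.den ≤ 1 := (div_le_one hdR).2 (by exact_mod_cast hlt.le)
  nlinarith

end ZagierSum

namespace ZagierSum

open scoped ENNReal
open MeasureTheory

variable {D : ℤ} {k : ℕ} {κ : ℝ}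

/-- Half of the second Bernoulli function. -/
noncomputable def halfBernoulli (y : ℝ) : ℝ := (Int.fract y ^ 2 - Int.fract y) / 2 + 1 / 12

/-- The average of the sum over forms with `a < 0`. -/
noncomputable def meanValue (D : ℤ) (k : ℕ) (κ : ℝ) : ℝ := coeffSum D + κ * (k ^ 2 / 2 - 1 / 12)

lemma halfBernoulli_periodic : Function.Periodic halfBernoulli 1 := fun x => by
  simp [halfBernoulli]

lemma abs_halfBernoulli_le (y : ℝ) : |halfBernoulli y| ≤ 1 := by
  have h0 := Int.fract_nonneg y
  have h1 := (Int.fract_lt_one y).le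
  unfold halfBernoulli
  rw [abs_le]
  constructor <;> nlinarith

/-- The deviation of the sum over forms with `a < 0` from its expected value. -/
noncomputable def deviation (D : ℤ) (k : ℕ) (κ : ℝ) (x : ℝ) : ℝ :=
  (posSum D (fun a _ => a < 0) x).toReal - κ * halfBernoulli (k * x) - meanValue D k κ

lemma deviation_periodic : Function.Periodic (deviation D k κ) 1 := fun x => by
  have h : halfBernoulli (k * (x + 1)) = halfBernoulli (k * x) := by
    have := (halfBernoulli_periodic.nat_mul k) (k * x)
    rw [← this]; congr 1; ring
  simp only [deviation, posSum_add_one, h]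

lemma posSum_ne_top (h : IsSquareData D k κ) (x : ℝ) : posSum D (fun a _ => a < 0) x ≠ ∞ :=
  ((posSum_le h x).trans_lt ENNReal.ofReal_lt_top).ne

lemma deviation_inv (h : IsSquareData D k κ) {x : ℝ} (hx : 0 < x) :
    deviation D k κ x = x ^ 2 * deviation D k κ (1 / x) := by
  have hfe := congrArg ENNReal.toReal (posSum_functional_equation h hx)
  have t1 : 0 ≤ tailSum (k * x) := tailSum_nonneg (by positivity)
  have t2 : 0 ≤ tailSum (k * (1 / x)) := tailSum_nonneg (by positivity)
  have hκ := h.nonneg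
  have s1 : 0 ≤ ∑ Q ∈ indefForms D, max (-evalForm Q x) 0 :=
    Finset.sum_nonneg fun _ _ => le_max_right _ _
  have s2 : 0 ≤ ∑ Q ∈ indefForms D, max (evalForm Q x) 0 :=
    Finset.sum_nonneg fun _ _ => le_max_right _ _
  rw [ENNReal.toReal_add (posSum_ne_top h x) ENNReal.ofReal_ne_top,
    ENNReal.toReal_add (ENNReal.mul_ne_top ENNReal.ofReal_ne_top (posSum_ne_top h _))
      ENNReal.ofReal_ne_top, ENNReal.toReal_mul, ENNReal.toReal_ofReal (by positivity),
    ENNReal.toReal_ofReal (by positivity), ENNReal.toReal_ofReal (by positivity)] at hfe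
  have hs := sum_eval_indefForms (D := D) x
  have e1 : tailSum (k * x) = ((k * x) ^ 2 - k * x) / 2 - halfBernoulli (k * x) + 1 / 12 := by
    unfold tailSum halfBernoulli; ring
  have e2 : x ^ 2 * (κ * tailSum (k * (1 / x))) =
      κ * ((k ^ 2 - k * x) / 2 - x ^ 2 * halfBernoulli (k * (1 / x)) + x ^ 2 / 12) := by
    unfold tailSum halfBernoulli; field_simp; ring
  rw [e1, e2] at hfe
  unfold deviation meanValue
  linear_combination hfe + hs

lemma exists_abs_deviation_le (h : IsSquareData D k κ) : ∃ B, 0 ≤ B ∧ ∀ x, |deviation D k κ x| ≤ B := by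
  refine ⟨2 * formBound D k κ + κ + |meanValue D k κ|, ?_, fun x => ?_⟩
  · have := formBound_nonneg h
    have := h.nonneg
    positivity
  · have h1 : (posSum D (fun a _ => a < 0) x).toReal ≤ 2 * formBound D k κ :=
      ENNReal.toReal_le_of_le_ofReal (by linarith [formBound_nonneg h]) (posSum_le h x)
    have h2 : |κ * halfBernoulli (k * x)| ≤ κ := by
      rw [abs_mul, abs_of_nonneg h.nonneg]
      exact mul_le_of_le_one_right h.nonneg (abs_halfBernoulli_le _)
    have h3 : 0 ≤ (posSum D (fun a _ => a < 0) x).toReal := ENNReal.toReal_nonneg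
    unfold deviation
    refine (abs_sub _ _).trans (add_le_add ((abs_sub _ _).trans (add_le_add ?_ h2)) le_rfl)
    rwa [abs_of_nonneg h3]

lemma deviation_eq_fract (h : IsSquareData D k κ) {x : ℝ} (hx : 0 < x) :
    deviation D k κ x = x ^ 2 * deviation D k κ (Int.fract (1 / x)) := by
  rw [deviation_inv h hx]
  congr 1
  have := (deviation_periodic (D := D) (k := k) (κ := κ)).int_mul ⌊1 / x⌋ (Int.fract (1 / x))
  rw [← this, mul_one, Int.fract_add_floor]

lemma gauss_map_props {x : ℝ} (hx : Irrational x) (h0 : 0 < x) (h1 : x < 1) :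
    Irrational (Int.fract (1 / x)) ∧ 0 < Int.fract (1 / x) ∧ Int.fract (1 / x) < 1 ∧
      x * (1 + Int.fract (1 / x)) ≤ 1 ∧ x * Int.fract (1 / x) ≤ 1 / 2 := by
  have hirr : Irrational (Int.fract (1 / x)) := by
    rw [Int.fract, one_div]
    exact hx.inv.sub_intCast _
  have hn : (1 : ℝ) ≤ (⌊1 / x⌋ : ℝ) := by
    have : (1 : ℤ) ≤ ⌊1 / x⌋ := by
      rw [Int.le_floor, Int.cast_one, le_div_iff₀ h0]; linarith
    exact_mod_cast this
  have h2 := Int.fract_nonneg (1 / x)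
  have h3 := Int.fract_lt_one (1 / x)
  have e : x * ((⌊1 / x⌋ : ℝ) + Int.fract (1 / x)) = 1 := by
    rw [Int.floor_add_fract]; field_simp
  refine ⟨hirr, lt_of_le_of_ne h2 (Ne.symm hirr.ne_zero), h3, ?_, ?_⟩
  · nlinarith
  · nlinarith [mul_le_mul_of_nonneg_left (h3.le.trans hn) h0.le]

lemma deviation_eq_zero (h : IsSquareData D k κ) {x : ℝ} (hx : Irrational x) (h0 : 0 < x)
    (h1 : x < 1) : deviation D k κ x = 0 := by
  obtain ⟨B, hB, hb⟩ := exists_abs_deviation_le h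
  have step : ∀ c, 0 ≤ c → (∀ x, Irrational x → 0 < x → x < 1 → |deviation D k κ x| ≤ c * x) →
      ∀ x, Irrational x → 0 < x → x < 1 → |deviation D k κ x| ≤ c / 2 * x := by
    intro c hc hyp x hx h0 h1
    obtain ⟨p1, p2, p3, -, p5⟩ := gauss_map_props hx h0 h1
    rw [deviation_eq_fract h h0, abs_mul, abs_of_nonneg (sq_nonneg x)]
    calc _ ≤ x ^ 2 * (c * Int.fract (1 / x)) :=
          mul_le_mul_of_nonneg_left (hyp _ p1 p2 p3) (sq_nonneg x)
      _ = c * x * (x * Int.fract (1 / x)) := by ring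
      _ ≤ c * x * (1 / 2) := mul_le_mul_of_nonneg_left p5 (by positivity)
      _ = _ := by ring
  have hall : ∀ n : ℕ, ∀ x, Irrational x → 0 < x → x < 1 →
      |deviation D k κ x| ≤ B * (1 / 2) ^ n * x := by
    intro n
    induction n with
    | zero =>
      intro x hx h0 h1
      obtain ⟨p1, p2, p3, p4, -⟩ := gauss_map_props hx h0 h1
      rw [deviation_eq_fract h h0, abs_mul, abs_of_nonneg (sq_nonneg x)]
      calc _ ≤ x ^ 2 * B := mul_le_mul_of_nonneg_left (hb _) (sq_nonneg x)
        _ ≤ _ := by nlinarith [mul_nonneg hB h0.le]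
    | succ n ih =>
      intro x hx h0 h1
      have := step _ (by positivity) ih x hx h0 h1
      rw [pow_succ]
      linarith
  have hlim : Filter.Tendsto (fun n : ℕ => B * (1 / 2 : ℝ) ^ n * x) Filter.atTop (nhds 0) := by
    have := ((tendsto_pow_atTop_nhds_zero_of_lt_one (r := (1 / 2 : ℝ)) (by norm_num)
      (by norm_num)).const_mul B).mul_const x
    simpa using this
  have := ge_of_tendsto' hlim (fun n => hall n x hx h0 h1)
  exact abs_nonpos_iff.1 this

lemma integral_halfBernoulli (hk : 0 < k) : ∫ x in (0 : ℝ)..1, halfBernoulli (k * x) = 0 := by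
  have hkR : (k : ℝ) ≠ 0 := by exact_mod_cast hk.ne'
  have hm : Measurable halfBernoulli := by
    unfold halfBernoulli
    fun_prop
  have hloc : ∀ a b, IntervalIntegrable halfBernoulli volume a b := fun a b =>
    IntervalIntegrable.mono_fun (f := fun _ => (1 : ℝ)) (by simp) hm.aestronglyMeasurable
      (Filter.Eventually.of_forall fun x => by simpa using abs_halfBernoulli_le x)
  rw [intervalIntegral.integral_comp_mul_left (fun x => halfBernoulli x) hkR]
  have h1 := halfBernoulli_periodic.intervalIntegral_add_zsmul_eq k 0 hloc
  simp only [zero_add, zsmul_eq_mul, mul_one, Int.cast_natCast] at h1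
  rw [mul_zero, mul_one, h1]
  have h2 : ∫ x in (0 : ℝ)..1, halfBernoulli x = ∫ x in (0 : ℝ)..1, ((x ^ 2 - x) / 2 + 1 / 12) := by
    apply intervalIntegral.integral_congr_ae
    have : ∀ᵐ x : ℝ, x ≠ 1 := by simp [ae_iff]
    filter_upwards [this] with x hx hx'
    rw [Set.uIoc_of_le zero_le_one] at hx'
    rw [halfBernoulli, Int.fract_eq_self.2 ⟨hx'.1.le, lt_of_le_of_ne hx'.2 hx⟩]
  rw [h2]
  have hc : ∀ g : ℝ → ℝ, Continuous g → IntervalIntegrable g volume 0 1 :=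
    fun g hg => hg.intervalIntegrable 0 1
  have h3 : ∫ x in (0 : ℝ)..1, ((x ^ 2 - x) / 2 + 1 / 12) = 0 := by
    rw [intervalIntegral.integral_add (hc _ (by fun_prop)) (hc _ (by fun_prop)), intervalIntegral.integral_div,
      intervalIntegral.integral_sub (hc _ (by fun_prop)) (hc _ (by fun_prop))]
    simp
    norm_num
  rw [h3]; simp

/-- The integral over a period of the sum over forms with `a < 0`. -/
theorem lintegral_posSum (h : IsSquareData D k κ) :
    ∫⁻ x in Set.Ioc (0 : ℝ) 1, posSum D (fun a _ => a < 0) x =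
      ENNReal.ofReal (meanValue D k κ) := by
  have hae : ∀ᵐ x ∂(volume.restrict (Set.Ioc (0 : ℝ) 1)),
      posSum D (fun a _ => a < 0) x =
        ENNReal.ofReal (κ * halfBernoulli (k * x) + meanValue D k κ) ∧
      0 ≤ κ * halfBernoulli (k * x) + meanValue D k κ := by
    have hirr : ∀ᵐ x : ℝ, Irrational x := by
      have := (Set.countable_range ((↑) : ℚ → ℝ)).ae_notMem volume
      exact this
    have h1 : ∀ᵐ x : ℝ, x ≠ 1 := by simp [ae_iff]
    refine (ae_restrict_iff' measurableSet_Ioc).2 ?_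
    filter_upwards [hirr, h1] with x hx hx1 hx'
    have hz := deviation_eq_zero h hx hx'.1 (lt_of_le_of_ne hx'.2 hx1)
    have e : (posSum D (fun a _ => a < 0) x).toReal =
        κ * halfBernoulli (k * x) + meanValue D k κ := by
      unfold deviation at hz; linarith
    exact ⟨by rw [← e, ENNReal.ofReal_toReal (posSum_ne_top h x)],
      by rw [← e]; exact ENNReal.toReal_nonneg⟩
  have hm : Measurable halfBernoulli := by
    unfold halfBernoulli
    fun_prop
  have hi : IntervalIntegrable (fun x : ℝ => κ * halfBernoulli (k * x)) volume 0 1 := by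
    refine IntervalIntegrable.mono_fun (f := fun _ => (κ : ℝ)) (by simp)
      (Measurable.aestronglyMeasurable (by fun_prop))
      (Filter.Eventually.of_forall fun x => ?_)
    simp only [Real.norm_eq_abs, abs_mul]
    exact mul_le_of_le_one_right (abs_nonneg _) (abs_halfBernoulli_le _)
  have hi2 : IntervalIntegrable (fun _ : ℝ => meanValue D k κ) volume 0 1 := by simp
  rw [lintegral_congr_ae (hae.mono fun x hx => hx.1), ← ofReal_integral_eq_lintegral_ofReal]
  · rw [← intervalIntegral.integral_of_le zero_le_one, intervalIntegral.integral_add hi hi2,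
      intervalIntegral.integral_const_mul, integral_halfBernoulli h.1]
    simp
  · exact ((hi.add hi2).1)
  · exact hae.mono fun x hx => hx.2

end ZagierSum

/-- The number of roots of `X² + βX + γ` modulo `M`. -/
noncomputable def quadRootCount (β γ : ℤ) (M : ℕ) : ℕ :=
  Nat.card {x : ZMod M // x ^ 2 + β * x + γ = 0}

namespace ZagierSum

open scoped ENNReal
open MeasureTheory

lemma tsum_lintegral_translates {f : ℝ → ℝ≥0∞} (hf : Measurable f) (c : ℝ) :
    ∑' j : ℤ, ∫⁻ x in Set.Ioc (0 : ℝ) 1, f (x - (j + c)) = ∫⁻ x, f x := by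
  rw [← lintegral_sub_right_eq_self f c, ← setLIntegral_univ, ← iUnion_Ioc_intCast ℝ,
    lintegral_iUnion (fun _ => measurableSet_Ioc) (Set.pairwise_disjoint_Ioc_intCast ℝ),
    ← (Equiv.neg ℤ).tsum_eq]
  refine tsum_congr fun j => ?_
  have h := (measurePreserving_add_right volume (j : ℝ)).setLIntegral_comp_preimage
    (s := Set.Ioc (j : ℝ) (j + 1)) measurableSet_Ioc (f := fun x => f (x - c)) (by fun_prop)
  rw [← h]
  have : (fun x : ℝ => x + j) ⁻¹' Set.Ioc (j : ℝ) (j + 1) = Set.Ioc 0 1 := by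
    ext x; simp
  rw [this]
  refine lintegral_congr fun x => ?_
  congr 1
  simp only [Equiv.neg_apply, Int.cast_neg]
  ring

lemma lintegral_parabola {d M : ℝ} (hd : 0 < d) (hM : 0 < M) :
    ∫⁻ u, ENNReal.ofReal (d / (4 * M) - M * u ^ 2) = ENNReal.ofReal (d * √d / (6 * M ^ 2)) := by
  set s := √d / (2 * M) with hs
  have hs0 : 0 < s := by positivity
  have hss : M * s ^ 2 = d / (4 * M) := by
    rw [hs, div_pow, Real.sq_sqrt hd.le]; field_simp; ring
  have hcont : Continuous fun u : ℝ => d / (4 * M) - M * u ^ 2 := by fun_prop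
  have h1 : ∫⁻ u, ENNReal.ofReal (d / (4 * M) - M * u ^ 2) =
      ∫⁻ u in Set.Ioc (-s) s, ENNReal.ofReal (d / (4 * M) - M * u ^ 2) := by
    refine (setLIntegral_eq_of_support_subset ?_).symm
    intro u hu
    by_contra hu'
    apply hu
    apply ENNReal.ofReal_of_nonpos
    have : s ^ 2 ≤ u ^ 2 := by
      rw [sq_le_sq, abs_of_pos hs0, le_abs]
      simp only [Set.mem_Ioc, not_and_or, not_lt, not_le] at hu'
      rcases hu' with h | h
      · right; linarith
      · left; exact h.le
    nlinarith
  rw [h1, ← ofReal_integral_eq_lintegral_ofReal]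
  · rw [← intervalIntegral.integral_of_le (by linarith), intervalIntegral.integral_sub
      (by simp) ((by fun_prop : Continuous fun u : ℝ => M * u ^ 2).intervalIntegrable _ _),
      intervalIntegral.integral_const, intervalIntegral.integral_const_mul, integral_pow]
    congr 1
    rw [← hss]
    have e : d * √d = 8 * M ^ 3 * s ^ 3 := by
      have : √d = 2 * M * s := by rw [hs]; field_simp
      calc d * √d = (√d) ^ 2 * √d := by rw [Real.sq_sqrt hd.le]
        _ = _ := by rw [this]; ring
    rw [e, smul_eq_mul]
    field_simp
    norm_num
    ring
  · exact (hcont.intervalIntegrable (-s) s).1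
  · refine (ae_restrict_iff' measurableSet_Ioc).2 (Filter.Eventually.of_forall fun u hu => ?_)
    have : u ^ 2 ≤ s ^ 2 := by
      rw [sq_le_sq, abs_of_pos hs0, abs_le]
      exact ⟨hu.1.le, hu.2⟩
    simp only [Pi.zero_apply]
    nlinarith

variable {D β γ : ℤ}

lemma posSum_eq_tsum (hD : β ^ 2 - 4 * γ = D) (x : ℝ) :
    posSum D (fun a _ => a < 0) x = ∑' p : ℕ × ℤ,
      if ((p.1 + 1 : ℕ) : ℤ) ∣ p.2 ^ 2 + β * p.2 + γ then
        ENNReal.ofReal (D / (4 * ((p.1 + 1 : ℕ) : ℝ)) - ((p.1 + 1 : ℕ) : ℝ) *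
          (x - (2 * p.2 + β) / (2 * ((p.1 + 1 : ℕ) : ℝ))) ^ 2)
      else 0 := by
  let i : ℕ × ℤ → ℤ × ℤ × ℤ := fun p =>
    (-((p.1 + 1 : ℕ) : ℤ), 2 * p.2 + β, -((p.2 ^ 2 + β * p.2 + γ) / ((p.1 + 1 : ℕ) : ℤ)))
  have hi : Function.Injective i := fun p q h => by
    simp only [i, Prod.mk.injEq] at h
    ext <;> omega
  unfold posSum
  have hkey : ∀ (m : ℕ) (t c : ℤ), (2 * t + β) ^ 2 - 4 * -((m + 1 : ℕ) : ℤ) * c = D ↔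
      t ^ 2 + β * t + γ = ((m + 1 : ℕ) : ℤ) * (-c) := by
    intro m t c
    rw [← hD]
    constructor <;> intro h <;> linarith
  rw [← hi.tsum_eq]
  · refine tsum_congr fun p => ?_
    have hm0 : (((p.1 + 1 : ℕ) : ℤ)) ≠ 0 := by positivity
    have hmR : (((p.1 + 1 : ℕ) : ℝ)) ≠ 0 := by positivity
    split_ifs with hdvd
    · obtain ⟨c, hc⟩ := hdvd
      have hc' : (p.2 ^ 2 + β * p.2 + γ) / ((p.1 + 1 : ℕ) : ℤ) = c := by
        rw [hc, Int.mul_ediv_cancel_left _ hm0]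
      rw [Set.indicator_of_mem]
      · congr 1
        simp only [evalForm, i, hc']
        have h1 : ((p.2 : ℝ) ^ 2 + β * p.2 + γ) = ((p.1 + 1 : ℕ) : ℝ) * c := by exact_mod_cast hc
        have h2 : (β : ℝ) ^ 2 - 4 * γ = D := by exact_mod_cast hD
        rw [← h2]
        have h3 : (c : ℝ) = ((p.2 : ℝ) ^ 2 + β * p.2 + γ) / ((p.1 + 1 : ℕ) : ℝ) := by
          rw [h1]; field_simp
        push_cast at h3 hmR ⊢
        rw [h3]
        field_simp
        ring
      · refine ⟨?_, ?_⟩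
        · simp only [i, hc']
          rw [hkey, hc]; ring
        · simp only [i]; omega
    · refine Set.indicator_of_notMem ?_ _
      rintro ⟨h1, -⟩
      simp only [i] at h1
      rw [hkey] at h1
      exact hdvd ⟨_, h1⟩
  · rintro ⟨a, b, c⟩ hQ
    obtain ⟨h1, h2⟩ := Set.mem_of_indicator_ne_zero hQ
    simp only at h1 h2
    have hpar : Even (b - β) := by
      have : Even (b ^ 2 - β ^ 2) := ⟨2 * (a * c - γ), by linarith⟩
      rw [Int.even_sub, Int.even_pow' two_ne_zero, Int.even_pow' two_ne_zero] at this
      rwa [Int.even_sub]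
    obtain ⟨t, ht⟩ := hpar
    obtain ⟨m, hm⟩ : ∃ m : ℕ, a = -((m + 1 : ℕ) : ℤ) := ⟨(-a - 1).toNat, by omega⟩
    have hb : b = 2 * t + β := by omega
    subst hb hm
    rw [hkey] at h1
    refine ⟨(m, t), ?_⟩
    simp only [i, h1]
    rw [Int.mul_ediv_cancel_left _ (by positivity), neg_neg]

lemma quadRootCount_eq_card (M : ℕ) [NeZero M] :
    quadRootCount β γ M =
      (Finset.univ.filter fun r : Fin M => (M : ℤ) ∣ (r : ℤ) ^ 2 + β * r + γ).card := by
  rw [quadRootCount, Nat.card_eq_fintype_card, Fintype.card_subtype]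
  refine Finset.card_equiv (ZMod.finEquiv M).symm.toEquiv fun x => ?_
  simp only [Finset.mem_filter, Finset.mem_univ, true_and, ← ZMod.intCast_zmod_eq_zero_iff_dvd]
  obtain ⟨n, rfl⟩ : ∃ n, M = n + 1 := ⟨M - 1, (Nat.succ_pred (NeZero.ne M)).symm⟩
  have : ((((ZMod.finEquiv (n + 1)).symm.toEquiv x : Fin (n + 1)) : ℕ) : ZMod (n + 1)) = x :=
    ZMod.natCast_zmod_val x
  push_cast
  rw [this]

/-- Unfolding the integral of the sum over forms with `a < 0`. -/
theorem lintegral_posSum_unfold (h0 : 0 < D) (hD : β ^ 2 - 4 * γ = D) :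
    ∫⁻ x in Set.Ioc (0 : ℝ) 1, posSum D (fun a _ => a < 0) x =
      ∑' m : ℕ, quadRootCount β γ (m + 1) *
        ENNReal.ofReal (D * √D / (6 * ((m + 1 : ℕ) : ℝ) ^ 2)) := by
  have hDR : (0 : ℝ) < D := by exact_mod_cast h0
  simp only [posSum_eq_tsum hD]
  rw [lintegral_tsum]
  swap
  · intro p
    split_ifs
    · fun_prop
    · fun_prop
  rw [ENNReal.tsum_prod (f := fun m t => ∫⁻ x in Set.Ioc (0 : ℝ) 1,
    if ((m + 1 : ℕ) : ℤ) ∣ t ^ 2 + β * t + γ then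
        ENNReal.ofReal (D / (4 * ((m + 1 : ℕ) : ℝ)) - ((m + 1 : ℕ) : ℝ) *
          (x - (2 * t + β) / (2 * ((m + 1 : ℕ) : ℝ))) ^ 2)
      else 0)]
  refine tsum_congr fun m => ?_
  set M := m + 1 with hM
  have hMR : (0 : ℝ) < M := by rw [hM]; positivity
  rw [← (Int.divModEquiv M).symm.tsum_eq, ENNReal.tsum_prod', ENNReal.tsum_comm, tsum_fintype,
    quadRootCount_eq_card, Finset.card_filter, Nat.cast_sum, Finset.sum_mul]
  refine Finset.sum_congr rfl fun r _ => ?_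
  have hdvd : ∀ j : ℤ, ((M : ℤ) ∣ ((Int.divModEquiv M).symm (j, r)) ^ 2 +
      β * ((Int.divModEquiv M).symm (j, r)) + γ) ↔ (M : ℤ) ∣ (r : ℤ) ^ 2 + β * r + γ := by
    intro j
    have : ((Int.divModEquiv M).symm (j, r)) ^ 2 + β * ((Int.divModEquiv M).symm (j, r)) + γ =
        (r : ℤ) ^ 2 + β * r + γ + M * (j * (j * M + 2 * r + β)) := by
      simp only [Int.divModEquiv, Equiv.coe_fn_symm_mk]; ring
    rw [this, Int.dvd_add_left ⟨_, rfl⟩]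
  simp only [hdvd]
  split_ifs with h
  · rw [Nat.cast_one, one_mul, ← lintegral_parabola hDR hMR,
      ← tsum_lintegral_translates (by fun_prop) ((2 * r + β) / (2 * M))]
    refine tsum_congr fun j => lintegral_congr fun x => ?_
    congr 3
    simp only [Int.divModEquiv, Equiv.coe_fn_symm_mk]
    push_cast
    field_simp
    ring
  · simp

variable {k : ℕ} {κ : ℝ}

lemma coeffSum_nonneg : 0 ≤ coeffSum D :=
  Finset.sum_nonneg fun _ hQ => (mem_indefForms.1 hQ).2.2.le

lemma meanValue_nonneg (h : IsSquareData D k κ) : 0 ≤ meanValue D k κ := by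
  have h1 : (0 : ℝ) ≤ coeffSum D := by exact_mod_cast coeffSum_nonneg
  have h2 : (1 : ℝ) ≤ k := by exact_mod_cast h.1
  have := h.nonneg
  unfold meanValue
  have h3 : (0 : ℝ) ≤ (k : ℝ) ^ 2 / 2 - 1 / 12 := by nlinarith
  positivity

theorem hasSum_quadRootCount (h0 : 0 < D) (hD : β ^ 2 - 4 * γ = D) (h : IsSquareData D k κ) :
    HasSum (fun m : ℕ => (quadRootCount β γ (m + 1) : ℝ) *
      (D * √D / (6 * ((m + 1 : ℕ) : ℝ) ^ 2))) (meanValue D k κ) := by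
  have h1 := (lintegral_posSum_unfold h0 hD).symm.trans (lintegral_posSum h)
  have hDR : (0 : ℝ) < D := by exact_mod_cast h0
  have h2 : ∀ m : ℕ, 0 ≤ (quadRootCount β γ (m + 1) : ℝ) *
      (D * √D / (6 * ((m + 1 : ℕ) : ℝ) ^ 2)) := fun m => by positivity
  have h3 : ∑' m : ℕ, ENNReal.ofReal ((quadRootCount β γ (m + 1) : ℝ) *
      (D * √D / (6 * ((m + 1 : ℕ) : ℝ) ^ 2))) = ENNReal.ofReal (meanValue D k κ) := by
    rw [← h1]
    refine tsum_congr fun m => ?_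
    rw [ENNReal.ofReal_mul (by positivity), ENNReal.ofReal_natCast]
  have h4 := ENNReal.hasSum_toReal (f := fun m => ENNReal.ofReal (_ : ℝ)) (h3.trans_ne ENNReal.ofReal_ne_top)
  rw [← ENNReal.tsum_toReal_eq (fun _ => ENNReal.ofReal_ne_top), h3,
    ENNReal.toReal_ofReal (meanValue_nonneg h)] at h4
  simpa only [ENNReal.toReal_ofReal (h2 _)] using h4

end ZagierSum

namespace RootCount

variable {β γ : ℤ}

lemma eq_count {M : ℕ} (hM : M ≠ 0) : quadRootCount β γ M =
    Nat.count (fun r : ℕ => (M : ℤ) ∣ (r : ℤ) ^ 2 + β * r + γ) M := by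
  have : NeZero M := ⟨hM⟩
  rw [ZagierSum.quadRootCount_eq_card, Nat.count_eq_card_filter_range]
  refine Finset.card_bij (fun r _ => r) ?_ (fun _ _ _ _ h => Fin.ext h) ?_
  · intro r hr
    simpa using hr
  · intro r hr
    rw [Finset.mem_filter, Finset.mem_range] at hr
    exact ⟨⟨r, hr.1⟩, by simpa using hr.2, rfl⟩

lemma count_mul_of_periodic {P : ℕ → Prop} [DecidablePred P] {a : ℕ} (h : Function.Periodic P a)
    (n : ℕ) : Nat.count P (n * a) = n * Nat.count P a := by
  induction n with
  | zero => simp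
  | succ n ih =>
    rw [Nat.succ_mul, Nat.succ_mul, Nat.count_add, ih]
    congr 1
    have h' : (fun k => P (n * a + k)) = P := by
      funext k
      have := (h.nat_mul n) k
      rw [← this, add_comm]; rfl
    simp only [h']

lemma quadRootCount_shift (s : ℤ) (M : ℕ) :
    quadRootCount (β + 2 * s) (γ + β * s + s ^ 2) M = quadRootCount β γ M := by
  refine Nat.card_congr ((Equiv.addRight (s : ZMod M)).subtypeEquiv fun x => ?_)
  have : (x + s) ^ 2 + β * (x + s) + γ = x ^ 2 + ((β + 2 * s : ℤ) : ZMod M) * x +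
      ((γ + β * s + s ^ 2 : ℤ) : ZMod M) := by push_cast; ring
  rw [← this]; rfl

lemma quadRootCount_mul {m n : ℕ} (h : m.Coprime n) :
    quadRootCount β γ (m * n) = quadRootCount β γ m * quadRootCount β γ n := by
  unfold quadRootCount
  rw [← Nat.card_prod]
  let e := ZMod.chineseRemainder h
  refine Nat.card_congr ((e.toEquiv.subtypeEquiv (q := fun y =>
    (y.1 ^ 2 + (β : ZMod m) * y.1 + γ = 0) ∧ (y.2 ^ 2 + (β : ZMod n) * y.2 + γ = 0)) fun x => ?_).trans (Equiv.subtypeProdEquivProd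
    (p := fun a : ZMod m => a ^ 2 + (β : ZMod m) * a + γ = 0)
    (q := fun a : ZMod n => a ^ 2 + (β : ZMod n) * a + γ = 0)))
  rw [← e.map_eq_zero_iff, map_add, map_add, map_pow, map_mul, map_intCast, map_intCast,
    Prod.ext_iff]
  rfl

lemma quadRootCount_one : quadRootCount β γ 1 = 1 := by
  rw [eq_count one_ne_zero, Nat.count_eq_card_filter_range]; simp

variable {p : ℕ}

lemma prime_eq_one (hp : p.Prime) (hβ : (p : ℤ) ∣ β) (hγ : (p : ℤ) ∣ γ) :
    quadRootCount β γ p = 1 := by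
  have : Fact p.Prime := ⟨hp⟩
  rw [quadRootCount, Nat.card_eq_one_iff_unique]
  have h1 := (ZMod.intCast_zmod_eq_zero_iff_dvd β p).2 hβ
  have h2 := (ZMod.intCast_zmod_eq_zero_iff_dvd γ p).2 hγ
  have h3 : ∀ x : ZMod p, x ^ 2 + β * x + γ = 0 ↔ x = 0 := fun x => by simp [h1, h2]
  exact ⟨⟨fun x y => Subtype.ext (((h3 _).1 x.2).trans ((h3 _).1 y.2).symm)⟩, ⟨⟨0, (h3 0).2 rfl⟩⟩⟩

lemma dvd_of_pow_dvd (hp : p.Prime) (hβ : (p : ℤ) ∣ β) (hγ : (p : ℤ) ∣ γ) {k : ℕ} {t : ℤ}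
    (h : ((p ^ (k + 2) : ℕ) : ℤ) ∣ t ^ 2 + β * t + γ) : (p : ℤ) ∣ t := by
  have hp' : Prime (p : ℤ) := Nat.prime_iff_prime_int.1 hp
  refine hp'.dvd_of_dvd_pow (n := 2) ?_
  have h1 : (p : ℤ) ∣ t ^ 2 + β * t + γ := by
    refine dvd_trans ?_ h
    push_cast
    exact dvd_pow_self _ (by omega)
  have : t ^ 2 = (t ^ 2 + β * t + γ) - (β * t + γ) := by ring
  rw [this]
  exact dvd_sub h1 (dvd_add (hβ.mul_right _) hγ)

lemma prime_pow_eq_zero (hp : p.Prime) (hβ : (p : ℤ) ∣ β) (hγ : (p : ℤ) ∣ γ)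
    (hγ2 : ¬ (p : ℤ) ^ 2 ∣ γ) (k : ℕ) : quadRootCount β γ (p ^ (k + 2)) = 0 := by
  rw [eq_count (pow_ne_zero _ hp.ne_zero), Nat.count_eq_card_filter_range, Finset.card_eq_zero,
    Finset.filter_eq_empty_iff]
  intro t _ h
  obtain ⟨s, hs⟩ := dvd_of_pow_dvd hp hβ hγ h
  obtain ⟨b, rfl⟩ := hβ
  apply hγ2
  have h1 : (p : ℤ) ^ 2 ∣ (t : ℤ) ^ 2 + p * b * t + γ := by
    refine dvd_trans ?_ h
    push_cast
    exact pow_dvd_pow _ (by omega)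
  have : γ = ((t : ℤ) ^ 2 + p * b * t + γ) - (p : ℤ) ^ 2 * (s ^ 2 + b * s) := by rw [hs]; ring
  rw [this]
  exact dvd_sub h1 (dvd_mul_right _ _)

lemma prime_pow_add_two (hp : p.Prime) (b c : ℤ) (k : ℕ) :
    quadRootCount (p * b) (p ^ 2 * c) (p ^ (k + 2)) = p * quadRootCount b c (p ^ k) := by
  have hpk : p ^ k ≠ 0 := pow_ne_zero _ hp.ne_zero
  have hp0 : (p : ℤ) ^ 2 ≠ 0 := by exact_mod_cast pow_ne_zero 2 hp.ne_zero
  rw [eq_count (pow_ne_zero _ hp.ne_zero), eq_count hpk, ← count_mul_of_periodic,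
    Nat.count_eq_card_filter_range, Nat.count_eq_card_filter_range]
  · have hkey : ∀ s : ℤ, ((p ^ (k + 2) : ℕ) : ℤ) ∣ (p * s) ^ 2 + p * b * (p * s) + p ^ 2 * c ↔
        ((p ^ k : ℕ) : ℤ) ∣ s ^ 2 + b * s + c := by
      intro s
      have e1 : ((p ^ (k + 2) : ℕ) : ℤ) = p ^ 2 * ((p ^ k : ℕ) : ℤ) := by push_cast; ring
      have e2 : ((p : ℤ) * s) ^ 2 + p * b * (p * s) + p ^ 2 * c = p ^ 2 * (s ^ 2 + b * s + c) := by
        ring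
      rw [e1, e2, mul_dvd_mul_iff_left hp0]
    refine (Finset.card_bij (fun s _ => p * s) ?_ ?_ ?_).symm
    · intro s hs
      simp only [Finset.mem_filter, Finset.mem_range] at hs ⊢
      refine ⟨?_, ?_⟩
      · have := Nat.mul_lt_mul_of_pos_left hs.1 hp.pos
        convert this using 1
        ring
      · push_cast
        have := (hkey s).2 hs.2
        push_cast at this
        exact this
    · intro s _ s' _ h
      exact Nat.eq_of_mul_eq_mul_left hp.pos h
    · intro t ht
      simp only [Finset.mem_filter, Finset.mem_range] at ht
      obtain ⟨s, rfl⟩ : p ∣ t := by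
        have := dvd_of_pow_dvd hp (dvd_mul_right _ _)
          (dvd_mul_of_dvd_left (dvd_pow_self _ two_ne_zero) _) ht.2
        exact_mod_cast this
      refine ⟨s, ?_, rfl⟩
      simp only [Finset.mem_filter, Finset.mem_range]
      refine ⟨?_, ?_⟩
      · have h1 : p * s < p * (p * p ^ k) := by
          convert ht.1 using 1
          ring
        exact lt_of_mul_lt_mul_left h1 (Nat.zero_le _)
      · rw [← hkey]
        have := ht.2
        push_cast at this ⊢
        exact this
  · intro r
    simp only [eq_iff_iff]
    have : ((r + p ^ k : ℕ) : ℤ) ^ 2 + b * ((r + p ^ k : ℕ) : ℤ) + c =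
        (r : ℤ) ^ 2 + b * r + c + ((p ^ k : ℕ) : ℤ) * (2 * r + p ^ k + b) := by push_cast; ring
    rw [this, Int.dvd_add_left ⟨_, rfl⟩]

/-- Roots modulo `p` lift to roots modulo powers of `p` when `p` does not divide the
discriminant. -/
lemma exists_root_pow (hp : p.Prime) (hD : ¬ (p : ℤ) ∣ β ^ 2 - 4 * γ)
    (h : ∃ t : ℤ, (p : ℤ) ∣ t ^ 2 + β * t + γ) (k : ℕ) :
    ∃ t : ℤ, (p : ℤ) ^ (k + 1) ∣ t ^ 2 + β * t + γ := by
  have hp' : Prime (p : ℤ) := Nat.prime_iff_prime_int.1 hp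
  induction k with
  | zero => simpa using h
  | succ k ih =>
    obtain ⟨t, u, hu⟩ := ih
    have hcop : IsCoprime (2 * t + β) (p : ℤ) := by
      rw [isCoprime_comm, hp'.coprime_iff_not_dvd]
      intro hdvd
      apply hD
      have : β ^ 2 - 4 * γ = (2 * t + β) * (2 * t + β) - 4 * (t ^ 2 + β * t + γ) := by ring
      rw [this, hu]
      exact dvd_sub (hdvd.mul_right _) (Dvd.dvd.mul_left (Dvd.dvd.mul_right
        (dvd_pow_self _ (by omega)) _) _)
    obtain ⟨x, y, hxy⟩ := hcop
    refine ⟨t + p ^ (k + 1) * (-u * x), ?_⟩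
    have : (t + (p : ℤ) ^ (k + 1) * (-u * x)) ^ 2 + β * (t + (p : ℤ) ^ (k + 1) * (-u * x)) + γ =
        p ^ (k + 1 + 1) * (u * y + p ^ k * (u * x) ^ 2) := by
      calc _ = (t ^ 2 + β * t + γ) - p ^ (k + 1) * u * (x * (2 * t + β)) +
            (p ^ (k + 1)) ^ 2 * (u * x) ^ 2 := by ring
        _ = p ^ (k + 1) * u * 1 - p ^ (k + 1) * u * (x * (2 * t + β)) +
            (p ^ (k + 1)) ^ 2 * (u * x) ^ 2 := by rw [hu, mul_one]
        _ = _ := by rw [← hxy]; ring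
    rw [this]
    exact dvd_mul_right _ _

lemma prime_pow_of_exists (hp : p.Prime) (hD : ¬ (p : ℤ) ∣ β ^ 2 - 4 * γ)
    (h : ∃ t : ℤ, (p : ℤ) ∣ t ^ 2 + β * t + γ) (k : ℕ) :
    quadRootCount β γ (p ^ (k + 1)) = 2 := by
  have hp' : Prime (p : ℤ) := Nat.prime_iff_prime_int.1 hp
  obtain ⟨t, ht⟩ := exists_root_pow hp hD h k
  have hpd : (p : ℤ) ∣ (p : ℤ) ^ (k + 1) := dvd_pow_self _ (by omega)
  have hnd : ¬ (p : ℤ) ∣ 2 * t + β := by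
    intro hdvd
    apply hD
    have : β ^ 2 - 4 * γ = (2 * t + β) * (2 * t + β) - 4 * (t ^ 2 + β * t + γ) := by ring
    rw [this]
    exact dvd_sub (hdvd.mul_right _) ((hpd.trans ht).mul_left _)
  have hz : ∀ x : ℤ, ((x : ZMod (p ^ (k + 1))) = 0 ↔ (p : ℤ) ^ (k + 1) ∣ x) := fun x => by
    rw [ZMod.intCast_zmod_eq_zero_iff_dvd]; push_cast; rfl
  have hne : (t : ZMod (p ^ (k + 1))) ≠ ((-β - t : ℤ) : ZMod (p ^ (k + 1))) := by
    rw [Ne, ← sub_eq_zero, ← Int.cast_sub, hz]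
    intro h'
    apply hnd
    have := hpd.trans h'
    rwa [show t - (-β - t) = 2 * t + β by ring] at this
  rw [quadRootCount, ← Set.coe_ofPred, Nat.card_coe_set_eq, Set.ncard_eq_two]
  refine ⟨_, _, hne, ?_⟩
  ext x
  obtain ⟨x, rfl⟩ := ZMod.intCast_surjective x
  simp only [Set.mem_ofPred_eq, Set.mem_insert_iff, Set.mem_singleton_iff]
  have h1 : (x : ZMod (p ^ (k + 1))) ^ 2 + β * x + γ = ((x ^ 2 + β * x + γ : ℤ) : ZMod (p ^ (k + 1))) := by
    push_cast; rfl
  rw [h1, hz, ← sub_eq_zero, ← sub_eq_zero (b := ((-β - t : ℤ) : ZMod (p ^ (k + 1)))),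
    ← Int.cast_sub, ← Int.cast_sub, hz, hz]
  have h2 : x ^ 2 + β * x + γ = (x - t) * (x - (-β - t)) + (t ^ 2 + β * t + γ) := by ring
  rw [h2, dvd_add_left ht]
  constructor
  · intro hd
    by_cases hx : (p : ℤ) ∣ x - t
    · left
      have : ¬ (p : ℤ) ∣ x - (-β - t) := by
        intro hx'
        apply hnd
        have := dvd_sub hx' hx
        rwa [show x - (-β - t) - (x - t) = 2 * t + β by ring] at this
      exact IsCoprime.dvd_of_dvd_mul_right ((hp'.coprime_iff_not_dvd.2 this).pow_left) hd
    · right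
      exact IsCoprime.dvd_of_dvd_mul_left ((hp'.coprime_iff_not_dvd.2 hx).pow_left) hd
  · rintro (h | h)
    · exact h.mul_right _
    · exact h.mul_left _

lemma prime_pow_of_not_exists (hp : p.Prime)
    (h : ¬ ∃ t : ℤ, (p : ℤ) ∣ t ^ 2 + β * t + γ) (k : ℕ) :
    quadRootCount β γ (p ^ (k + 1)) = 0 := by
  rw [eq_count (pow_ne_zero _ hp.ne_zero), Nat.count_eq_card_filter_range, Finset.card_eq_zero,
    Finset.filter_eq_empty_iff]
  intro t _ h'
  refine h ⟨t, dvd_trans ?_ h'⟩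
  push_cast
  exact dvd_pow_self _ (by omega)

end RootCount

namespace RootCount

variable {β γ D₀ : ℤ} {p : ℕ}

lemma kroneckerSym_two (a : ℤ) :
    kroneckerSym a 2 = if a % 2 = 0 then 0 else if a % 8 = 1 ∨ a % 8 = 7 then 1 else -1 := by
  have : Nat.factorization 2 2 = 1 := Nat.prime_two.factorization_self
  simp only [kroneckerSym, this]
  norm_num

lemma kroneckerSym_odd_prime (hp : p.Prime) (hp2 : p ≠ 2) (a : ℤ) :
    kroneckerSym a p = jacobiSym a p := by
  have : p.factorization 2 = 0 :=
    Nat.factorization_eq_zero_of_not_dvd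
      (fun h => hp2 ((Nat.prime_dvd_prime_iff_eq Nat.prime_two hp).1 h).symm)
  simp [kroneckerSym, this, hp.ne_zero]

lemma kroneckerSym_trichotomy (hp : p.Prime) (a : ℤ) :
    kroneckerSym a p = 0 ∨ kroneckerSym a p = 1 ∨ kroneckerSym a p = -1 := by
  by_cases hp2 : p = 2
  · subst hp2
    rw [kroneckerSym_two]
    split_ifs <;> simp
  · rw [kroneckerSym_odd_prime hp hp2]
    exact jacobiSym.trichotomy a p

lemma kroneckerSym_eq_zero (hp : p.Prime) (h : (p : ℤ) ∣ D₀) : kroneckerSym D₀ p = 0 := by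
  have : Fact p.Prime := ⟨hp⟩
  by_cases hp2 : p = 2
  · subst hp2
    rw [kroneckerSym_two, if_pos (by omega)]
  · rw [kroneckerSym_odd_prime hp hp2, ← jacobiSym.legendreSym.to_jacobiSym, legendreSym.eq_zero_iff,
      ZMod.intCast_zmod_eq_zero_iff_dvd]
    exact h

lemma _root_.IsFundamentalDiscriminant.mod_four (h : IsFundamentalDiscriminant D₀) :
    D₀ % 4 = 0 ∨ D₀ % 4 = 1 := by
  rcases h with h | h
  · exact Or.inr h.1
  · exact Or.inl h.1

lemma mul_sq_mod_four (h : D₀ % 4 = 0 ∨ D₀ % 4 = 1) (g : ℤ) :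
    (D₀ * g ^ 2) % 4 = 0 ∨ (D₀ * g ^ 2) % 4 = 1 := by
  rw [Int.mul_emod]
  have : g ^ 2 % 4 = 0 ∨ g ^ 2 % 4 = 1 := by
    rcases Int.even_or_odd' g with ⟨t, rfl | rfl⟩
    · left; ring_nf; omega
    · right; ring_nf; omega
  rcases h with h | h <;> rcases this with h' | h' <;> rw [h, h'] <;> simp

/-- Away from the discriminant, the Kronecker symbol detects roots modulo `p`. -/
lemma kroneckerSym_cases (hp : p.Prime) (h4 : D₀ % 4 = 0 ∨ D₀ % 4 = 1) (hD₀ : ¬ (p : ℤ) ∣ D₀)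
    {g : ℤ} (hg : ¬ (p : ℤ) ∣ g) (hD : β ^ 2 - 4 * γ = D₀ * g ^ 2) :
    (kroneckerSym D₀ p = 1 ∧ ∃ t : ℤ, (p : ℤ) ∣ t ^ 2 + β * t + γ) ∨
      (kroneckerSym D₀ p = -1 ∧ ¬ ∃ t : ℤ, (p : ℤ) ∣ t ^ 2 + β * t + γ) := by
  have : Fact p.Prime := ⟨hp⟩
  by_cases hp2 : p = 2
  · subst hp2
    rw [kroneckerSym_two, if_neg (by omega)]
    obtain ⟨u, hu⟩ : ∃ u, g = 2 * u + 1 := ⟨g / 2, by omega⟩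
    have hβ : β % 2 = 1 := by
      by_contra hβ
      obtain ⟨b, rfl⟩ : ∃ b, β = 2 * b := ⟨β / 2, by omega⟩
      obtain ⟨d, rfl⟩ : ∃ d, D₀ = 2 * d + 1 := ⟨D₀ / 2, by omega⟩
      subst hu
      ring_nf at hD
      omega
    obtain ⟨b, rfl⟩ : ∃ b, β = 2 * b + 1 := ⟨β / 2, by omega⟩
    obtain ⟨d, rfl⟩ : ∃ d, D₀ = 4 * d + 1 := ⟨D₀ / 4, by omega⟩
    have hbe : ∃ c, b * (b + 1) = 2 * c := by
      obtain ⟨c, hc⟩ := Int.even_mul_succ_self b; exact ⟨c, by omega⟩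
    have hue : ∃ c, u * (u + 1) = 2 * c := by
      obtain ⟨c, hc⟩ := Int.even_mul_succ_self u; exact ⟨c, by omega⟩
    obtain ⟨c, hc⟩ := hbe
    obtain ⟨e, he⟩ := hue
    have hmain : d = 2 * c - γ - 2 * (4 * d + 1) * e := by
      have h1 : 4 * (b * (b + 1)) + 1 - 4 * γ = (4 * d + 1) * (4 * (u * (u + 1)) + 1) := by
        rw [hu] at hD; linear_combination hD
      rw [hc, he] at h1
      linarith
    have hmain2 : ∃ w, d = -γ + 2 * w := ⟨c - (4 * d + 1) * e, by linarith⟩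
    obtain ⟨w, hw⟩ := hmain2
    by_cases hγ : γ % 2 = 0
    · left
      exact ⟨by rw [if_pos (by omega)], 0, by push_cast; omega⟩
    · right
      refine ⟨by rw [if_neg (by omega)], ?_⟩
      rintro ⟨t, ht⟩
      obtain ⟨c', hc'⟩ := Int.even_mul_succ_self t
      have : t ^ 2 + (2 * b + 1) * t + γ = (c' + c') + 2 * (b * t) + γ := by rw [← hc']; ring
      rw [this] at ht
      push_cast at ht
      omega
  · rw [kroneckerSym_odd_prime hp hp2, ← jacobiSym.legendreSym.to_jacobiSym]
    have hz : ((D₀ : ℤ) : ZMod p) ≠ 0 := by rwa [Ne, ZMod.intCast_zmod_eq_zero_iff_dvd]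
    have hgz : ((g : ℤ) : ZMod p) ≠ 0 := by rwa [Ne, ZMod.intCast_zmod_eq_zero_iff_dvd]
    have h2 : (2 : ZMod p) ≠ 0 := by
      intro h
      have : ((2 : ℕ) : ZMod p) = 0 := by exact_mod_cast h
      rw [ZMod.natCast_eq_zero_iff] at this
      exact hp2 ((Nat.prime_dvd_prime_iff_eq hp Nat.prime_two).1 this)
    have hDz : (β : ZMod p) ^ 2 - 4 * γ = D₀ * (g : ZMod p) ^ 2 := by exact_mod_cast congrArg (Int.cast (R := ZMod p)) hD
    have hiff : IsSquare (D₀ : ZMod p) ↔ ∃ t : ℤ, (p : ℤ) ∣ t ^ 2 + β * t + γ := by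
      constructor
      · rintro ⟨y, hy⟩
        obtain ⟨t, ht⟩ := ZMod.intCast_surjective ((y * g - β) / 2 : ZMod p)
        refine ⟨t, ?_⟩
        rw [← ZMod.intCast_zmod_eq_zero_iff_dvd]
        push_cast
        rw [ht]
        have h4 : (4 : ZMod p) ≠ 0 := by
          rw [show (4 : ZMod p) = 2 * 2 by norm_num]; exact mul_ne_zero h2 h2
        apply mul_left_cancel₀ h4
        field_simp
        rw [hy] at hDz
        linear_combination -hDz
      · rintro ⟨t, ht⟩
        rw [← ZMod.intCast_zmod_eq_zero_iff_dvd] at ht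
        push_cast at ht
        refine ⟨(2 * t + β) / g, ?_⟩
        field_simp
        linear_combination (-1 : ZMod p) * hDz - 4 * ht
    by_cases hs : IsSquare (D₀ : ZMod p)
    · left
      exact ⟨(legendreSym.eq_one_iff p hz).2 hs, hiff.1 hs⟩
    · right
      exact ⟨(legendreSym.eq_neg_one_iff p).2 hs, fun h => hs (hiff.2 h)⟩

/-- A quadratic polynomial whose discriminant is divisible by `p` can be translated so that both
lower coefficients are divisible by `p`. -/
lemma exists_shift (hp : p.Prime) (h : (p : ℤ) ∣ β ^ 2 - 4 * γ) :
    ∃ s : ℤ, (p : ℤ) ∣ β + 2 * s ∧ (p : ℤ) ∣ γ + β * s + s ^ 2 := by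
  by_cases hp2 : p = 2
  · subst hp2
    have hβ : (2 : ℤ) ∣ β := by
      refine Int.prime_two.dvd_of_dvd_pow (n := 2) ?_
      have : β ^ 2 = (β ^ 2 - 4 * γ) + 2 * (2 * γ) := by ring
      rw [this]
      exact dvd_add (by exact_mod_cast h) (dvd_mul_right _ _)
    refine ⟨γ, by push_cast; omega, ?_⟩
    push_cast
    obtain ⟨c, hc⟩ := Int.even_mul_succ_self γ
    obtain ⟨b, rfl⟩ := hβ
    exact ⟨c + b * γ, by linear_combination hc⟩
  · have hp' : Prime (p : ℤ) := Nat.prime_iff_prime_int.1 hp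
    have hodd : p % 2 = 1 := hp.eq_two_or_odd.resolve_left hp2
    obtain ⟨u, hu⟩ : ∃ u : ℤ, (p : ℤ) = 2 * u - 1 := ⟨((p + 1) / 2 : ℕ), by omega⟩
    have h1 : (p : ℤ) ∣ β + 2 * (-β * u) := ⟨-β, by rw [hu]; ring⟩
    refine ⟨-β * u, h1, ?_⟩
    have h4 : (p : ℤ) ∣ 4 * (γ + β * (-β * u) + (-β * u) ^ 2) := by
      have : 4 * (γ + β * (-β * u) + (-β * u) ^ 2) =
          (β + 2 * (-β * u)) * (β + 2 * (-β * u)) - (β ^ 2 - 4 * γ) := by ring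
      rw [this]
      exact dvd_sub (h1.mul_right _) h
    refine (hp'.dvd_or_dvd h4).resolve_left fun h => hp2 ?_
    have h2 : p ∣ 2 ^ 2 := by exact_mod_cast h
    exact (Nat.prime_dvd_prime_iff_eq hp Nat.prime_two).1 (hp.dvd_of_dvd_pow h2)

lemma exists_shift' (hp : p.Prime) (h : (p : ℤ) ∣ β ^ 2 - 4 * γ) :
    ∃ b c : ℤ, (p : ℤ) ∣ b ∧ (p : ℤ) ∣ c ∧ b ^ 2 - 4 * c = β ^ 2 - 4 * γ ∧
      ∀ M, quadRootCount b c M = quadRootCount β γ M := by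
  obtain ⟨s, h1, h2⟩ := exists_shift hp h
  exact ⟨_, _, h1, h2, by ring, fun M => quadRootCount_shift s M⟩

lemma not_sq_dvd_of_fundamental (hp : p.Prime) (hf : IsFundamentalDiscriminant D₀)
    (hD₀ : (p : ℤ) ∣ D₀) {g : ℤ} (hg : ¬ (p : ℤ) ∣ g) (hβ : (p : ℤ) ∣ β)
    (hD : β ^ 2 - 4 * γ = D₀ * g ^ 2) : ¬ (p : ℤ) ^ 2 ∣ γ := by
  have hp' : Prime (p : ℤ) := Nat.prime_iff_prime_int.1 hp
  rintro ⟨c, rfl⟩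
  obtain ⟨b, rfl⟩ := hβ
  have h1 : (p : ℤ) ^ 2 * (b ^ 2 - 4 * c) = D₀ * g ^ 2 := by rw [← hD]; ring
  have hcop : IsCoprime ((p : ℤ) ^ 2) (g ^ 2) :=
    (hp'.coprime_iff_not_dvd.2 hg).pow
  have h2 : (p : ℤ) ^ 2 ∣ D₀ := hcop.dvd_of_dvd_mul_right ⟨_, h1.symm⟩
  have hnu : ¬ IsUnit (p : ℤ) := hp'.not_isUnit
  rw [sq] at h2
  rcases hf with ⟨-, hsq⟩ | ⟨h4, hsq, hm⟩
  · exact hnu (hsq _ h2)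
  · obtain ⟨m, rfl⟩ : ∃ m, D₀ = 4 * m := ⟨D₀ / 4, by omega⟩
    rw [Int.mul_ediv_cancel_left _ (by norm_num)] at hsq hm
    by_cases hp2 : p = 2
    · subst hp2
      obtain ⟨u, rfl⟩ : ∃ u, g = 2 * u + 1 := ⟨g / 2, by push_cast at hg; omega⟩
      push_cast at h1
      have h3 : b ^ 2 - 4 * c = m + 4 * (m * (u ^ 2 + u)) := by linarith
      rcases Int.even_or_odd' b with ⟨t, rfl | rfl⟩
      · ring_nf at h3; omega
      · ring_nf at h3; omega
    · have hcop4 : IsCoprime ((p : ℤ) * p) 4 := by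
        have : IsCoprime (p : ℤ) 2 := by
          rw [hp'.coprime_iff_not_dvd]
          intro h
          exact hp2 ((Nat.prime_dvd_prime_iff_eq hp Nat.prime_two).1 (by exact_mod_cast h))
        have h := this.pow (m := 2) (n := 2)
        rw [sq] at h
        norm_num at h
        exact h
      exact hnu (hsq _ (hcop4.dvd_of_dvd_mul_left h2))

lemma sq_dvd_of_disc (hp : p.Prime) {D' : ℤ} (h4 : D' % 4 = 0 ∨ D' % 4 = 1)
    (hβ : (p : ℤ) ∣ β) (hγ : (p : ℤ) ∣ γ) (hD : β ^ 2 - 4 * γ = p ^ 2 * D') :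
    ∃ b c : ℤ, β = p * b ∧ γ = p ^ 2 * c ∧ b ^ 2 - 4 * c = D' := by
  have hp' : Prime (p : ℤ) := Nat.prime_iff_prime_int.1 hp
  have hp0 : (p : ℤ) ^ 2 ≠ 0 := pow_ne_zero _ hp'.ne_zero
  obtain ⟨b, rfl⟩ := hβ
  have hdvd : (p : ℤ) ^ 2 ∣ γ := by
    by_cases hp2 : p = 2
    · subst hp2
      push_cast at *
      have h1 : γ = b ^ 2 - D' := by linarith
      rcases Int.even_or_odd' b with ⟨t, rfl | rfl⟩
      · ring_nf at h1; omega
      · ring_nf at h1; omega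
    · have hcop4 : IsCoprime ((p : ℤ) ^ 2) 4 := by
        have : IsCoprime (p : ℤ) 2 := by
          rw [hp'.coprime_iff_not_dvd]
          intro h
          exact hp2 ((Nat.prime_dvd_prime_iff_eq hp Nat.prime_two).1 (by exact_mod_cast h))
        have h := this.pow (m := 2) (n := 2)
        norm_num at h
        exact h
      exact hcop4.dvd_of_dvd_mul_left ⟨b ^ 2 - D', by linarith⟩
  obtain ⟨c, rfl⟩ := hdvd
  refine ⟨b, c, rfl, rfl, ?_⟩
  apply mul_left_cancel₀ hp0
  rw [← hD]; ring

lemma hasSum_congr_of_eq {u w : ℕ → ℝ} {a b : ℝ} (h : HasSum u a) (huw : ∀ k, w k = u k)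
    (hab : b = a) : HasSum w b := by
  rwa [funext huw, hab]

/-- The generating function of root counts modulo powers of `p`. -/
theorem hasSum_prime_pow (hp : p.Prime) (hf : IsFundamentalDiscriminant D₀) {g : ℤ}
    (hg : ¬ (p : ℤ) ∣ g) {X : ℝ} (hX : |X| < 1) (v : ℕ) : ∀ β γ : ℤ,
    β ^ 2 - 4 * γ = D₀ * (p ^ v * g) ^ 2 →
    HasSum (fun k => (quadRootCount β γ (p ^ k) : ℝ) * X ^ k)
      ((1 + X) * (∑ j ∈ Finset.range (v + 1), (p * X ^ 2) ^ j -
        kroneckerSym D₀ p * X * ∑ j ∈ Finset.range v, (p * X ^ 2) ^ j) /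
          (1 - kroneckerSym D₀ p * X)) := by
  have hX1 : X < 1 := (abs_lt.1 hX).2
  have hX2 : -1 < X := (abs_lt.1 hX).1
  induction v with
  | zero =>
    intro β γ hD
    rw [pow_zero, one_mul] at hD
    simp only [zero_add, Finset.range_one, Finset.sum_singleton, pow_zero, Finset.range_zero,
      Finset.sum_empty, mul_zero, sub_zero, mul_one]
    by_cases hpD : (p : ℤ) ∣ D₀
    · rw [kroneckerSym_eq_zero hp hpD]
      obtain ⟨b, c, hb, hc, hbc, hcount⟩ := exists_shift' (β := β) (γ := γ) hp
        (by rw [hD]; exact hpD.mul_right _)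
      rw [hD] at hbc
      have hnd := not_sq_dvd_of_fundamental hp hf hpD hg hb hbc
      simp only [← hcount]
      rw [← hasSum_nat_add_iff' 2]
      simp only [prime_pow_eq_zero hp hb hc hnd]
      refine hasSum_congr_of_eq hasSum_zero (fun k => by simp) ?_
      · rw [Finset.sum_range_succ _ 1, Finset.sum_range_one, pow_zero, pow_zero, quadRootCount_one,
          pow_one, prime_eq_one hp hb hc]
        simp
    · have hnd : ¬ (p : ℤ) ∣ β ^ 2 - 4 * γ := by
        rw [hD]
        have hp' : Prime (p : ℤ) := Nat.prime_iff_prime_int.1 hp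
        intro h
        rcases hp'.dvd_or_dvd h with h | h
        · exact hpD h
        · exact hg (hp'.dvd_of_dvd_pow h)
      rw [← hasSum_nat_add_iff' 1]
      have hgeo := (hasSum_geometric_of_abs_lt_one hX)
      rcases kroneckerSym_cases hp hf.mod_four hpD hg hD with ⟨hk, hr⟩ | ⟨hk, hr⟩
      · simp only [prime_pow_of_exists hp hnd hr, hk]
        refine hasSum_congr_of_eq (hgeo.mul_left (2 * X)) (fun k => by push_cast; ring) ?_
        · have : 1 - X ≠ 0 := by linarith
          simp [quadRootCount_one]
          field_simp
          ring
      · simp only [prime_pow_of_not_exists hp hr, hk]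
        refine hasSum_congr_of_eq hasSum_zero (fun k => by simp) ?_
        · have : 1 + X ≠ 0 := by linarith
          simp [quadRootCount_one]
          field_simp
          ring
  | succ v ih =>
    intro β γ hD
    have hD' : β ^ 2 - 4 * γ = p ^ 2 * (D₀ * (p ^ v * g) ^ 2) := by rw [hD]; ring
    obtain ⟨b, c, hb, hc, hbc, hcount⟩ := exists_shift' (β := β) (γ := γ) hp
      (by rw [hD', sq]; exact (dvd_mul_right _ _).mul_right _)
    rw [hD'] at hbc
    obtain ⟨b', c', rfl, rfl, hbc'⟩ := sq_dvd_of_disc hp (mul_sq_mod_four hf.mod_four _) hb hc hbc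
    simp only [← hcount]
    rw [← hasSum_nat_add_iff' 2]
    simp only [prime_pow_add_two hp]
    refine hasSum_congr_of_eq ((ih b' c' hbc').mul_left (p * X ^ 2))
      (fun k => by push_cast; ring) ?_
    · rw [Finset.sum_range_succ _ 1, Finset.sum_range_one, pow_zero, pow_zero, quadRootCount_one,
        pow_one, prime_eq_one hp hb hc]
      have hne : 1 - (kroneckerSym D₀ p : ℝ) * X ≠ 0 := by
        have hk := kroneckerSym_trichotomy hp D₀
        rcases hk with h | h | h <;> rw [h] <;> push_cast <;> intro h' <;> linarith
      rw [geom_sum_succ (n := v + 1), geom_sum_succ (n := v)]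
      generalize ∑ j ∈ Finset.range v, ((p : ℝ) * X ^ 2) ^ j = S
      rw [mul_div_assoc', div_sub' hne, div_left_inj' hne]
      push_cast
      ring

end RootCount

namespace RootCount

open ArithmeticFunction

variable {β γ D₀ : ℤ} {p : ℕ}

section Twist

variable {N : ℕ} (χ : DirichletCharacter ℂ N)

/-- The arithmetic function `n ↦ μ(n) χ(n) n`. -/
noncomputable def moebiusTwist : ArithmeticFunction ℂ :=
  ⟨fun n => (moebius n : ℂ) * χ n * n, by simp⟩

lemma moebiusTwist_apply (n : ℕ) : moebiusTwist χ n = (moebius n : ℂ) * χ n * n := rfl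

lemma isMultiplicative_moebiusTwist : (moebiusTwist χ).IsMultiplicative := by
  refine ⟨by simp [moebiusTwist_apply], fun {m n} h => ?_⟩
  simp only [moebiusTwist_apply, isMultiplicative_moebius.map_mul_of_coprime h, Int.cast_mul,
    Nat.cast_mul, map_mul]
  ring

/-- The twisted divisor sum `n ↦ ∑_{d ∣ n} μ(d) χ(d) d σ₃(n / d)`. -/
noncomputable def twistedSigma : ArithmeticFunction ℂ :=
  moebiusTwist χ * ((sigma 3 : ArithmeticFunction ℕ) : ArithmeticFunction ℂ)

lemma isMultiplicative_twistedSigma : (twistedSigma χ).IsMultiplicative :=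
  (isMultiplicative_moebiusTwist χ).mul isMultiplicative_sigma.natCast

lemma twistedSigma_apply (n : ℕ) : twistedSigma χ n =
    ∑ d ∈ n.divisors, (moebius d : ℂ) * χ d * d * ∑ e ∈ (n / d).divisors, (e : ℂ) ^ 3 := by
  rw [twistedSigma, mul_apply, Nat.sum_divisorsAntidiagonal
    (f := fun a b => moebiusTwist χ a * ((sigma 3 : ArithmeticFunction ℕ) : ArithmeticFunction ℂ) b)]
  simp [moebiusTwist_apply, sigma_apply]

lemma twistedSigma_prime_pow (hp : p.Prime) (v : ℕ) : twistedSigma χ (p ^ v) / ((p ^ v : ℕ) : ℂ) ^ 3 =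
    ∑ j ∈ Finset.range (v + 1), ((p : ℂ) * ((p : ℂ) ^ 2)⁻¹ ^ 2) ^ j -
      χ p * ((p : ℂ) ^ 2)⁻¹ * ∑ j ∈ Finset.range v, ((p : ℂ) * ((p : ℂ) ^ 2)⁻¹ ^ 2) ^ j := by
  have hp0 : (p : ℂ) ≠ 0 := by exact_mod_cast hp.ne_zero
  have hY : (p : ℂ) * ((p : ℂ) ^ 2)⁻¹ ^ 2 = ((p : ℂ) ^ 3)⁻¹ := by field_simp
  have hs : ∀ w : ℕ, (∑ e ∈ (p ^ w).divisors, (e : ℂ) ^ 3) =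
      ((p : ℂ) ^ 3) ^ w * ∑ j ∈ Finset.range (w + 1), (((p : ℂ) ^ 3)⁻¹) ^ j := by
    intro w
    rw [Nat.sum_divisors_prime_pow hp, Finset.mul_sum, ← Finset.sum_range_reflect]
    refine Finset.sum_congr rfl fun j hj => ?_
    have hj' : j ≤ w := by simpa [Nat.lt_succ_iff] using hj
    obtain ⟨i, rfl⟩ := Nat.exists_eq_add_of_le hj'
    rw [show j + i + 1 - 1 - j = i by omega]
    have h1 : ((p : ℂ) ^ 3) ^ j * ((p : ℂ) ^ 3)⁻¹ ^ j = 1 := by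
      rw [← mul_pow, mul_inv_cancel₀ (pow_ne_zero _ hp0), one_pow]
    push_cast
    rw [pow_add, mul_right_comm, h1, one_mul, ← pow_mul, ← pow_mul, mul_comm]
  rw [hY, twistedSigma_apply, Nat.sum_divisors_prime_pow hp]
  cases v with
  | zero => simp
  | succ v =>
    rw [Finset.sum_range_succ', Finset.sum_range_succ', Finset.sum_eq_zero]
    · rw [zero_add, pow_one, pow_zero, Nat.div_one, hs, pow_succ p v, Nat.mul_div_cancel _ hp.pos, hs,
        moebius_apply_prime hp]
      simp
      field_simp
      ring
    · intro j _
      rw [moebius_apply_prime_pow hp (by omega), if_neg (by omega)]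
      simp

lemma twistedSigma_div (n : ℕ) (hn : n ≠ 0) : twistedSigma χ n / (n : ℂ) ^ 3 =
    ∏ q ∈ n.primeFactors, twistedSigma χ (q ^ n.factorization q) /
      ((q ^ n.factorization q : ℕ) : ℂ) ^ 3 := by
  rw [Finset.prod_div_distrib, (isMultiplicative_twistedSigma χ).multiplicative_factorization _ hn,
    Finset.prod_pow, ← Nat.cast_prod]
  congr 3
  exact (Nat.prod_factorization_pow_eq_self hn).symm

lemma hasProd_twistedSigma (n : ℕ) (hn : n ≠ 0) :
    HasProd (fun q : Nat.Primes => twistedSigma χ (q ^ n.factorization q) /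
      (((q : ℕ) ^ n.factorization q : ℕ) : ℂ) ^ 3) (twistedSigma χ n / (n : ℂ) ^ 3) := by
  rw [twistedSigma_div χ n hn, ← Finset.prod_subtype_of_mem (p := Nat.Prime) _
    (fun q hq => Nat.prime_of_mem_primeFactors hq)]
  refine hasProd_prod_of_ne_finset_one fun q hq => ?_
  have : n.factorization q = 0 := by
    rw [← Finsupp.notMem_support_iff, Nat.support_factorization]
    exact fun hm => hq (Finset.mem_subtype.2 hm)
  rw [this]
  simp [(isMultiplicative_twistedSigma χ).map_one]

end Twist

lemma hasProd_local (hf : IsFundamentalDiscriminant D₀) {f : ℕ} (hf0 : f ≠ 0)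
    (hD : β ^ 2 - 4 * γ = D₀ * f ^ 2) {T : ℝ}
    (hT : HasSum (fun m : ℕ => (quadRootCount β γ (m + 1) : ℝ) / ((m + 1 : ℕ) : ℝ) ^ 2) T) :
    HasProd (fun p : Nat.Primes => (1 + ((p : ℂ) ^ 2)⁻¹) *
      (∑ j ∈ Finset.range (f.factorization p + 1), ((p : ℂ) * ((p : ℂ) ^ 2)⁻¹ ^ 2) ^ j -
        kroneckerSym D₀ p * ((p : ℂ) ^ 2)⁻¹ *
          ∑ j ∈ Finset.range (f.factorization p), ((p : ℂ) * ((p : ℂ) ^ 2)⁻¹ ^ 2) ^ j) /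
        (1 - kroneckerSym D₀ p * ((p : ℂ) ^ 2)⁻¹)) T := by
  set F : ℕ → ℂ := fun n => ((quadRootCount β γ n / (n : ℝ) ^ 2 : ℝ) : ℂ) with hF
  have hsumR : HasSum (fun n : ℕ => (quadRootCount β γ n : ℝ) / (n : ℝ) ^ 2) T := by
    rw [← hasSum_nat_add_iff' 1]
    simpa using hT
  have hsum : HasSum F T := Complex.hasSum_ofReal.2 hsumR
  have hnorm : Summable fun n => ‖F n‖ := by
    refine hsumR.summable.congr fun n => ?_
    rw [hF, Complex.norm_real, Real.norm_of_nonneg (by positivity)]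
  have h := EulerProduct.eulerProduct_hasProd (f := F) (by simp [hF, quadRootCount_one])
    (fun {m n} hmn => by
      simp only [hF, quadRootCount_mul hmn]
      push_cast
      rw [mul_pow, mul_div_mul_comm]) hnorm (by simp [hF])
  rw [hsum.tsum_eq] at h
  refine h.congr_fun ?_
  rintro ⟨p, hp⟩
  have hp1 : (1 : ℝ) < (p : ℝ) ^ 2 := by
    have : (1 : ℝ) < p := by exact_mod_cast hp.one_lt
    nlinarith
  have hX : |((p : ℝ) ^ 2)⁻¹| < 1 := by
    rw [abs_of_pos (by positivity)]
    exact inv_lt_one_of_one_lt₀ hp1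
  have hfac : (p : ℤ) ^ f.factorization p * ((f / p ^ f.factorization p : ℕ) : ℤ) = f := by
    exact_mod_cast Nat.ordProj_mul_ordCompl_eq_self f p
  have hg : ¬ (p : ℤ) ∣ ((f / p ^ f.factorization p : ℕ) : ℤ) := by
    exact_mod_cast Nat.not_dvd_ordCompl hp hf0
  have hloc := hasSum_prime_pow hp hf hg hX (f.factorization p) β γ (by rw [hfac, hD])
  have hloc' := Complex.hasSum_ofReal.2 hloc
  have he : (fun k => (((quadRootCount β γ (p ^ k) : ℝ) * ((p : ℝ) ^ 2)⁻¹ ^ k : ℝ) : ℂ)) =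
      fun k => F (p ^ k) := by
    funext k
    simp only [hF, div_eq_mul_inv, inv_pow, Nat.cast_pow, ← pow_mul, mul_comm 2 k]
  rw [he] at hloc'
  rw [hloc'.tsum_eq]
  push_cast
  rfl

/-- The mean value of the quadratic-form sum in terms of `L(2, χ)`. -/
theorem meanValue_eq (hf : IsFundamentalDiscriminant D₀) {f : ℕ} (hf0 : f ≠ 0)
    (hD0 : 0 < D₀ * f ^ 2) [NeZero D₀.natAbs] (χ : DirichletCharacter ℂ D₀.natAbs)
    (hχ : ∀ n : ℕ, χ (n : ZMod D₀.natAbs) = kroneckerSym D₀ n) {k : ℕ} {κ : ℝ}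
    (h : ZagierSum.IsSquareData (D₀ * f ^ 2) k κ) :
    (ZagierSum.meanValue (D₀ * f ^ 2) k κ : ℂ) = 5 / 2 * (D₀ * √(D₀ : ℝ) : ℝ) / Real.pi ^ 2 *
      DirichletCharacter.LFunction χ 2 * twistedSigma χ f := by
  obtain ⟨β, γ, hβ⟩ : ∃ β γ : ℤ, β ^ 2 - 4 * γ = D₀ * f ^ 2 := by
    rcases mul_sq_mod_four hf.mod_four (f : ℤ) with h4 | h4
    · exact ⟨0, -(D₀ * f ^ 2 / 4), by omega⟩
    · exact ⟨1, -(D₀ * f ^ 2 / 4), by omega⟩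
  set D : ℤ := D₀ * f ^ 2 with hDdef
  have hDR : (0 : ℝ) < D := by exact_mod_cast hD0
  have hsq : 0 < √(D : ℝ) := Real.sqrt_pos.2 hDR
  have hT : HasSum (fun m : ℕ => (quadRootCount β γ (m + 1) : ℝ) / ((m + 1 : ℕ) : ℝ) ^ 2)
      (ZagierSum.meanValue D k κ * (6 / (D * √(D : ℝ)))) := by
    refine hasSum_congr_of_eq ((ZagierSum.hasSum_quadRootCount hD0 hβ h).mul_right
      (6 / (D * √(D : ℝ)))) (fun m => ?_) rfl
    field_simp
  have hP1 := (hasProd_local hf hf0 hβ hT).mul (riemannZeta_eulerProduct_hasProd (s := 4) (by norm_num))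
  have hP2 := ((riemannZeta_eulerProduct_hasProd (s := 2) (by norm_num)).mul
    (DirichletCharacter.LSeries_eulerProduct_hasProd χ (s := 2) (by norm_num))).mul
    (hasProd_twistedSigma χ f hf0)
  have heq := hP1.unique (hP2.congr_fun ?_)
  · rw [riemannZeta_two, riemannZeta_four, ← DirichletCharacter.LFunction_eq_LSeries χ
      (by norm_num)] at heq
    have hf0R : (0 : ℝ) < f := by positivity
    have hf0C : (f : ℂ) ≠ 0 := by exact_mod_cast hf0
    have hpi : (Real.pi : ℂ) ≠ 0 := by exact_mod_cast Real.pi_ne_zero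
    have hDs : (D : ℝ) * √(D : ℝ) = D₀ * √(D₀ : ℝ) * f ^ 3 := by
      have : √(D : ℝ) = √(D₀ : ℝ) * f := by
        rw [hDdef]
        push_cast
        rw [Real.sqrt_mul' _ (by positivity), Real.sqrt_sq hf0R.le]
      rw [this, hDdef]
      push_cast
      ring
    rw [hDs] at heq
    have hne : ((D₀ * √(D₀ : ℝ) : ℝ) : ℂ) ≠ 0 := by
      have : (D : ℝ) * √(D : ℝ) ≠ 0 := by positivity
      rw [hDs] at this
      exact_mod_cast left_ne_zero_of_mul this
    generalize (D₀ * √(D₀ : ℝ) : ℝ) = E at heq hne ⊢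
    push_cast at heq
    field_simp at heq
    field_simp
    linear_combination heq / 18
  · rintro ⟨p, hp⟩
    simp only
    rw [twistedSigma_prime_pow χ hp, hχ]
    have hp0 : (p : ℂ) ≠ 0 := by exact_mod_cast hp.ne_zero
    have e2 : (p : ℂ) ^ (-2 : ℂ) = ((p : ℂ) ^ 2)⁻¹ := by
      rw [Complex.cpow_neg]; norm_cast
    have e4 : (p : ℂ) ^ (-4 : ℂ) = ((p : ℂ) ^ 2)⁻¹ ^ 2 := by
      rw [Complex.cpow_neg, inv_pow, ← pow_mul]; norm_cast
    rw [e2, e4]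
    obtain ⟨x, hx, hx0, hx1⟩ : ∃ x : ℝ, ((p : ℂ) ^ 2)⁻¹ = x ∧ 0 < x ∧ x < 1 := by
      have hp1 : (1 : ℝ) < p := by exact_mod_cast hp.one_lt
      exact ⟨((p : ℝ) ^ 2)⁻¹, by push_cast; rfl, by positivity,
        inv_lt_one_of_one_lt₀ (by nlinarith)⟩
    rw [hx]
    have h1 : 1 - (x : ℂ) ≠ 0 := by exact_mod_cast (by linarith : 1 - x ≠ 0)
    have h2 : 1 + (x : ℂ) ≠ 0 := by exact_mod_cast (by linarith : 1 + x ≠ 0)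
    rw [show 1 - (x : ℂ) ^ 2 = (1 - x) * (1 + x) by ring, div_eq_mul_inv, mul_inv]
    field_simp

end RootCount

namespace GaussSign

/-- Gaussian binomial coefficients evaluated at `q`. -/
def qBinom (q : ℂ) : ℕ → ℕ → ℂ
  | _, 0 => 1
  | 0, _ + 1 => 0
  | m + 1, j + 1 => qBinom q m j + q ^ (j + 1) * qBinom q m (j + 1)

variable {q : ℂ}

lemma qBinom_zero_right (m : ℕ) : qBinom q m 0 = 1 := by cases m <;> simp [qBinom]

lemma qBinom_succ_succ (m j : ℕ) :
    qBinom q (m + 1) (j + 1) = qBinom q m j + q ^ (j + 1) * qBinom q m (j + 1) := by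
  simp [qBinom]

lemma qBinom_eq_zero : ∀ {m j : ℕ}, m < j → qBinom q m j = 0
  | 0, j + 1, _ => by simp [qBinom]
  | m + 1, j + 1, h => by
    rw [qBinom_succ_succ, qBinom_eq_zero (by omega), qBinom_eq_zero (by omega)]
    simp

lemma qBinom_absorb (m : ℕ) : ∀ j, (1 - q ^ (j + 1)) * qBinom q (m + 1) (j + 1) =
    (1 - q ^ (m + 1)) * qBinom q m j := by
  induction m with
  | zero =>
    intro j
    cases j with
    | zero => simp [qBinom]
    | succ j => rw [qBinom_eq_zero (by omega), qBinom_eq_zero (by omega)]; simp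
  | succ m ih =>
    intro j
    rw [qBinom_succ_succ (m + 1), mul_add, mul_left_comm, ih]
    cases j with
    | zero => rw [qBinom_zero_right, qBinom_zero_right]; ring
    | succ j =>
      have h1 := ih j
      rw [qBinom_succ_succ m] at h1 ⊢
      linear_combination q * h1

/-- The alternating sum of Gaussian binomial coefficients. -/
noncomputable def altSum (q : ℂ) (m : ℕ) : ℂ := ∑ j ∈ Finset.range (m + 1), (-1) ^ j * qBinom q m j

lemma altSum_add_two (m : ℕ) : altSum q (m + 2) = (1 - q ^ (m + 1)) * altSum q m := by
  have h1 : altSum q (m + 2) =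
      ∑ j ∈ Finset.range (m + 2), (-1) ^ j * (q ^ j - 1) * qBinom q (m + 1) j := by
    have h2 : ∑ j ∈ Finset.range (m + 3), (-1) ^ j * (q ^ j * qBinom q (m + 1) j) =
        ∑ j ∈ Finset.range (m + 2), (-1) ^ j * (q ^ j * qBinom q (m + 1) j) := by
      rw [Finset.sum_range_succ, qBinom_eq_zero (by omega)]; simp
    rw [Finset.sum_range_succ'] at h2
    rw [altSum, Finset.sum_range_succ']
    simp only [qBinom_succ_succ (m + 1), mul_add, Finset.sum_add_distrib, qBinom_zero_right]
    rw [qBinom_zero_right] at h2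
    have h3 : ∑ x ∈ Finset.range (m + 2), (-1 : ℂ) ^ (x + 1) * qBinom q (m + 1) x =
        - ∑ x ∈ Finset.range (m + 2), (-1) ^ x * qBinom q (m + 1) x := by
      rw [← Finset.sum_neg_distrib]
      exact Finset.sum_congr rfl fun x _ => by ring
    have h4 : ∑ j ∈ Finset.range (m + 2), (-1) ^ j * (q ^ j - 1) * qBinom q (m + 1) j =
        ∑ j ∈ Finset.range (m + 2), (-1) ^ j * (q ^ j * qBinom q (m + 1) j) -
          ∑ j ∈ Finset.range (m + 2), (-1) ^ j * qBinom q (m + 1) j := by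
      rw [← Finset.sum_sub_distrib]
      exact Finset.sum_congr rfl fun x _ => by ring
    rw [h3, h4]
    linear_combination h2
  rw [h1, Finset.sum_range_succ', altSum, Finset.mul_sum]
  simp only [pow_zero, sub_self, mul_zero, zero_mul, add_zero]
  refine Finset.sum_congr rfl fun j _ => ?_
  linear_combination (-1) ^ j * qBinom_absorb m j

lemma altSum_two_mul (k : ℕ) : altSum q (2 * k) = ∏ i ∈ Finset.range k, (1 - q ^ (2 * i + 1)) := by
  induction k with
  | zero => simp [altSum, qBinom]
  | succ k ih => rw [mul_add, mul_one, altSum_add_two, ih, Finset.prod_range_succ, mul_comm]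

lemma qBinom_primitiveRoot {k : ℕ} (hq : IsPrimitiveRoot q (2 * k + 1)) (j : ℕ) (hj : j ≤ 2 * k) :
    q ^ (j * (j + 1) / 2) * qBinom q (2 * k) j = (-1) ^ j := by
  induction j with
  | zero => simp [qBinom_zero_right]
  | succ j ih =>
    have h1 := qBinom_absorb (q := q) (2 * k) j
    rw [hq.pow_eq_one, qBinom_succ_succ] at h1
    have h2 : 1 - q ^ (j + 1) ≠ 0 := fun h =>
      hq.pow_ne_one_of_pos_of_lt (by omega : j + 1 ≠ 0) (by omega) (by linear_combination -h)
    have h3 : qBinom q (2 * k) j + q ^ (j + 1) * qBinom q (2 * k) (j + 1) = 0 := by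
      apply mul_left_cancel₀ h2
      rw [h1]; ring
    have h4 : (j + 1) * (j + 1 + 1) / 2 = j * (j + 1) / 2 + (j + 1) := by
      rw [show (j + 1) * (j + 1 + 1) = j * (j + 1) + (j + 1) * 2 by ring,
        Nat.add_mul_div_right _ _ (by norm_num)]
    rw [h4, pow_add, pow_succ (-1 : ℂ)]
    linear_combination q ^ (j * (j + 1) / 2) * h3 - ih (by omega)

lemma sum_triangular {k : ℕ} {z : ℂ} (hz : IsPrimitiveRoot z (2 * k + 1)) :
    ∑ j ∈ Finset.range (2 * k + 1), z ^ (j * (j + 1) / 2) =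
      ∏ i ∈ Finset.range k, (1 - z⁻¹ ^ (2 * i + 1)) := by
  rw [← altSum_two_mul, altSum]
  refine Finset.sum_congr rfl fun j hj => ?_
  have hz0 : z ≠ 0 := hz.ne_zero (by omega)
  have h := qBinom_primitiveRoot hz.inv j (by simpa [Nat.lt_succ_iff] using hj)
  have h1 : z ^ (j * (j + 1) / 2) * z⁻¹ ^ (j * (j + 1) / 2) = 1 := by
    rw [← mul_pow, mul_inv_cancel₀ hz0, one_pow]
  have h2 : (-1 : ℂ) ^ j * (-1) ^ j = 1 := by rw [← mul_pow]; norm_num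
  linear_combination (-(z ^ (j * (j + 1) / 2)) * (-1) ^ j) * h +
    (-1) ^ j * qBinom z⁻¹ (2 * k) j * h1 - z ^ (j * (j + 1) / 2) * h2

/-- The sum of a periodic function over a complete residue system. -/
lemma sum_periodic {N : ℕ} (hN : N ≠ 0) {g : ℤ → ℂ} (hg : ∀ a, g (a + N) = g a) {ι : Type*}
    (s : Finset ι) (φ : ι → ℤ) (hcard : s.card = N)
    (hinj : ∀ i ∈ s, ∀ j ∈ s, (N : ℤ) ∣ φ i - φ j → i = j) :
    ∑ i ∈ s, g (φ i) = ∑ r ∈ Finset.range N, g r := by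
  have hN' : (0 : ℤ) < N := by exact_mod_cast Nat.pos_of_ne_zero hN
  set e : ι → ℕ := fun i => (φ i % N).toNat with he
  have he' : ∀ i, (e i : ℤ) = φ i % N := fun i => Int.toNat_of_nonneg (Int.emod_nonneg _ hN'.ne')
  have hge : ∀ i, g (φ i) = g (e i) := fun i => by
    have := (show Function.Periodic g (N : ℤ) from hg).int_mul (φ i / N) (φ i % N)
    rw [he', ← this]
    congr 1
    rw [mul_comm]
    exact (Int.emod_add_mul_ediv _ _).symm
  have hei : Set.InjOn e s := fun i hi j hj hij => hinj i hi j hj <| by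
    have : φ i % N = φ j % N := by rw [← he', ← he', hij]
    exact Int.ModEq.dvd (Int.ModEq.symm this)
  have himg : s.image e = Finset.range N := by
    refine Finset.eq_of_subset_of_card_le (fun r hr => ?_) ?_
    · obtain ⟨i, -, rfl⟩ := Finset.mem_image.1 hr
      have := Int.emod_lt_of_pos (φ i) hN'
      rw [← he'] at this
      exact Finset.mem_range.2 (by exact_mod_cast this)
    · rw [Finset.card_image_of_injOn hei, hcard, Finset.card_range]
  rw [← himg, Finset.sum_image hei]
  exact Finset.sum_congr rfl fun i _ => hge i

lemma sum_range_zmod {N : ℕ} [NeZero N] (g : ZMod N → ℂ) :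
    ∑ r ∈ Finset.range N, g (r : ZMod N) = ∑ a, g a :=
  Finset.sum_nbij' (fun r => (r : ZMod N)) ZMod.val (by simp)
    (fun a _ => Finset.mem_range.2 a.val_lt)
    (fun r hr => ZMod.val_cast_of_lt (Finset.mem_range.1 hr)) (by simp) (by simp)

/-- The standard primitive root of unity. -/
noncomputable def unitRoot (N : ℕ) : ℂ := exp (2 * Real.pi * I / N)

lemma isPrimitiveRoot_unitRoot {N : ℕ} (hN : N ≠ 0) : IsPrimitiveRoot (unitRoot N) N :=
  isPrimitiveRoot_exp N hN

/-- The evaluation of the quadratic Gauss sum as a product of sines. -/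
lemma sum_sq_eq_prod (k : ℕ) : ∑ j ∈ Finset.range (2 * k + 1), unitRoot (2 * k + 1) ^ (j ^ 2) =
    ∏ i ∈ Finset.range k, (2 * I * Real.sin (2 * Real.pi * (2 * i + 1) / (2 * k + 1))) := by
  set w := unitRoot (2 * k + 1) with hw
  have hprim : IsPrimitiveRoot w (2 * k + 1) := isPrimitiveRoot_unitRoot (by omega)
  have hw0 : w ≠ 0 := hprim.ne_zero (by omega)
  have h2 : IsPrimitiveRoot (w ^ 2) (2 * k + 1) := by
    refine hprim.pow_of_coprime 2 ?_
    simp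
  have h := sum_triangular h2
  have hshift : ∑ j ∈ Finset.range (2 * k + 1), w ^ (j ^ 2) =
      w ^ ((k + 1) ^ 2) * ∑ j ∈ Finset.range (2 * k + 1), (w ^ 2) ^ (j * (j + 1) / 2) := by
    have hper : ∀ a : ℤ, w ^ ((a + (2 * k + 1 : ℕ)) ^ 2) = w ^ (a ^ 2) := fun a => by
      have : (a + (2 * k + 1 : ℕ)) ^ 2 = a ^ 2 + (2 * k + 1 : ℕ) * (2 * a + (2 * k + 1 : ℕ)) := by ring
      rw [this, zpow_add₀ hw0, zpow_mul, zpow_natCast, hprim.pow_eq_one, one_zpow, mul_one]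
    have h3 := sum_periodic (N := 2 * k + 1) (g := fun a => w ^ (a ^ 2)) (by omega) hper (Finset.range (2 * k + 1))
      (fun j => (j : ℤ) + (k + 1)) (Finset.card_range _) fun i hi j hj hij => by
        rw [Finset.mem_range] at hi hj
        obtain ⟨c, hc⟩ := hij
        have hc0 : c = 0 := by
          rcases lt_trichotomy c 0 with h | h | h
          · push_cast at hc; nlinarith
          · exact h
          · push_cast at hc; nlinarith
        rw [hc0] at hc
        omega
    have h4 : ∀ j : ℕ, w ^ ((j : ℤ) ^ 2) = w ^ (j ^ 2) := fun j => by
      exact_mod_cast zpow_natCast w (j ^ 2)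
    rw [← Finset.sum_congr rfl fun j _ => h4 j, ← h3, Finset.mul_sum]
    refine Finset.sum_congr rfl fun j _ => ?_
    have h5 : ((j : ℤ) + (k + 1)) ^ 2 =
        (((k + 1) ^ 2 + 2 * (j * (j + 1) / 2) : ℕ) : ℤ) + (2 * k + 1 : ℕ) * j := by
      rw [Nat.mul_div_cancel' (Nat.even_mul_succ_self j).two_dvd]
      push_cast
      ring
    rw [h5, zpow_add₀ hw0, zpow_mul, zpow_natCast, zpow_natCast w (2 * k + 1), hprim.pow_eq_one,
      one_zpow, mul_one, pow_add, pow_mul]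
  rw [hshift, h]
  have hs : ∀ i : ℕ, (2 * I * Real.sin (2 * Real.pi * (2 * i + 1) / (2 * k + 1)) : ℂ) =
      w ^ (2 * i + 1) * (1 - (w ^ 2)⁻¹ ^ (2 * i + 1)) := by
    intro i
    have e1 : w ^ (2 * i + 1) = exp (2 * Real.pi * (2 * i + 1) / (2 * k + 1) * I) := by
      rw [hw, unitRoot, ← exp_nat_mul]
      congr 1
      push_cast
      ring
    have e2 : w ^ (2 * i + 1) * (w ^ 2)⁻¹ ^ (2 * i + 1) =
        exp (-(2 * Real.pi * (2 * i + 1) / (2 * k + 1)) * I) := by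
      have e3 : w * (w ^ 2)⁻¹ = w⁻¹ := by field_simp
      rw [neg_mul, exp_neg, ← e1, ← mul_pow, e3, inv_pow]
    rw [mul_sub, e2, mul_one, e1]
    push_cast
    rw [sin]
    ring_nf
    simp only [I_sq]
    ring
  rw [Finset.prod_congr rfl fun i _ => hs i, Finset.prod_mul_distrib, Finset.prod_pow_eq_pow_sum]
  congr 1
  have hodd : ∑ i ∈ Finset.range k, (2 * i + 1) = k ^ 2 := by
    clear * -
    induction k with
    | zero => rfl
    | succ k ih => rw [Finset.sum_range_succ, ih]; ring
  rw [hodd, show (k + 1) ^ 2 = k ^ 2 + (2 * k + 1) by ring, pow_add, hprim.pow_eq_one, mul_one]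

lemma prod_sin (k : ℕ) : ∃ P : ℝ, 0 < P ∧
    ∏ i ∈ Finset.range k, (2 * Real.sin (2 * Real.pi * (2 * i + 1) / (2 * k + 1))) =
      (-1) ^ (k / 2) * P := by
  have hk : k = (k + 1) / 2 + k / 2 := by omega
  have hpi := Real.pi_pos
  have hden : (0 : ℝ) < 2 * k + 1 := by positivity
  refine ⟨(∏ i ∈ Finset.range ((k + 1) / 2),
      (2 * Real.sin (2 * Real.pi * (2 * i + 1) / (2 * k + 1)))) *
    ∏ i ∈ Finset.range (k / 2), -(2 * Real.sin (2 * Real.pi * (2 * ((((k + 1) / 2 + i : ℕ)) : ℝ) + 1) /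
      (2 * k + 1))), mul_pos (Finset.prod_pos fun i hi => ?_) (Finset.prod_pos fun i hi => ?_), ?_⟩
  · rw [Finset.mem_range] at hi
    have hi' : (2 * (2 * i + 1) : ℝ) < 2 * k + 1 := by
      exact_mod_cast (by omega : 2 * (2 * i + 1) < 2 * k + 1)
    refine mul_pos two_pos (Real.sin_pos_of_pos_of_lt_pi (by positivity) ?_)
    rw [div_lt_iff₀ hden]
    nlinarith
  · rw [Finset.mem_range] at hi
    set m := (k + 1) / 2 + i with hm
    have h1 : (2 * k + 1 : ℝ) < 2 * (2 * m + 1) := by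
      exact_mod_cast (by omega : 2 * k + 1 < 2 * (2 * m + 1))
    have h2 : (2 * m + 1 : ℝ) < 2 * k + 1 := by exact_mod_cast (by omega : 2 * m + 1 < 2 * k + 1)
    have h3 : Real.sin (2 * Real.pi * (2 * m + 1) / (2 * k + 1)) =
        Real.sin (2 * Real.pi * (2 * m + 1) / (2 * k + 1) - 2 * Real.pi) := (Real.sin_sub_two_pi _).symm
    rw [h3]
    have h4 : Real.sin (2 * Real.pi * (2 * m + 1) / (2 * k + 1) - 2 * Real.pi) < 0 := by
      refine Real.sin_neg_of_neg_of_neg_pi_lt ?_ ?_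
      · rw [sub_neg, div_lt_iff₀ hden]
        nlinarith
      · rw [neg_lt_sub_iff_lt_add, ← sub_lt_iff_lt_add', lt_div_iff₀ hden]
        nlinarith
    linarith
  · rw [Finset.prod_neg, Finset.card_range]
    conv_lhs => rw [show Finset.range k = Finset.range ((k + 1) / 2 + k / 2) by rw [← hk]]
    rw [Finset.prod_range_add]
    have h2 : (-1 : ℝ) ^ (k / 2) * (-1) ^ (k / 2) = 1 := by rw [← mul_pow]; norm_num
    linear_combination (-(∏ i ∈ Finset.range ((k + 1) / 2),
      (2 * Real.sin (2 * Real.pi * (2 * i + 1) / (2 * k + 1)))) *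
      ∏ i ∈ Finset.range (k / 2), (2 * Real.sin (2 * Real.pi *
        (2 * ((((k + 1) / 2 + i : ℕ)) : ℝ) + 1) / (2 * k + 1)))) * h2

/-- The sign of the quadratic Gauss sum: `1` or `i` according to the class modulo four. -/
noncomputable def gaussUnit (n : ℕ) : ℂ := if n % 4 = 1 then 1 else I

lemma sum_sq_eq_pos (k : ℕ) : ∃ P : ℝ, 0 < P ∧
    ∑ j ∈ Finset.range (2 * k + 1), unitRoot (2 * k + 1) ^ (j ^ 2) = gaussUnit (2 * k + 1) * P := by
  obtain ⟨P, hP, h⟩ := prod_sin k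
  refine ⟨P, hP, ?_⟩
  have h1 : ∀ i : ℕ, (2 * I * Real.sin (2 * Real.pi * (2 * i + 1) / (2 * k + 1)) : ℂ) =
      I * ((2 * Real.sin (2 * Real.pi * (2 * i + 1) / (2 * k + 1)) : ℝ) : ℂ) := fun i => by
    push_cast; ring
  rw [sum_sq_eq_prod, Finset.prod_congr rfl fun i _ => h1 i, Finset.prod_mul_distrib,
    ← ofReal_prod, h, Finset.prod_const, Finset.card_range]
  push_cast
  rw [← mul_assoc]
  congr 1
  have h2 : ∀ l : ℕ, (-1 : ℂ) ^ l * (-1) ^ l = 1 := fun l => by rw [← mul_pow]; norm_num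
  rcases Nat.even_or_odd' k with ⟨l, rfl | rfl⟩
  · rw [gaussUnit, if_pos (by omega), pow_mul, I_sq, Nat.mul_div_cancel_left _ two_pos, h2]
  · rw [gaussUnit, if_neg (by omega), pow_succ, pow_mul, I_sq, show (2 * l + 1) / 2 = l by omega,
      mul_right_comm, h2, one_mul]

/-- The sign of the quadratic Gauss sum of a prime modulus. -/
theorem sum_jacobi_prime {p : ℕ} (hp : p.Prime) (hp2 : p ≠ 2) :
    ∑ r ∈ Finset.range p, (jacobiSym r p : ℂ) * unitRoot p ^ r = gaussUnit p * √(p : ℝ) := by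
  have : Fact p.Prime := ⟨hp⟩
  have hodd : p % 2 = 1 := hp.eq_two_or_odd.resolve_left hp2
  set ψ : AddChar (ZMod p) ℂ := ZMod.stdAddChar with hψ
  have hψv : ∀ r : ℕ, ψ (r : ZMod p) = unitRoot p ^ r := fun r => by
    have := ZMod.stdAddChar_coe (N := p) (r : ℤ)
    rw [Int.cast_natCast] at this
    rw [hψ, this, unitRoot, ← exp_nat_mul]
    congr 1
    push_cast
    ring
  have hsumZ := sum_range_zmod (N := p)
  have hJ : ∀ r : ℕ, (jacobiSym r p : ℂ) = ((quadraticChar (ZMod p) (r : ZMod p) : ℤ) : ℂ) := fun r => by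
    rw [← jacobiSym.legendreSym.to_jacobiSym, legendreSym]
    simp
  have hchar : ringChar (ZMod p) ≠ 2 := by rwa [ZMod.ringChar_zmod_n]
  have hψp : ψ.IsPrimitive := ZMod.isPrimitive_stdAddChar p
  have hψne : ψ ≠ 1 := by
    have := hψp one_ne_zero
    rwa [AddChar.mulShift_one] at this
  have hψ1 : ∑ a, ψ a = 0 := AddChar.sum_eq_zero_of_ne_one hψne
  set G := ∑ a, ((quadraticChar (ZMod p) a : ℤ) : ℂ) * ψ a with hG
  have hLHS : ∑ r ∈ Finset.range p, (jacobiSym r p : ℂ) * unitRoot p ^ r = G := by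
    rw [hG, ← hsumZ]
    exact Finset.sum_congr rfl fun r _ => by rw [hJ, hψv]
  have hsq : ∑ j ∈ Finset.range p, unitRoot p ^ (j ^ 2) = G := by
    have h1 : ∑ j ∈ Finset.range p, unitRoot p ^ (j ^ 2) = ∑ x : ZMod p, ψ (x ^ 2) := by
      rw [← hsumZ (fun x => ψ (x ^ 2))]
      exact Finset.sum_congr rfl fun r _ => by rw [← hψv]; push_cast; rfl
    rw [h1, ← Finset.sum_fiberwise (s := Finset.univ) (g := fun x : ZMod p => x ^ 2)]
    have h2 : ∀ a : ZMod p, ∑ x with x ^ 2 = a, ψ (x ^ 2) =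
        ((quadraticChar (ZMod p) a : ℤ) : ℂ) * ψ a + ψ a := fun a => by
      rw [Finset.sum_congr rfl (g := fun _ => ψ a) fun x hx => by rw [(Finset.mem_filter.1 hx).2],
        Finset.sum_const, nsmul_eq_mul]
      have h3 := quadraticChar_card_sqrts hchar a
      have h4 : ({x : ZMod p | x ^ 2 = a} : Set (ZMod p)).toFinset =
          Finset.univ.filter (fun x => x ^ 2 = a) := by ext; simp
      rw [h4] at h3
      have h5 : ((Finset.univ.filter (fun x : ZMod p => x ^ 2 = a)).card : ℂ) =
        ((quadraticChar (ZMod p) a : ℤ) : ℂ) + 1 := by exact_mod_cast h3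
      rw [h5]; ring
    rw [Finset.sum_congr rfl fun a _ => h2 a, Finset.sum_add_distrib, hψ1, add_zero]
  obtain ⟨k, hk⟩ : ∃ k, p = 2 * k + 1 := ⟨p / 2, by omega⟩
  obtain ⟨P, hP, h⟩ := sum_sq_eq_pos k
  rw [← hk, hsq] at h
  have hnorm : ‖G‖ ^ 2 = p := by
    set χ : MulChar (ZMod p) ℂ := (quadraticChar (ZMod p)).ringHomComp (Int.castRingHom ℂ) with hχ
    have hGχ : G = gaussSum χ ψ := rfl
    have hχ1 : χ ≠ 1 :=
      (MulChar.ringHomComp_ne_one_iff Int.cast_injective).2 (quadraticChar_ne_one hchar)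
    have hχq : χ.IsQuadratic := (quadraticChar_isQuadratic _).comp _
    have h1 : ‖χ (-1)‖ = 1 := by
      have h2 : χ (-1) * χ (-1) = 1 := by rw [← map_mul]; simp
      rcases mul_self_eq_one_iff.1 h2 with h | h <;> rw [h] <;> simp
    rw [← norm_pow, hGχ, gaussSum_sq hχ1 hχq hψp, norm_mul, h1, ZMod.card]
    simp
  rw [hLHS, h]
  congr 2
  rw [h, norm_mul, gaussUnit] at hnorm
  have : ‖(if p % 4 = 1 then 1 else I : ℂ)‖ = 1 := by split_ifs <;> simp
  rw [this, one_mul, norm_real, Real.norm_of_nonneg hP.le] at hnorm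
  rw [← hnorm, Real.sqrt_sq hP.le]

end GaussSign

namespace GaussSign

lemma unitRoot_ne_zero (N : ℕ) : unitRoot N ≠ 0 := exp_ne_zero _

lemma unitRoot_pow_self {N : ℕ} (hN : N ≠ 0) : unitRoot N ^ N = 1 :=
  (isPrimitiveRoot_unitRoot hN).pow_eq_one

lemma unitRoot_zpow_add {N : ℕ} (hN : N ≠ 0) (a c : ℤ) :
    unitRoot N ^ (a + N * c) = unitRoot N ^ a := by
  rw [zpow_add₀ (unitRoot_ne_zero N), zpow_mul, zpow_natCast, unitRoot_pow_self hN, one_zpow, mul_one]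

lemma unitRoot_mul_pow {M N : ℕ} (hN : N ≠ 0) : unitRoot (M * N) ^ N = unitRoot M := by
  rw [unitRoot, unitRoot, ← exp_nat_mul]
  congr 1
  have : (N : ℂ) ≠ 0 := by exact_mod_cast hN
  push_cast
  rw [mul_comm (M : ℂ), ← mul_div_assoc, mul_div_mul_left _ _ this]

lemma unitRoot_mul_pow' {M N : ℕ} (hM : M ≠ 0) : unitRoot (M * N) ^ M = unitRoot N := by
  rw [mul_comm, unitRoot_mul_pow hM]

/-- A completely multiplicative `N`-periodic integer function that is an eigenvector of the
discrete Fourier transform, with eigenvalue `ε √N`. -/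
structure IsGaussEigen (N : ℕ) (f : ℤ → ℤ) (ε : ℂ) : Prop where
  ne_zero : N ≠ 0
  one : f 1 = 1
  mul : ∀ a b, f (a * b) = f a * f b
  periodic : ∀ a, f (a + N) = f a
  sum_eq : ∀ k : ℤ, ∑ r ∈ Finset.range N, (f r : ℂ) * unitRoot N ^ ((r : ℤ) * k) = ε * √(N : ℝ) * f k

namespace IsGaussEigen

variable {M N : ℕ} {f g : ℤ → ℤ} {ε η : ℂ}

lemma add_mul_right (h : IsGaussEigen N f ε) (a c : ℤ) : f (a + N * c) = f a := by
  have := (show Function.Periodic f (N : ℤ) from h.periodic).int_mul c a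
  rwa [mul_comm] at this

/-- The product of two eigenvectors with coprime moduli. -/
lemma prod (hf : IsGaussEigen M f ε) (hg : IsGaussEigen N g η) (hcop : M.Coprime N) :
    IsGaussEigen (M * N) (fun a => f a * g a) (f N * g M * (ε * η)) where
  ne_zero := mul_ne_zero hf.ne_zero hg.ne_zero
  one := by rw [hf.one, hg.one, mul_one]
  mul a b := by rw [hf.mul, hg.mul]; ring
  periodic a := by
    rw [Nat.cast_mul, hf.add_mul_right, mul_comm (M : ℤ), hg.add_mul_right]
  sum_eq k := by
    have hM := hf.ne_zero
    have hN := hg.ne_zero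
    have hMN := mul_ne_zero hM hN
    have hper : ∀ a : ℤ, ((f (a + (M * N : ℕ)) * g (a + (M * N : ℕ)) : ℤ) : ℂ) *
        unitRoot (M * N) ^ ((a + (M * N : ℕ)) * k) =
        ((f a * g a : ℤ) : ℂ) * unitRoot (M * N) ^ (a * k) := fun a => by
      have e1 : (a + (M * N : ℕ)) * k = a * k + (M * N : ℕ) * k := by ring
      rw [e1, unitRoot_zpow_add hMN, Nat.cast_mul, hf.add_mul_right, mul_comm (M : ℤ),
        hg.add_mul_right]
    have h := sum_periodic (g := fun a => ((f a * g a : ℤ) : ℂ) * unitRoot (M * N) ^ (a * k)) hMN hper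
      (Finset.range M ×ˢ Finset.range N) (fun p => (N : ℤ) * p.1 + M * p.2) (by simp) ?_
    · rw [← h, Finset.sum_product]
      have h1 : ∀ a b : ℕ, ((f (N * a + M * b) * g (N * a + M * b) : ℤ) : ℂ) *
          unitRoot (M * N) ^ (((N : ℤ) * a + M * b) * k) =
          (f N * g M) * (((f a : ℂ) * unitRoot M ^ ((a : ℤ) * k)) *
            ((g b : ℂ) * unitRoot N ^ ((b : ℤ) * k))) := fun a b => by
        have e1 : ((N : ℤ) * a + M * b) * k = N * (a * k) + M * (b * k) := by ring
        have e2 : f (N * a + M * b) = f N * f a := by rw [hf.add_mul_right, hf.mul]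
        have e3 : g (N * a + M * b) = g M * g b := by rw [add_comm, hg.add_mul_right, hg.mul]
        rw [e1, zpow_add₀ (unitRoot_ne_zero _), zpow_mul _ (N : ℤ), zpow_mul _ (M : ℤ),
          zpow_natCast (unitRoot (M * N)) N, zpow_natCast (unitRoot (M * N)) M, unitRoot_mul_pow hN, unitRoot_mul_pow' hM, e2, e3]
        push_cast
        ring
      simp only [h1]
      simp only [← Finset.mul_sum, ← Finset.sum_mul]
      rw [hf.sum_eq, hg.sum_eq, Nat.cast_mul, Real.sqrt_mul (Nat.cast_nonneg M)]
      push_cast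
      ring
    · rintro ⟨a, b⟩ h1 ⟨a', b'⟩ h2 hd
      simp only [Finset.mem_product, Finset.mem_range] at h1 h2
      have hcop' : IsCoprime (M : ℤ) (N : ℤ) := Nat.isCoprime_iff_coprime.2 hcop
      have e : (N : ℤ) * a + M * b - (N * a' + M * b') = N * (a - a') + M * (b - b') := by ring
      simp only at hd
      rw [e] at hd
      push_cast at hd
      have d1 : (M : ℤ) ∣ a - a' := by
        have := (dvd_mul_right (M : ℤ) N).trans hd
        rw [dvd_add_left (dvd_mul_right _ _)] at this
        exact hcop'.dvd_of_dvd_mul_left this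
      have d2 : (N : ℤ) ∣ b - b' := by
        have := (dvd_mul_left (N : ℤ) M).trans hd
        rw [dvd_add_right (dvd_mul_right _ _)] at this
        exact hcop'.symm.dvd_of_dvd_mul_left this
      have z1 := Int.eq_zero_of_abs_lt_dvd d1 (by rw [abs_lt]; omega)
      have z2 := Int.eq_zero_of_abs_lt_dvd d2 (by rw [abs_lt]; omega)
      ext <;> simp <;> omega

lemma eigenvalue_congr (hf : IsGaussEigen N f ε) (h : ε = η) : IsGaussEigen N f η := h ▸ hf

lemma map_neg (hf : IsGaussEigen N f 1) (k : ℤ) : f (-k) = f k := by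
  have h1 := hf.sum_eq 1
  have h2 := congrArg (starRingEnd ℂ) h1
  have hc : (starRingEnd ℂ) (unitRoot N) = (unitRoot N)⁻¹ := by
    rw [unitRoot, ← exp_conj, ← exp_neg]
    congr 1
    simp [neg_div, map_ofNat]
  have h3 : (starRingEnd ℂ) (∑ r ∈ Finset.range N, (f r : ℂ) * unitRoot N ^ ((r : ℤ) * 1)) =
      ∑ r ∈ Finset.range N, (f r : ℂ) * unitRoot N ^ ((r : ℤ) * (-1)) := by
    rw [map_sum]
    refine Finset.sum_congr rfl fun r _ => ?_
    rw [map_mul, map_zpow₀, hc, inv_zpow, ← zpow_neg]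
    simp
  rw [h3, hf.sum_eq, hf.one] at h2
  have hN : ((√(N : ℝ) : ℝ) : ℂ) ≠ 0 := by
    have := hf.ne_zero
    have : 0 < √(N : ℝ) := Real.sqrt_pos.2 (by positivity)
    exact_mod_cast this.ne'
  have h4 : (f (-1) : ℂ) = 1 := by
    apply mul_left_cancel₀ hN
    simpa using h2
  have h5 : f (-1) = 1 := by exact_mod_cast h4
  rw [← neg_one_mul, hf.mul, h5, one_mul]

end IsGaussEigen

lemma isGaussEigen_prime {p : ℕ} (hp : p.Prime) (hp2 : p ≠ 2) :
    IsGaussEigen p (fun a => jacobiSym a p) (gaussUnit p) where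
  ne_zero := hp.ne_zero
  one := jacobiSym.one_left p
  mul a b := jacobiSym.mul_left a b p
  periodic a := by
    rw [jacobiSym.mod_left, jacobiSym.mod_left a]; simp
  sum_eq k := by
    have : Fact p.Prime := ⟨hp⟩
    by_cases hk : (p : ℤ) ∣ k
    · have h0 : jacobiSym k p = 0 := by
        rw [← jacobiSym.legendreSym.to_jacobiSym, legendreSym.eq_zero_iff,
          ZMod.intCast_zmod_eq_zero_iff_dvd]
        exact hk
      rw [h0]
      obtain ⟨c, rfl⟩ := hk
      have h1 : ∀ r : ℕ, unitRoot p ^ ((r : ℤ) * (p * c)) = 1 := fun r => by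
        rw [show (r : ℤ) * (p * c) = 0 + p * (r * c) by ring, unitRoot_zpow_add hp.ne_zero, zpow_zero]
      simp only [h1, mul_one]
      have h2 := sum_range_zmod (N := p) (fun a => ((quadraticChar (ZMod p) a : ℤ) : ℂ))
      have h3 : ∑ a, ((quadraticChar (ZMod p) a : ℤ) : ℂ) = 0 := by
        exact_mod_cast quadraticChar_sum_zero (F := ZMod p) (by rwa [ZMod.ringChar_zmod_n])
      rw [h3] at h2
      rw [Int.cast_zero, mul_zero, ← h2]
      refine Finset.sum_congr rfl fun r _ => ?_
      rw [← jacobiSym.legendreSym.to_jacobiSym, legendreSym]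
      simp
    · have hp' : Prime (p : ℤ) := Nat.prime_iff_prime_int.1 hp
      have hk2 : (jacobiSym k p : ℂ) * jacobiSym k p = 1 := by
        have : jacobiSym k p ^ 2 = 1 := by
          refine jacobiSym.sq_one ?_
          rw [← Int.isCoprime_iff_gcd_eq_one]
          exact ((hp'.coprime_iff_not_dvd).2 hk).symm
        rw [sq] at this
        exact_mod_cast this
      have h := sum_periodic (N := p) (g := fun a => (jacobiSym a p : ℂ) * unitRoot p ^ a) hp.ne_zero
        (fun a => by
          have h1 := unitRoot_zpow_add hp.ne_zero a 1
          rw [mul_one] at h1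
          have h2 : jacobiSym (a + p) p = jacobiSym a p := by
            rw [jacobiSym.mod_left, jacobiSym.mod_left a]; simp
          rw [h1, h2])
        (Finset.range p) (fun r => (r : ℤ) * k) (Finset.card_range _) (fun i hi j hj hij => by
          rw [Finset.mem_range] at hi hj
          rw [← sub_mul] at hij
          have := Int.eq_zero_of_abs_lt_dvd ((hp'.dvd_or_dvd hij).resolve_right hk)
            (by rw [abs_lt]; omega)
          omega)
      simp only [zpow_natCast] at h
      rw [sum_jacobi_prime hp hp2] at h
      rw [← h, Finset.sum_mul]
      refine Finset.sum_congr rfl fun r _ => ?_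
      rw [jacobiSym.mul_left]
      push_cast
      linear_combination (-(jacobiSym r p : ℂ) * unitRoot p ^ ((r : ℤ) * k)) * hk2

end GaussSign

namespace GaussSign

lemma jacobiSym_natCast_reciprocity {m n : ℕ} (hm : Odd m) (hn : Odd n) :
    jacobiSym m n = (if m % 4 = 3 then ZMod.χ₄ n else 1) * jacobiSym n m := by
  rcases Nat.odd_mod_four_iff.1 (Nat.odd_iff.1 hm) with h | h
  · rw [if_neg (by omega), one_mul, jacobiSym.quadratic_reciprocity_one_mod_four h hn]
  · rw [if_pos h]
    rcases Nat.odd_mod_four_iff.1 (Nat.odd_iff.1 hn) with h' | h'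
    · rw [ZMod.χ₄_nat_one_mod_four h', one_mul, jacobiSym.quadratic_reciprocity_one_mod_four' hm h']
    · rw [ZMod.χ₄_nat_three_mod_four h', jacobiSym.quadratic_reciprocity_three_mod_four h h']
      ring

lemma jacobiSym_mul_self {a : ℤ} {n : ℕ} (h : IsCoprime a n) : jacobiSym a n * jacobiSym a n = 1 := by
  rw [← sq]
  exact jacobiSym.sq_one (Int.isCoprime_iff_gcd_eq_one.1 h)

lemma isGaussEigen_one : IsGaussEigen 1 (fun a => jacobiSym a 1) (gaussUnit 1) where
  ne_zero := one_ne_zero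
  one := by simp
  mul a b := by simp
  periodic a := by simp
  sum_eq k := by simp [gaussUnit]

lemma isGaussEigen_jacobi (n : ℕ) (hn : Squarefree n) (hodd : Odd n) :
    IsGaussEigen n (fun a => jacobiSym a n) (gaussUnit n) := by
  induction n using Nat.recOnMul with
  | zero => simp at hodd
  | one => exact isGaussEigen_one
  | prime p hp => exact isGaussEigen_prime hp (by rintro rfl; exact absurd hodd (by decide))
  | mul a b iha ihb =>
    obtain ⟨hcop, ha, hb⟩ := Nat.squarefree_mul_iff.1 hn
    obtain ⟨oa, ob⟩ := Nat.odd_mul.1 hodd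
    have h := (iha ha oa).prod (ihb hb ob) hcop
    have hne : a ≠ 0 ∧ b ≠ 0 := ⟨by rintro rfl; simp at oa, by rintro rfl; simp at ob⟩
    have : NeZero a := ⟨hne.1⟩
    have : NeZero b := ⟨hne.2⟩
    simp only [← jacobiSym.mul_right] at h
    refine h.eigenvalue_congr ?_
    have hab : jacobiSym (b : ℤ) a * jacobiSym (a : ℤ) b =
        if a % 4 = 3 then ZMod.χ₄ b else 1 := by
      rw [jacobiSym_natCast_reciprocity oa ob, mul_left_comm,
        jacobiSym_mul_self (Nat.isCoprime_iff_coprime.2 hcop.symm), mul_one]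
    have hab' : (jacobiSym (b : ℤ) a : ℂ) * jacobiSym (a : ℤ) b =
        ((if a % 4 = 3 then ZMod.χ₄ b else 1 : ℤ) : ℂ) := by exact_mod_cast hab
    rw [hab']
    rcases Nat.odd_mod_four_iff.1 (Nat.odd_iff.1 ob) with h2 | h2
    · rw [ZMod.χ₄_nat_one_mod_four h2]
      simp [gaussUnit, h2, Nat.mul_mod]
    · rw [ZMod.χ₄_nat_three_mod_four h2]
      rcases Nat.odd_mod_four_iff.1 (Nat.odd_iff.1 oa) with h1 | h1 <;>
      simp [gaussUnit, h1, h2, Nat.mul_mod]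

lemma exists_residue {N : ℕ} (hN : N ≠ 0) (k : ℤ) : ∃ r : ℕ, r < N ∧ ∃ c : ℤ, k = r + N * c := by
  have hN' : (0 : ℤ) < N := by positivity
  refine ⟨(k % N).toNat, ?_, k / N, ?_⟩
  · have := Int.emod_lt_of_pos k hN'
    have := Int.emod_nonneg k hN'.ne'
    omega
  · rw [Int.toNat_of_nonneg (Int.emod_nonneg k hN'.ne'), Int.emod_add_mul_ediv]

lemma unitRoot_four : unitRoot 4 = I := by
  rw [unitRoot, show 2 * (Real.pi : ℂ) * I / (4 : ℕ) = Real.pi / 2 * I by push_cast; ring]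
  exact exp_pi_div_two_mul_I

lemma unitRoot_eight : unitRoot 8 = (√2 : ℝ) / 2 * (1 + I) := by
  rw [unitRoot, show 2 * (Real.pi : ℂ) * I / (8 : ℕ) = ((Real.pi / 4 : ℝ) : ℂ) * I by
    push_cast; ring, exp_mul_I, ← ofReal_cos, ← ofReal_sin, Real.cos_pi_div_four,
    Real.sin_pi_div_four]
  push_cast
  ring

/-- An integer-valued character is an eigenvector as soon as the defining identity holds on a
set of residues. -/
lemma isGaussEigen_mulChar {N : ℕ} [NeZero N] (ψ : MulChar (ZMod N) ℤ) (ε : ℂ)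
    (h : ∀ k < N, ∑ r ∈ Finset.range N, (ψ r : ℂ) * unitRoot N ^ (r * k) = ε * √(N : ℝ) * ψ k) :
    IsGaussEigen N (fun a => ψ a) ε where
  ne_zero := NeZero.ne N
  one := by simp
  mul a b := by simp
  periodic a := by simp
  sum_eq k := by
    obtain ⟨r, hr, c, rfl⟩ := exists_residue (NeZero.ne N) k
    have h1 : ∀ j : ℕ, unitRoot N ^ ((j : ℤ) * (r + N * c)) = unitRoot N ^ (j * r) := fun j => by
      rw [show (j : ℤ) * (r + N * c) = ((j * r : ℕ) : ℤ) + N * (j * c) by push_cast; ring,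
        unitRoot_zpow_add (NeZero.ne N), zpow_natCast]
    simp only [h1]
    simpa using h r hr

lemma isGaussEigen_χ₄ : IsGaussEigen 4 (fun a => ZMod.χ₄ a) I := by
  refine isGaussEigen_mulChar _ _ fun k hk => ?_
  have h4 : √((4 : ℕ) : ℝ) = 2 := by
    rw [show ((4 : ℕ) : ℝ) = 2 ^ 2 by norm_num, Real.sqrt_sq (by norm_num)]
  have h0 : ZMod.χ₄ 0 = 0 := rfl
  have h2 : ZMod.χ₄ 2 = 0 := rfl
  have h3 : ZMod.χ₄ 3 = -1 := rfl
  have hI := I_sq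
  rw [h4, unitRoot_four]
  interval_cases k <;> simp [Finset.sum_range_succ, h0, h2, h3] <;> grind

lemma unitRoot_eight_sq : unitRoot 8 ^ 2 = I := by
  have h := unitRoot_mul_pow (M := 4) (N := 2) (by norm_num)
  rw [show 4 * 2 = 8 from rfl] at h
  rw [h, unitRoot_four]

lemma sqrt_eight : √((8 : ℕ) : ℝ) = 2 * √2 := by
  rw [show ((8 : ℕ) : ℝ) = 2 ^ 2 * 2 by norm_num, Real.sqrt_mul (by norm_num),
    Real.sqrt_sq (by norm_num)]

lemma isGaussEigen_χ₈ : IsGaussEigen 8 (fun a => ZMod.χ₈ a) 1 := by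
  refine isGaussEigen_mulChar _ _ fun k hk => ?_
  have h0 : ZMod.χ₈ 0 = 0 := rfl
  have h2 : ZMod.χ₈ 2 = 0 := rfl
  have h3 : ZMod.χ₈ 3 = -1 := rfl
  have h4 : ZMod.χ₈ 4 = 0 := rfl
  have h5 : ZMod.χ₈ 5 = -1 := rfl
  have h6 : ZMod.χ₈ 6 = 0 := rfl
  have h7 : ZMod.χ₈ 7 = 1 := rfl
  have hz := unitRoot_eight
  have hz2 := unitRoot_eight_sq
  have hI := I_sq
  rw [sqrt_eight]
  generalize unitRoot 8 = z at *
  interval_cases k <;> simp [Finset.sum_range_succ, h0, h2, h3, h4, h5, h6, h7] <;> grind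

lemma isGaussEigen_χ₈' : IsGaussEigen 8 (fun a => ZMod.χ₈' a) I := by
  refine isGaussEigen_mulChar _ _ fun k hk => ?_
  have h0 : ZMod.χ₈' 0 = 0 := rfl
  have h2 : ZMod.χ₈' 2 = 0 := rfl
  have h3 : ZMod.χ₈' 3 = 1 := rfl
  have h4 : ZMod.χ₈' 4 = 0 := rfl
  have h5 : ZMod.χ₈' 5 = -1 := rfl
  have h6 : ZMod.χ₈' 6 = 0 := rfl
  have h7 : ZMod.χ₈' 7 = -1 := rfl
  have hz := unitRoot_eight
  have hz2 := unitRoot_eight_sq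
  have hI := I_sq
  rw [sqrt_eight]
  generalize unitRoot 8 = z at *
  interval_cases k <;> simp [Finset.sum_range_succ, h0, h2, h3, h4, h5, h6, h7] <;> grind

end GaussSign

namespace GaussSign

variable {D₀ : ℤ}

lemma isCoprime_two_natCast {n : ℕ} (hn : Odd n) : IsCoprime (2 : ℤ) n := by
  have := Nat.coprime_two_left.2 hn
  exact_mod_cast Nat.isCoprime_iff_coprime.2 this

lemma jacobiSym_two_sq {n : ℕ} (hn : Odd n) : jacobiSym 2 n * jacobiSym 2 n = 1 :=
  jacobiSym_mul_self (isCoprime_two_natCast hn)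

lemma jacobiSym_four {n : ℕ} (hn : Odd n) : jacobiSym 4 n = 1 := by
  rw [show (4 : ℤ) = 2 * 2 by norm_num, jacobiSym.mul_left, jacobiSym_two_sq hn]

lemma jacobiSym_eight {n : ℕ} (hn : Odd n) : jacobiSym 8 n = ZMod.χ₈ n := by
  rw [show (8 : ℤ) = 4 * 2 by norm_num, jacobiSym.mul_left, jacobiSym_four hn, one_mul,
    jacobiSym.at_two hn]

lemma χ₈_sq {n : ℕ} (hn : Odd n) : ZMod.χ₈ n * ZMod.χ₈ n = 1 := by
  rw [← jacobiSym.at_two hn, jacobiSym_two_sq hn]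

/-- A positive fundamental discriminant carries an eigenvector of eigenvalue one that agrees with
the Kronecker symbol at all primes. -/
lemma exists_isGaussEigen (hf : IsFundamentalDiscriminant D₀) (h0 : 0 < D₀) :
    ∃ g : ℤ → ℤ, IsGaussEigen D₀.natAbs g 1 ∧ ∀ p : ℕ, p.Prime → g p = kroneckerSym D₀ p := by
  obtain ⟨n, rfl⟩ := Int.eq_ofNat_of_zero_le h0.le
  rw [Int.natAbs_natCast]
  rcases hf with ⟨h4, hsq⟩ | ⟨h4, hsq, hm⟩
  · have hn4 : n % 4 = 1 := by omega
    have hodd : Odd n := Nat.odd_iff.2 (by omega)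
    refine ⟨_, (isGaussEigen_jacobi n (Int.squarefree_natCast.1 hsq) hodd).eigenvalue_congr
      (by simp [gaussUnit, hn4]), fun p hp => ?_⟩
    rcases hp.eq_two_or_odd' with rfl | hp2
    · rw [RootCount.kroneckerSym_two, Nat.cast_ofNat, jacobiSym.at_two hodd,
        ZMod.χ₈_nat_eq_if_mod_eight]
      grind
    · rw [RootCount.kroneckerSym_odd_prime hp (by rintro rfl; exact absurd hp2 (by decide)),
        jacobiSym_natCast_reciprocity hodd hp2, if_neg (by omega), one_mul]
  · obtain ⟨m, rfl⟩ : ∃ m, n = 4 * m := ⟨n / 4, by omega⟩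
    rw [show ((4 * m : ℕ) : ℤ) / 4 = m by omega] at hsq hm
    have hsq' : Squarefree m := Int.squarefree_natCast.1 hsq
    rcases hm with hm | hm
    · obtain ⟨l, rfl⟩ : ∃ l, m = 2 * l := ⟨m / 2, by omega⟩
      have hl : Odd l := Nat.odd_iff.2 (by omega)
      have hsl : Squarefree l := hsq'.squarefree_of_dvd (dvd_mul_left _ _)
      have hc : Nat.Coprime 8 l := by
        rw [show 8 = 2 ^ 3 by norm_num]
        exact (Nat.coprime_two_left.2 hl).pow_left 3
      have hJ := isGaussEigen_jacobi l hsl hl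
      have h8 : (ZMod.χ₈ l : ℂ) * ZMod.χ₈ l = 1 := by exact_mod_cast χ₈_sq hl
      have hkr : ∀ p : ℕ, p.Prime → Odd p → kroneckerSym ((4 * (2 * l) : ℕ) : ℤ) p =
          ZMod.χ₈ p * ((if l % 4 = 3 then ZMod.χ₄ p else 1) * jacobiSym p l) := fun p hp hp2 => by
        rw [RootCount.kroneckerSym_odd_prime hp (by rintro rfl; exact absurd hp2 (by decide)),
          show ((4 * (2 * l) : ℕ) : ℤ) = 8 * l by push_cast; ring, jacobiSym.mul_left,
          jacobiSym_eight hp2, jacobiSym_natCast_reciprocity hl hp2]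
      have hk2 : kroneckerSym ((4 * (2 * l) : ℕ) : ℤ) 2 = 0 := by
        rw [RootCount.kroneckerSym_two, if_pos (by omega)]
      rw [show 4 * (2 * l) = 8 * l by ring] at hkr hk2 ⊢
      rcases Nat.odd_mod_four_iff.1 (Nat.odd_iff.1 hl) with h | h
      · refine ⟨_, (isGaussEigen_χ₈.prod hJ hc).eigenvalue_congr ?_, fun p hp => ?_⟩
        · simpa [gaussUnit, h, jacobiSym_eight hl] using h8
        · rcases hp.eq_two_or_odd' with rfl | hp2
          · rw [hk2]
            exact zero_mul _
          · rw [hkr p hp hp2, if_neg (by omega), one_mul, Int.cast_natCast]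
      · refine ⟨_, (isGaussEigen_χ₈'.prod hJ hc).eigenvalue_congr ?_, fun p hp => ?_⟩
        · have h8' : ZMod.χ₈' l = - ZMod.χ₈ l := by
            have := ZMod.χ₈'_int_eq_χ₄_mul_χ₈ l
            rw [ZMod.χ₄_int_three_mod_four (by omega)] at this
            simpa using this
          simp only [gaussUnit, h, Int.cast_natCast, h8', Nat.cast_ofNat, jacobiSym_eight hl]
          push_cast
          linear_combination (-I * I) * h8 - I_sq
        · rcases hp.eq_two_or_odd' with rfl | hp2
          · rw [hk2]
            exact zero_mul _
          · rw [hkr p hp hp2, if_pos h, ZMod.χ₈'_int_eq_χ₄_mul_χ₈, Int.cast_natCast,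
              Int.cast_natCast]
            ring
    · have hm4 : m % 4 = 3 := by omega
      have hm2 : Odd m := Nat.odd_iff.2 (by omega)
      have hc : Nat.Coprime 4 m := by
        rw [show 4 = 2 ^ 2 by norm_num]
        exact (Nat.coprime_two_left.2 hm2).pow_left 2
      refine ⟨_, (isGaussEigen_χ₄.prod (isGaussEigen_jacobi m hsq' hm2) hc).eigenvalue_congr ?_,
        fun p hp => ?_⟩
      · simp [gaussUnit, hm4, jacobiSym_four hm2, ZMod.χ₄_nat_three_mod_four hm4]
      · rcases hp.eq_two_or_odd' with rfl | hp2
        · rw [RootCount.kroneckerSym_two, if_pos (by omega)]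
          exact zero_mul _
        · rw [RootCount.kroneckerSym_odd_prime hp (by rintro rfl; exact absurd hp2 (by decide)),
            Nat.cast_mul, jacobiSym.mul_left, Nat.cast_ofNat, jacobiSym_four hp2,
            jacobiSym_natCast_reciprocity hm2 hp2, if_pos hm4, one_mul, Int.cast_natCast]

/-- A Dirichlet character with the values of the Kronecker symbol is given by an eigenvector of
eigenvalue one. -/
lemma exists_isGaussEigen_char (hf : IsFundamentalDiscriminant D₀) (h0 : 0 < D₀)
    [NeZero D₀.natAbs] (χ : DirichletCharacter ℂ D₀.natAbs)
    (hχ : ∀ n : ℕ, χ (n : ZMod D₀.natAbs) = kroneckerSym D₀ n) :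
    ∃ g : ℤ → ℤ, IsGaussEigen D₀.natAbs g 1 ∧ ∀ n : ℕ, χ (n : ZMod D₀.natAbs) = g n := by
  obtain ⟨g, hg, hp⟩ := exists_isGaussEigen hf h0
  refine ⟨g, hg, fun n => ?_⟩
  induction n using Nat.recOnMul with
  | zero =>
    rcases eq_or_ne D₀.natAbs 1 with h1 | h1
    · have hg1 := hg.periodic 0
      rw [h1, Nat.cast_one, zero_add, hg.one] at hg1
      have : Subsingleton (ZMod D₀.natAbs) := by
        rw [h1]; exact inferInstanceAs (Subsingleton (Fin 1))
      rw [Nat.cast_zero, Subsingleton.elim (0 : ZMod D₀.natAbs) 1, Nat.cast_zero, ← hg1, map_one,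
        Int.cast_one]
    · have hq := Nat.minFac_prime h1
      have hg0 : g 0 = 0 := by
        have hgq : (g (D₀.natAbs.minFac) : ℂ) = 0 := by
          rw [hp _ hq, ← hχ]
          refine χ.map_nonunit fun hu => ?_
          rw [ZMod.isUnit_iff_coprime] at hu
          exact h1 (Nat.minFac_eq_one_iff.1 (Nat.eq_one_of_dvd_coprimes hu dvd_rfl (Nat.minFac_dvd _)))
        have := hg.mul 0 (D₀.natAbs.minFac)
        rw [zero_mul, (by exact_mod_cast hgq : g (D₀.natAbs.minFac) = 0), mul_zero] at this
        exact this
      have hz : ¬ IsUnit ((0 : ℕ) : ZMod D₀.natAbs) := by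
        rw [ZMod.isUnit_iff_coprime, Nat.coprime_zero_left]
        exact h1
      rw [χ.map_nonunit hz, Nat.cast_zero, hg0, Int.cast_zero]
  | one => rw [Nat.cast_one, map_one, Nat.cast_one, hg.one, Int.cast_one]
  | prime p h => rw [hχ, hp p h]
  | mul a b ha hb => rw [Nat.cast_mul, map_mul, ha, hb, Nat.cast_mul, hg.mul, Int.cast_mul]

open scoped ZMod in
lemma dft_char {N : ℕ} [NeZero N] {g : ℤ → ℤ} (hg : IsGaussEigen N g 1) {χ : DirichletCharacter ℂ N}
    (h : ∀ n : ℕ, χ (n : ZMod N) = g n) : 𝓕 (χ : ZMod N → ℂ) = fun k => √(N : ℝ) * χ k := by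
  funext k
  rw [ZMod.dft_apply, ← sum_range_zmod (N := N)]
  have hk : χ k = g (k.val : ℤ) := by rw [← h, ZMod.natCast_zmod_val]
  rw [hk, ← hg.map_neg]
  have := hg.sum_eq (-(k.val : ℤ))
  rw [one_mul] at this
  rw [← this]
  refine Finset.sum_congr rfl fun r _ => ?_
  have hr : -((r : ZMod N) * k) = (((r : ℤ) * (-(k.val : ℤ)) : ℤ) : ZMod N) := by
    push_cast
    rw [ZMod.natCast_zmod_val]
    ring
  rw [hr, ZMod.stdAddChar_coe, h, smul_eq_mul, mul_comm, unitRoot, ← exp_int_mul]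
  congr 2
  push_cast
  ring

lemma char_neg {N : ℕ} [NeZero N] {g : ℤ → ℤ} (hg : IsGaussEigen N g 1) {χ : DirichletCharacter ℂ N}
    (h : ∀ n : ℕ, χ (n : ZMod N) = g n) (k : ZMod N) : χ (-k) = χ k := by
  have h1 : χ (-1) = 1 := by
    have e : (-1 : ZMod N) = ((N - 1 : ℕ) : ZMod N) := by
      rw [Nat.cast_sub (NeZero.one_le)]
      simp
    have e2 : ((N - 1 : ℕ) : ℤ) = -1 + N := by
      rw [Nat.cast_sub (NeZero.one_le)]
      push_cast
      ring
    rw [e, h, e2, hg.periodic, hg.map_neg, hg.one, Int.cast_one]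
  rw [← neg_one_mul, map_mul, h1, one_mul]

lemma LFunction_neg_one {N : ℕ} [NeZero N] {g : ℤ → ℤ} (hg : IsGaussEigen N g 1)
    {χ : DirichletCharacter ℂ N} (h : ∀ n : ℕ, χ (n : ZMod N) = g n) :
    DirichletCharacter.LFunction χ (-1) =
      -(N * √(N : ℝ)) / (2 * Real.pi ^ 2) * DirichletCharacter.LFunction χ 2 := by
  have h1 := ZMod.LFunction_one_sub (χ : ZMod N → ℂ) (s := 2)
    (fun n hn => by
      have : ((2 + n : ℕ) : ℂ) = 0 := by push_cast; rw [hn]; ring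
      norm_cast at this
      omega) (Or.inr (by norm_num))
  have h2 : (fun x => χ (-x)) = (χ : ZMod N → ℂ) := funext fun k => char_neg hg h k
  rw [h2, dft_char hg h, show (1 : ℂ) - 2 = -1 by norm_num] at h1
  rw [DirichletCharacter.LFunction, h1]
  have h3 : ZMod.LFunction (fun k => √(N : ℝ) * χ k) 2 = √(N : ℝ) * ZMod.LFunction (χ : ZMod N → ℂ) 2 := by
    simp only [ZMod.LFunction, Finset.mul_sum]
    refine Finset.sum_congr rfl fun k _ => ?_
    ring
  have h4 : cexp (Real.pi * I * 2 / 2) = -1 := by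
    rw [mul_div_assoc, div_self two_ne_zero, mul_one, exp_pi_mul_I]
  have h5 : cexp (-Real.pi * I * 2 / 2) = -1 := by
    rw [mul_div_assoc, div_self two_ne_zero, mul_one, neg_mul, exp_neg, exp_pi_mul_I]
    norm_num
  have h6 : (N : ℂ) ^ ((2 : ℂ) - 1) = N := by
    rw [show (2 : ℂ) - 1 = 1 by norm_num, cpow_one]
  have h7 : (2 * (Real.pi : ℂ)) ^ (-2 : ℂ) = ((2 * (Real.pi : ℂ)) ^ 2)⁻¹ := by
    rw [cpow_neg, cpow_ofNat]
  have h8 : Gamma 2 = 1 := by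
    rw [show (2 : ℂ) = (1 : ℕ) + 1 by norm_num, Gamma_nat_eq_factorial]
    simp
  rw [h3, h4, h5, h6, h7, h8, DirichletCharacter.LFunction]
  have : (Real.pi : ℂ) ≠ 0 := by exact_mod_cast Real.pi_ne_zero
  field_simp
  ring

end GaussSign

namespace DiscriminantSum

open ClassNumberRelation ZagierSum

variable {D : ℤ}

/-- The integers `x ≡ D (mod 2)` with `x² < D`. -/
noncomputable def middleCoeffs (D : ℤ) : Finset ℤ :=
  (Finset.Icc (-D) D).filter fun x => x % 2 = D % 2 ∧ x ^ 2 < D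

lemma mem_middleCoeffs {x : ℤ} : x ∈ middleCoeffs D ↔ x % 2 = D % 2 ∧ x ^ 2 < D := by
  simp only [middleCoeffs, Finset.mem_filter, Finset.mem_Icc, and_iff_right_iff_imp]
  rintro ⟨-, h⟩
  constructor <;> nlinarith [sq_nonneg (x - 1), sq_nonneg (x + 1)]

lemma four_dvd_sub_sq (hD : D % 4 = 0 ∨ D % 4 = 1) {x : ℤ} (hx : x % 2 = D % 2) : (4 : ℤ) ∣ D - x ^ 2 := by
  rcases Int.even_or_odd' x with ⟨y, rfl | rfl⟩
  · have : (2 * y) ^ 2 = 4 * y ^ 2 := by ring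
    omega
  · have : (2 * y + 1) ^ 2 = 4 * (y ^ 2 + y) + 1 := by ring
    omega

lemma sum_indefForms (hD : D % 4 = 0 ∨ D % 4 = 1) (φ : ℤ × ℤ × ℤ → ℤ) :
    ∑ Q ∈ indefForms D, φ Q = ∑ x ∈ middleCoeffs D,
      ∑ B ∈ (Finset.Icc 1 ((D - x ^ 2) / 4)).filter (fun B => B ∣ (D - x ^ 2) / 4),
        φ (-((D - x ^ 2) / 4 / B), x, B) := by
  rw [Finset.sum_sigma']
  refine Finset.sum_bij' (fun Q _ => ⟨Q.2.1, Q.2.2⟩)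
    (fun s _ => (-((D - s.1 ^ 2) / 4 / s.2), s.1, s.2)) ?_ ?_ ?_ ?_ ?_
  · rintro ⟨a, b, c⟩ hQ
    obtain ⟨h1, h2, h3⟩ := mem_indefForms.1 hQ
    simp only at h1 h2 h3
    have hac : a * c < 0 := mul_neg_of_neg_of_pos h2 h3
    have hm : (D - b ^ 2) / 4 = -a * c := by
      rw [show D - b ^ 2 = (-a * c) * 4 by rw [← h1]; ring]
      exact Int.mul_ediv_cancel _ (by norm_num)
    simp only [Finset.mem_sigma, mem_middleCoeffs, Finset.mem_filter, Finset.mem_Icc, hm]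
    refine ⟨⟨?_, by linarith⟩, ⟨by omega, by nlinarith⟩, dvd_mul_left _ _⟩
    rw [← h1, mul_assoc, sq, Int.sub_emod, Int.mul_emod b b, Int.mul_emod 4]
    rcases Int.emod_two_eq_zero_or_one b with h | h <;> simp [h]
  · rintro ⟨x, B⟩ hs
    simp only [Finset.mem_sigma, mem_middleCoeffs, Finset.mem_filter, Finset.mem_Icc] at hs
    obtain ⟨⟨hx, hlt⟩, ⟨hB, -⟩, j, hj⟩ := hs
    have h4 := Int.mul_ediv_cancel' (four_dvd_sub_sq hD hx)
    rw [mem_indefForms]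
    simp only
    rw [hj, Int.mul_ediv_cancel_left _ (by omega)]
    rw [hj] at h4
    refine ⟨by linarith, ?_, by omega⟩
    have : 0 < B * j := by linarith
    have := pos_of_mul_pos_right this (by omega)
    omega
  · rintro ⟨a, b, c⟩ hQ
    obtain ⟨h1, h2, h3⟩ := mem_indefForms.1 hQ
    simp only at h1 h2 h3
    have hm : (D - b ^ 2) / 4 = -a * c := by
      rw [show D - b ^ 2 = (-a * c) * 4 by rw [← h1]; ring]
      exact Int.mul_ediv_cancel _ (by norm_num)
    simp only [hm, Int.mul_ediv_cancel _ h3.ne', neg_neg]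
  · rintro ⟨x, B⟩ -
    rfl
  · rintro ⟨a, b, c⟩ hQ
    obtain ⟨h1, h2, h3⟩ := mem_indefForms.1 hQ
    simp only at h1 h2 h3
    have hm : (D - b ^ 2) / 4 = -a * c := by
      rw [show D - b ^ 2 = (-a * c) * 4 by rw [← h1]; ring]
      exact Int.mul_ediv_cancel _ (by norm_num)
    simp only [hm, Int.mul_ediv_cancel _ h3.ne', neg_neg]

lemma sum_hurwitzH_row (hD : D % 4 = 0 ∨ D % 4 = 1) {x : ℤ} (hx : x ∈ middleCoeffs D) :
    ∑ y ∈ Finset.Icc (-D) D, hurwitzH (D - x ^ 2 - y ^ 2) =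
      ((∑ B ∈ (Finset.Icc 1 ((D - x ^ 2) / 4)).filter (fun B => B ∣ (D - x ^ 2) / 4),
        (B + if 0 < -((D - x ^ 2) / 4 / B) + B then -((D - x ^ 2) / 4 / B) + B else 0) : ℤ) : ℝ) := by
  obtain ⟨hx2, hlt⟩ := mem_middleCoeffs.1 hx
  obtain ⟨m, hm⟩ := four_dvd_sub_sq hD hx2
  have hm' : (D - x ^ 2) / 4 = m := by omega
  have hm1 : 1 ≤ m := by omega
  rw [hm', Finset.sum_add_distrib]
  have h1 : ∑ B ∈ (Finset.Icc 1 m).filter (fun B => B ∣ m),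
      (if 0 < -(m / B) + B then -(m / B) + B else 0) =
      ∑ B ∈ (Finset.Icc 1 m).filter (fun B => B ∣ m ∧ m < B ^ 2), (B - m / B) := by
    rw [← Finset.filter_filter, Finset.sum_filter (fun B => m < B ^ 2)]
    refine Finset.sum_congr rfl fun B hB => ?_
    rw [Finset.mem_filter, Finset.mem_Icc] at hB
    obtain ⟨⟨hB1, -⟩, j, rfl⟩ := hB
    rw [Int.mul_ediv_cancel_left _ (by omega)]
    have : 0 < -j + B ↔ B * j < B ^ 2 := by
      rw [sq, mul_lt_mul_iff_right₀ (by omega)]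
      omega
    rw [if_congr this rfl rfl, neg_add_eq_sub]
  rw [h1, ← class_number_relation hm1, hm]
  have hsub : ∀ y : ℤ, y ^ 2 ≤ 4 * m → y ∈ Finset.Icc (-D) D ∧ y ∈ Finset.Icc (-(2 * m)) (2 * m) := by
    intro y hy
    simp only [Finset.mem_Icc]
    have : y ^ 2 ≤ D := by nlinarith [sq_nonneg x]
    refine ⟨⟨?_, ?_⟩, ?_, ?_⟩ <;> nlinarith [sq_nonneg (y - 1), sq_nonneg (y + 1)]
  have hz : ∀ y : ℤ, ¬ y ^ 2 ≤ 4 * m → hurwitzH (4 * m - y ^ 2) = 0 := fun y hy =>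
    hurwitzH_neg (by omega)
  rw [← Finset.sum_filter_of_ne (s := Finset.Icc (-D) D) (p := fun y => y ^ 2 ≤ 4 * m)
      (fun y _ h => by_contra fun h' => h (hz y h')),
    ← Finset.sum_filter_of_ne (s := Finset.Icc (-(2 * m)) (2 * m)) (p := fun y => y ^ 2 ≤ 4 * m)
      (fun y _ h => by_contra fun h' => h (hz y h'))]
  refine Finset.sum_congr ?_ fun _ _ => rfl
  ext y
  simp only [Finset.mem_filter]
  exact ⟨fun h => ⟨(hsub y h.2).2, h.2⟩, fun h => ⟨(hsub y h.2).1, h.2⟩⟩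

lemma sum_hurwitzH_row_eq_sq {x : ℤ} (hD : 0 < D) (hx : x ^ 2 = D) :
    ∑ y ∈ Finset.Icc (-D) D, hurwitzH (D - x ^ 2 - y ^ 2) = -(1 / 12) := by
  rw [Finset.sum_eq_single 0]
  · simp [hx, hurwitzH]
  · intro y _ hy
    refine hurwitzH_neg ?_
    have : 0 < y ^ 2 := by positivity
    omega
  · intro h
    exact absurd (Finset.mem_Icc.2 ⟨by omega, hD.le⟩) h

lemma sum_hurwitzH_row_of_lt {x : ℤ} (hx : D < x ^ 2) :
    ∑ y ∈ Finset.Icc (-D) D, hurwitzH (D - x ^ 2 - y ^ 2) = 0 :=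
  Finset.sum_eq_zero fun y _ => hurwitzH_neg (by nlinarith [sq_nonneg y])

lemma card_square_roots (hD : 0 < D) {k : ℕ} {κ : ℝ} (h : IsSquareData D k κ) :
    (((Finset.Icc (-D) D).filter fun x => x % 2 = D % 2 ∧ x ^ 2 = D).card : ℝ) = 2 * κ := by
  obtain ⟨hk, ⟨rfl, hkD⟩ | ⟨rfl, hno⟩⟩ := h
  · have : ((Finset.Icc (-D) D).filter fun x => x % 2 = D % 2 ∧ x ^ 2 = D) = {(k : ℤ), -(k : ℤ)} := by
      ext x
      simp only [Finset.mem_filter, Finset.mem_Icc, Finset.mem_insert, Finset.mem_singleton]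
      rw [← sq_eq_sq_iff_eq_or_eq_neg, hkD]
      refine ⟨fun h => h.2.2, fun h => ⟨?_, ?_, h⟩⟩
      · constructor <;> nlinarith [sq_nonneg (x - 1), sq_nonneg (x + 1)]
      · rw [← h, sq, Int.mul_emod]
        rcases Int.emod_two_eq_zero_or_one x with h | h <;> simp [h]
    rw [this, Finset.card_pair (by omega)]
    norm_num
  · rw [Finset.filter_false_of_mem fun x _ hx => hno ⟨x, hx.2⟩]
    simp

lemma sum_hurwitzH (hD : 0 < D) (hD4 : D % 4 = 0 ∨ D % 4 = 1) {k : ℕ} {κ : ℝ}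
    (h : IsSquareData D k κ) :
    ∑ x ∈ (Finset.Icc (-D) D).filter (fun x => x % 2 = D % 2),
      ∑ y ∈ Finset.Icc (-D) D, hurwitzH (D - x ^ 2 - y ^ 2) =
    coeffSum D + ((∑ Q ∈ (indefForms D).filter (fun Q => 0 < Q.1 + Q.2.2), (Q.1 + Q.2.2) : ℤ) : ℝ) -
      κ / 6 := by
  have hrow : ∀ x ∈ (Finset.Icc (-D) D).filter (fun x => x % 2 = D % 2),
      ∑ y ∈ Finset.Icc (-D) D, hurwitzH (D - x ^ 2 - y ^ 2) =
      (if x ^ 2 < D then ∑ y ∈ Finset.Icc (-D) D, hurwitzH (D - x ^ 2 - y ^ 2) else 0) +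
        if x ^ 2 = D then -(1 / 12) else 0 := fun x _ => by
    rcases lt_trichotomy (x ^ 2) D with h1 | h1 | h1
    · rw [if_pos h1, if_neg h1.ne, add_zero]
    · rw [if_neg h1.not_lt, if_pos h1, zero_add, sum_hurwitzH_row_eq_sq hD h1]
    · rw [if_neg h1.not_gt, if_neg h1.ne', add_zero, sum_hurwitzH_row_of_lt h1]
  rw [Finset.sum_congr rfl hrow, Finset.sum_add_distrib, ← Finset.sum_filter, ← Finset.sum_filter,
    Finset.filter_filter, Finset.filter_filter, Finset.sum_const, nsmul_eq_mul,
    card_square_roots hD h]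
  have h1 := Finset.sum_congr rfl fun x (hx : x ∈ middleCoeffs D) => sum_hurwitzH_row hD4 hx
  rw [← Int.cast_sum, ← sum_indefForms hD4
    (fun Q => Q.2.2 + if 0 < Q.1 + Q.2.2 then Q.1 + Q.2.2 else 0), Finset.sum_add_distrib,
    ← Finset.sum_filter, Int.cast_add] at h1
  rw [middleCoeffs] at h1
  rw [h1, coeffSum]
  ring

lemma exists_isSquareData (D : ℤ) (hD : D ≠ 0) : ∃ k κ, IsSquareData D k κ := by
  by_cases h : ∃ k : ℤ, k ^ 2 = D
  · obtain ⟨k, hk⟩ := h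
    refine ⟨k.natAbs, 1, ?_, Or.inl ⟨rfl, by rw [Int.natCast_natAbs, sq_abs, hk]⟩⟩
    rw [Int.natAbs_pos]
    rintro rfl
    exact hD (by rw [← hk]; rfl)
  · exact ⟨1, 0, one_pos, Or.inr ⟨rfl, h⟩⟩

lemma LFunction_neg_one_eq_meanValue {D₀ : ℤ} (hf : IsFundamentalDiscriminant D₀) {f : ℕ} (hf0 : f ≠ 0)
    (hD : 0 < D₀ * f ^ 2) [NeZero D₀.natAbs] (χ : DirichletCharacter ℂ D₀.natAbs)
    (hχ : ∀ n : ℕ, χ (n : ZMod D₀.natAbs) = kroneckerSym D₀ n) {k : ℕ} {κ : ℝ}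
    (h : IsSquareData (D₀ * f ^ 2) k κ) :
    -5 * (DirichletCharacter.LFunction χ (-1) * RootCount.twistedSigma χ f) =
      meanValue (D₀ * f ^ 2) k κ := by
  have h0 : 0 < D₀ := pos_of_mul_pos_left hD (by positivity)
  obtain ⟨g, hg, hχg⟩ := GaussSign.exists_isGaussEigen_char hf h0 χ hχ
  have hN : ((D₀.natAbs : ℕ) : ℤ) = D₀ := by rw [Int.natCast_natAbs, abs_of_pos h0]
  have hNR : ((D₀.natAbs : ℕ) : ℝ) = D₀ := by
    rw [← Int.cast_natCast, hN]
  have hNC : ((D₀.natAbs : ℕ) : ℂ) = D₀ := by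
    rw [← Int.cast_natCast, hN]
  rw [RootCount.meanValue_eq hf hf0 hD χ hχ h, GaussSign.LFunction_neg_one hg hχg, hNR, hNC]
  push_cast
  ring

end DiscriminantSum

open scoped Classical in
theorem statement3
    (D : ℤ) (hD : 0 < D) (hDmod : D % 4 = 0 ∨ D % 4 = 1)
    -- the decomposition D = D₀·f² with D₀ a fundamental discriminant
    (D₀ : ℤ) (f : ℕ) (hf : 0 < f)
    (hfund : IsFundamentalDiscriminant D₀) (hdec : D = D₀ * (f : ℤ) ^ 2) [NeZero D₀.natAbs]
    -- χ is the Kronecker symbol (D₀/·) as a Dirichlet character modulo |D₀|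
    (χ : DirichletCharacter ℂ D₀.natAbs)
    (hχ : ∀ n : ℕ, χ (n : ZMod D₀.natAbs) = kroneckerSym D₀ n)
    -- L_D(−1) = L_{D₀}(−1)·∑_{d∣f} μ(d)·χ_{D₀}(d)·d·σ₃(f/d)
    (LD : ℂ)
    (hLD : LD = DirichletCharacter.LFunction χ (-1) *
        ∑ d ∈ f.divisors, (ArithmeticFunction.moebius d : ℂ) * (kroneckerSym D₀ d : ℂ) * (d : ℂ) *
          ∑ e ∈ (f / d).divisors, (e : ℂ) ^ 3) :
    -- both sums have only finitely many nonzero terms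
    ({p : ℤ × ℤ | p.1 % 2 = D % 2 ∧ hurwitzH (D - p.1 ^ 2 - p.2 ^ 2) ≠ 0}).Finite ∧
    ({p : ℤ × ℤ × ℤ | p.2.1 ^ 2 - 4 * p.1 * p.2.2 = D ∧ 0 < p.1 + p.2.2 ∧ p.1 < 0}).Finite ∧
    -- the identity (stated in ℂ, since L_D(−1) is a priori a complex number)
    ((∑ᶠ p ∈ {p : ℤ × ℤ | p.1 % 2 = D % 2}, hurwitzH (D - p.1 ^ 2 - p.2 ^ 2) : ℝ) : ℂ)
      = -5 * LD
        + ∑ᶠ p ∈ {p : ℤ × ℤ × ℤ | p.2.1 ^ 2 - 4 * p.1 * p.2.2 = D ∧ 0 < p.1 + p.2.2 ∧ p.1 < 0},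
            ((p.1 + p.2.2 : ℤ) : ℂ)
        - 1 / 12 * (if ∃ k : ℤ, k ^ 2 = D then (1 : ℂ) else 0) * (6 * (D : ℂ) + 1) := by
  have hbox : ∀ p : ℤ × ℤ, hurwitzH (D - p.1 ^ 2 - p.2 ^ 2) ≠ 0 →
      p.1 ∈ Finset.Icc (-D) D ∧ p.2 ∈ Finset.Icc (-D) D := by
    intro p hp
    have hle : 0 ≤ D - p.1 ^ 2 - p.2 ^ 2 := by
      by_contra h
      exact hp (ClassNumberRelation.hurwitzH_neg (not_le.1 h))
    simp only [Finset.mem_Icc]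
    refine ⟨⟨?_, ?_⟩, ?_, ?_⟩ <;> nlinarith [sq_nonneg p.1, sq_nonneg p.2, sq_nonneg (p.1 - 1),
      sq_nonneg (p.1 + 1), sq_nonneg (p.2 - 1), sq_nonneg (p.2 + 1)]
  have hforms : {p : ℤ × ℤ × ℤ | p.2.1 ^ 2 - 4 * p.1 * p.2.2 = D ∧ 0 < p.1 + p.2.2 ∧ p.1 < 0} =
      ((ZagierSum.indefForms D).filter (fun Q => 0 < Q.1 + Q.2.2) : Finset (ℤ × ℤ × ℤ)) := by
    ext p
    simp only [Set.mem_ofPred_eq, Finset.coe_filter, ZagierSum.mem_indefForms]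
    constructor
    · rintro ⟨h1, h2, h3⟩
      exact ⟨⟨h1, h3, by omega⟩, h2⟩
    · rintro ⟨⟨h1, h2, h3⟩, h4⟩
      exact ⟨h1, h4, h2⟩
  refine ⟨?_, hforms ▸ Finset.finite_toSet _, ?_⟩
  · refine (Finset.finite_toSet (Finset.Icc (-D) D ×ˢ Finset.Icc (-D) D)).subset fun p hp => ?_
    simpa only [Finset.mem_coe, Finset.mem_product] using hbox p hp.2
  · obtain ⟨k, κ, hsq⟩ := DiscriminantSum.exists_isSquareData D hD.ne'
    have hsum : ∑ᶠ p ∈ {p : ℤ × ℤ | p.1 % 2 = D % 2}, hurwitzH (D - p.1 ^ 2 - p.2 ^ 2) =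
        ∑ p ∈ (Finset.Icc (-D) D).filter (fun x => x % 2 = D % 2) ×ˢ Finset.Icc (-D) D,
          hurwitzH (D - p.1 ^ 2 - p.2 ^ 2) := by
      refine finsum_mem_eq_sum_of_inter_support_eq _ ?_
      ext p
      simp only [Set.mem_inter_iff, Set.mem_ofPred_eq, Function.mem_support, Finset.mem_coe,
        Finset.mem_product, Finset.mem_filter, and_congr_left_iff]
      intro hp
      obtain ⟨h1, h2⟩ := hbox p hp
      tauto
    have hLD' : -5 * LD = ZagierSum.meanValue D k κ := by
      subst hdec
      rw [← DiscriminantSum.LFunction_neg_one_eq_meanValue hfund hf.ne' hD χ hχ hsq, hLD,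
        RootCount.twistedSigma_apply]
      simp only [hχ]
    have hκ : (κ : ℂ) = if ∃ k : ℤ, k ^ 2 = D then (1 : ℂ) else 0 := by
      obtain ⟨-, ⟨rfl, h⟩ | ⟨rfl, h⟩⟩ := hsq
      · rw [if_pos ⟨k, h⟩, ofReal_one]
      · rw [if_neg h, ofReal_zero]
    have hκk : (κ : ℂ) * (k : ℂ) ^ 2 = κ * D := by
      obtain ⟨-, ⟨rfl, h⟩ | ⟨rfl, -⟩⟩ := hsq
      · rw [← h]
        push_cast
        ring
      · simp
    rw [hsum, Finset.sum_product, DiscriminantSum.sum_hurwitzH hD hDmod hsq, hLD', hforms,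
      finsum_mem_coe_finset, ← hκ, ZagierSum.meanValue]
    push_cast
    linear_combination -hκk / 2
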